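/- Fix T > 0. Let W ∈ L¹([0,T]×[0,1]²;ℝ) satisfy W ≥ 0 and W(t,x,y) = W(t,y,x) a.e.; let β, γ ∈ L^∞([0,T]×[0,1]) with β, γ ≥ 0 a.e.; let s₀, i₀, r₀ ∈ L^∞([0,1]) with 0 ≤ s₀, i₀, r₀ ≤ 1 and s₀ + i₀ + r₀ = 1 a.e. For each n define β^n_j(t) := ⟨β(t,·)⟩_{I^n_j}, γ^n_j(t) := ⟨γ(t,·)⟩_{I^n_j}, A^n_{jk}(t) := ⟨W(t,·,·)⟩_{I^n_j×I^n_k}, s^n_{j,0} := ⟨s₀⟩_{I^n_j}, i^n_{j,0} := ⟨i₀⟩_{I^n_j}, r^n_{j,0} := ⟨r₀⟩_{I^n_j}, and let (s^n, i^n, r^n) be the step-function form of the solution of the graph SIR system with these coefficients and initial data. Let (s,i,r) be a distributional solution of the continuum SIR system with kernel W and initial data (s₀,i₀,r₀) satisfying 0 ≤ s, i, r ≤ 1 and s + i + r = 1 a.e. If moreover W ∈ L²([0,T]×[0,1]²;ℝ), then lim_{n→∞} esssup_{t∈[0,T]} ( ‖s(t,·) − s^n(t,·)‖_{L²(0,1)}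 + ‖i(t,·) − i^n(t,·)‖_{L²(0,1)} + ‖r(t,·) − r^n(t,·)‖_{L²(0,1)} ) = 0. -/

import Mathlib

open MeasureTheory Real Filter Set

noncomputable section

/-- The subinterval `I^n_j = (j/n, (j+1)/n)` of `(0,1)`, for `j : Fin n`
(corresponding to `((j-1)/n, j/n)` in one-based indexing). -/
def Inj (n : ℕ) (j : Fin n) : Set ℝ := Set.Ioo ((j : ℝ) / n) (((j : ℝ) + 1) / n)

/-- Step function on `[0,1]` associated with a vector `v : Fin n → ℝ`. -/
def stepFn (n : ℕ) (v : Fin n → ℝ) (x : ℝ) : ℝ :=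
  ∑ j : Fin n, Set.indicator (Inj n j) (fun _ => v j) x

/-- Step kernel (step graphon) on `[0,1]²` associated with a matrix. -/
def stepKer (n : ℕ) (A : Fin n → Fin n → ℝ) (x y : ℝ) : ℝ :=
  ∑ j : Fin n, ∑ k : Fin n,
    Set.indicator (Inj n j) (fun _ => Set.indicator (Inj n k) (fun _ => A j k) y) x

/-- Average `⟨u⟩_{I^n_j} = n ∫_{I^n_j} u`. -/
def avg1 (n : ℕ) (j : Fin n) (u : ℝ → ℝ) : ℝ := (n : ℝ) * ∫ x in Inj n j, u x

/-- Average `⟨U⟩_{I^n_j × I^n_k} = n² ∬_{I^n_j × I^n_k} U`. -/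
def avg2 (n : ℕ) (j k : Fin n) (U : ℝ → ℝ → ℝ) : ℝ :=
  (n : ℝ) ^ 2 * ∫ x in Inj n j, ∫ y in Inj n k, U x y

/-- Carathéodory (integral-form) solutions of the graph SIR system on a time set `J`. -/
def IsGraphSIRSol (n : ℕ) (J : Set ℝ) (β γ : Fin n → ℝ → ℝ)
    (A : Fin n → Fin n → ℝ → ℝ) (s i r : Fin n → ℝ → ℝ) : Prop :=
  (∀ j : Fin n, ContinuousOn (s j) J ∧ ContinuousOn (i j) J ∧ ContinuousOn (r j) J) ∧
  ∀ j : Fin n, ∀ t ∈ J,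
    (s j t = s j 0 - ∫ τ in (0:ℝ)..t,
        s j τ * (1 / (n : ℝ) * ∑ k : Fin n, β k τ * A j k τ * i k τ)) ∧
    (i j t = i j 0 + ∫ τ in (0:ℝ)..t,
        (s j τ * (1 / (n : ℝ) * ∑ k : Fin n, β k τ * A j k τ * i k τ) - γ j τ * i j τ)) ∧
    (r j t = r j 0 + ∫ τ in (0:ℝ)..t, γ j τ * i j τ)

/-- Smooth test functions on `[0,T) × [0,1]` (vanishing for `t` close to `T`). -/
def IsTest (T : ℝ) (φ : ℝ → ℝ → ℝ) : Prop :=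
  ContDiff ℝ (⊤ : ℕ∞) (fun p : ℝ × ℝ => φ p.1 p.2) ∧ ∃ T' : ℝ, T' < T ∧ ∀ t x : ℝ, T' ≤ t → φ t x = 0

/-- Distributional solutions of the continuum SIR system on `[0,T] × [0,1]`
with kernel `W`, coefficients `β, γ` and initial data `(s₀, i₀, r₀)`. -/
def IsDistribSol (T : ℝ) (W : ℝ → ℝ → ℝ → ℝ) (β γ : ℝ → ℝ → ℝ)
    (s0 i0 r0 : ℝ → ℝ) (s i r : ℝ → ℝ → ℝ) : Prop :=
  Measurable (fun p : ℝ × ℝ => s p.1 p.2) ∧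
  Measurable (fun p : ℝ × ℝ => i p.1 p.2) ∧
  Measurable (fun p : ℝ × ℝ => r p.1 p.2) ∧
  (∀ φ : ℝ → ℝ → ℝ, IsTest T φ →
    (∫ t in Set.Icc (0:ℝ) T, ∫ x in Set.Icc (0:ℝ) 1,
        s t x * (deriv (fun τ => φ τ x) t
          - φ t x * ∫ y in Set.Icc (0:ℝ) 1, β t y * W t x y * i t y))
      + (∫ x in Set.Icc (0:ℝ) 1, s0 x * φ 0 x) = 0) ∧
  (∀ ψ : ℝ → ℝ → ℝ, IsTest T ψ →
    (∫ t in Set.Icc (0:ℝ) T, ∫ x in Set.Icc (0:ℝ) 1,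
        (i t x * (deriv (fun τ => ψ τ x) t - γ t x * ψ t x)
          + s t x * ψ t x * ∫ y in Set.Icc (0:ℝ) 1, β t y * W t x y * i t y))
      + (∫ x in Set.Icc (0:ℝ) 1, i0 x * ψ 0 x) = 0) ∧
  (∀ η : ℝ → ℝ → ℝ, IsTest T η →
    (∫ t in Set.Icc (0:ℝ) T, ∫ x in Set.Icc (0:ℝ) 1,
        (r t x * deriv (fun τ => η τ x) t + γ t x * η t x * i t x))
      + (∫ x in Set.Icc (0:ℝ) 1, r0 x * η 0 x) = 0)

/-- The cut norm of a kernel on `[0,1]²`. -/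
def cutNorm (U : ℝ → ℝ → ℝ) : ℝ :=
  sSup { c : ℝ | ∃ S T : Set ℝ, MeasurableSet S ∧ MeasurableSet T ∧
    S ⊆ Set.Icc 0 1 ∧ T ⊆ Set.Icc 0 1 ∧ c = |∫ x in S, ∫ y in T, U x y| }

/-- `L²(0,1)` distance. -/
def L2dist (f g : ℝ → ℝ) : ℝ := Real.sqrt (∫ x in Set.Icc (0:ℝ) 1, (f x - g x) ^ 2)

/-- `L¹(0,1)` distance. -/
def L1dist (f g : ℝ → ℝ) : ℝ := ∫ x in Set.Icc (0:ℝ) 1, |f x - g x|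



lemma ac_exp_neg {A : ℝ → ℝ} {a b : ℝ} (hA : AbsolutelyContinuousOnInterval A a b)
    (h0 : ∀ x ∈ uIcc a b, 0 ≤ A x) :
    AbsolutelyContinuousOnInterval (fun x => Real.exp (-(A x))) a b := by
  have key : ∀ u v : ℝ, 0 ≤ u → 0 ≤ v → |Real.exp (-u) - Real.exp (-v)| ≤ |u - v| := by
    have aux : ∀ u v : ℝ, 0 ≤ u → u ≤ v → |Real.exp (-u) - Real.exp (-v)| ≤ |u - v| := by
      intro u v hu huv
      have h1 : Real.exp (-v) ≤ Real.exp (-u) := Real.exp_le_exp.2 (by linarith)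
      rw [abs_of_nonneg (by linarith), abs_of_nonpos (by linarith)]
      have h2 : Real.exp (-v) = Real.exp (-u) * Real.exp (-(v-u)) := by
        rw [← Real.exp_add]; ring_nf
      have h3 := Real.add_one_le_exp (-(v-u))
      have h4 : Real.exp (-u) ≤ 1 := Real.exp_le_one_iff.2 (by linarith)
      have h5 := Real.exp_pos (-u)
      rw [h2]
      nlinarith
    intro u v hu hv
    rcases le_total u v with h | h
    · exact aux u v hu h
    · rw [abs_sub_comm, abs_sub_comm u v]; exact aux v u hv h
  unfold AbsolutelyContinuousOnInterval at *
  refine squeeze_zero' ?_ ?_ hA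
  · filter_upwards with E
    exact Finset.sum_nonneg (fun _ _ ↦ dist_nonneg)
  · have : ∀ᶠ (E : ℕ × (ℕ → ℝ × ℝ)) in AbsolutelyContinuousOnInterval.totalLengthFilter ⊓ 𝓟 (AbsolutelyContinuousOnInterval.disjWithin a b),
      E ∈ AbsolutelyContinuousOnInterval.disjWithin a b :=
      eventually_inf_principal.mpr (by simp)
    filter_upwards [this] with E hE
    refine Finset.sum_le_sum fun i hi => ?_
    have := hE.1 i hi
    simp only [Real.dist_eq]
    exact key _ _ (h0 _ this.1) (h0 _ this.2)

/-- integral Gronwall inequality with an integrable kernel -/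
lemma gronwall_L1 {T b : ℝ} (hT : 0 < T) {a f : ℝ → ℝ}
    (ha : IntegrableOn a (Icc 0 T)) (ha0 : ∀ t, 0 ≤ a t)
    (haf : IntegrableOn (fun t => a t * f t) (Icc 0 T))
    (hf : ∀ᵐ t ∂(volume.restrict (Icc (0:ℝ) T)), f t ≤ b + ∫ τ in (0:ℝ)..t, a τ * f τ) :
    ∀ t ∈ Icc 0 T, b + ∫ τ in (0:ℝ)..t, a τ * f τ ≤ b * Real.exp (∫ τ in (0:ℝ)..t, a τ) := by
  intro t ht
  have ii : ∀ g : ℝ → ℝ, IntegrableOn g (Icc 0 T) → IntervalIntegrable g volume 0 t := by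
    intro g hg
    rw [intervalIntegrable_iff_integrableOn_Icc_of_le ht.1]
    exact hg.mono_set (Icc_subset_Icc le_rfl ht.2)
  have ia := ii _ ha
  have iaf := ii _ haf
  set A : ℝ → ℝ := fun t => ∫ τ in (0:ℝ)..t, a τ with hAdef
  set H : ℝ → ℝ := fun t => ∫ τ in (0:ℝ)..t, a τ * f τ with hHdef
  have acA : AbsolutelyContinuousOnInterval A 0 t :=
    ia.absolutelyContinuousOnInterval_intervalIntegral (by simp)
  have acH0 : AbsolutelyContinuousOnInterval H 0 t :=
    iaf.absolutelyContinuousOnInterval_intervalIntegral (by simp)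
  have acH : AbsolutelyContinuousOnInterval (fun x => b + H x) 0 t := by
    have hb : AbsolutelyContinuousOnInterval (fun _ : ℝ => b) 0 t := by
      refine LipschitzOnWith.absolutelyContinuousOnInterval (K := 0) ?_
      intro x _ y _; simp
    exact hb.add acH0
  have acE : AbsolutelyContinuousOnInterval (fun x => Real.exp (-(A x))) 0 t := by
    refine ac_exp_neg acA ?_
    intro x hx
    rw [uIcc_of_le ht.1] at hx
    exact intervalIntegral.integral_nonneg hx.1 (fun u _ => ha0 u)
  have acK := acH.mul acE
  have hK := acK.integral_deriv_eq_sub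
  have hle : ∫ x in (0:ℝ)..t, deriv ((fun x => b + H x) * fun x => Real.exp (-(A x))) x ≤ 0 := by
    have : ∫ x in (0:ℝ)..t, deriv ((fun x => b + H x) * fun x => Real.exp (-(A x))) x ≤ ∫ x in (0:ℝ)..t, (0:ℝ) := by
      refine intervalIntegral.integral_mono_ae_restrict ht.1 acK.intervalIntegrable_deriv (by simp) ?_
      have h1 := ae_restrict_of_ae (s := Icc 0 t) ia.ae_hasDerivAt_integral
      have h2 := ae_restrict_of_ae (s := Icc 0 t) iaf.ae_hasDerivAt_integral
      have h3 := ae_restrict_of_ae_restrict_of_subset (Icc_subset_Icc (le_refl (0:ℝ)) ht.2) hf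
      filter_upwards [h1, h2, h3, ae_restrict_mem measurableSet_Icc] with x h1 h2 h3 hx
      have hx' : x ∈ uIcc 0 t := by rwa [uIcc_of_le ht.1]
      have d1 := h1 hx' 0 (by simp)
      have d2 := h2 hx' 0 (by simp)
      have d3 := (d2.const_add b).mul (d1.neg.exp)
      have : deriv ((fun x => b + H x) * fun x => Real.exp (-(A x))) x = _ := d3.deriv
      rw [this]
      have := ha0 x
      have e := Real.exp_pos (-(A x))
      have h4 : a x * f x ≤ a x * (b + H x) := mul_le_mul_of_nonneg_left h3 this
      have : (a x * f x - a x * (b + H x)) * Real.exp (-(A x)) ≤ 0 :=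
        mul_nonpos_of_nonpos_of_nonneg (by linarith) e.le
      show a x * f x * Real.exp (-(A x)) + (b + H x) * (Real.exp (-(A x)) * -a x) ≤ 0
      linarith
    simpa using this
  rw [hK] at hle
  simp only [Pi.mul_apply] at hle
  have A0 : A 0 = 0 := by simp [hAdef]
  have H0 : H 0 = 0 := by simp [hHdef]
  rw [A0, H0] at hle
  simp only [add_zero, neg_zero, Real.exp_zero, mul_one, sub_nonpos] at hle
  rw [Real.exp_neg, ← div_eq_mul_inv, div_le_iff₀ (Real.exp_pos _)] at hle
  exact hle

/-- last zero comparison lemma -/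
lemma pos_part_le {T : ℝ} (hT : 0 < T) {u g h : ℝ → ℝ}
    (ig : IntegrableOn g (Icc 0 T)) (ih : IntegrableOn h (Icc 0 T))
    (hu : ∀ t ∈ Icc 0 T, u t = u 0 + ∫ τ in (0:ℝ)..t, g τ)
    (hh : ∀ᵐ t ∂(volume.restrict (Icc (0:ℝ) T)), 0 ≤ h t)
    (hg : ∀ᵐ t ∂(volume.restrict (Icc (0:ℝ) T)), 0 < u t → g t ≤ h t) :
    ∀ t ∈ Icc 0 T, max (u t) 0 ≤ max (u 0) 0 + ∫ τ in (0:ℝ)..t, h τ := by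
  intro t ht
  have ii : ∀ g : ℝ → ℝ, IntegrableOn g (Icc 0 T) → ∀ x ∈ Icc 0 T, ∀ y ∈ Icc 0 T, x ≤ y → IntervalIntegrable g volume x y := by
    intro g hg x hx y hy hxy
    rw [intervalIntegrable_iff_integrableOn_Icc_of_le hxy]
    exact hg.mono_set (Icc_subset_Icc hx.1 hy.2)
  have z : (0:ℝ) ∈ Icc 0 T := ⟨le_rfl, hT.le⟩
  have hint0 : ∀ x ∈ Icc 0 T, ∀ y ∈ Icc 0 T, x ≤ y → 0 ≤ ∫ τ in x..y, h τ := by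
    intro x hx y hy hxy
    refine intervalIntegral.integral_nonneg_of_ae_restrict hxy ?_
    exact ae_restrict_of_ae_restrict_of_subset (Icc_subset_Icc hx.1 hy.2) hh
  have hcont : ContinuousOn u (Icc 0 T) := by
    have : ContinuousOn (fun t => u 0 + ∫ τ in (0:ℝ)..t, g τ) (Icc 0 T) := by
      refine continuousOn_const.add ?_
      have := intervalIntegral.continuousOn_primitive_interval (μ := volume) (a := 0) (b := T) (f := g) (by rwa [uIcc_of_le hT.le])
      rwa [uIcc_of_le hT.le] at this
    exact this.congr hu
  have cmp : ∀ x ∈ Icc 0 T, x ≤ t → (∀ y ∈ Ioc x t, 0 < u y) → u t ≤ u x + ∫ τ in x..t, h τ := by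
    intro x hx hxt hpos
    have e1 : u t - u x = ∫ τ in x..t, g τ := by
      rw [hu t ht, hu x hx]
      rw [← intervalIntegral.integral_interval_sub_left (ii g ig 0 z t ht ht.1) (ii g ig 0 z x hx hx.1)]
      ring
    have : ∫ τ in x..t, g τ ≤ ∫ τ in x..t, h τ := by
      rw [intervalIntegral.integral_of_le hxt, intervalIntegral.integral_of_le hxt]
      refine setIntegral_mono_ae_restrict (ig.mono_set ?_) (ih.mono_set ?_) ?_
      · exact Ioc_subset_Icc_self.trans (Icc_subset_Icc hx.1 ht.2)
      · exact Ioc_subset_Icc_self.trans (Icc_subset_Icc hx.1 ht.2)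
      · have := ae_restrict_of_ae_restrict_of_subset (Ioc_subset_Icc_self.trans (Icc_subset_Icc hx.1 ht.2)) hg
        filter_upwards [this, ae_restrict_mem measurableSet_Ioc] with y h1 h2
        exact h1 (hpos y h2)
    linarith
  by_cases hut : u t ≤ 0
  · rw [max_eq_right hut]
    exact add_nonneg (le_max_right _ _) (hint0 0 z t ht ht.1)
  push Not at hut
  rw [max_eq_left hut.le]
  by_cases hex : ∃ x ∈ Icc 0 t, u x ≤ 0
  · set Z := {x ∈ Icc 0 t | u x ≤ 0} with hZ
    have hZc : IsClosed Z := by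
      have := (hcont.mono (Icc_subset_Icc (le_refl (0:ℝ)) ht.2)).preimage_isClosed_of_isClosed isClosed_Icc (isClosed_Iic (a := (0:ℝ)))
      exact this
    have hZne : Z.Nonempty := by obtain ⟨x, h1, h2⟩ := hex; exact ⟨x, h1, h2⟩
    have hZb : BddAbove Z := ⟨t, fun x hx => hx.1.2⟩
    have hm := hZc.csSup_mem hZne hZb
    set x := sSup Z
    have hxT : x ∈ Icc 0 T := ⟨hm.1.1, hm.1.2.trans ht.2⟩
    have := cmp x hxT hm.1.2 (by
      intro y hy
      by_contra hcon
      push Not at hcon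
      have : y ≤ x := le_csSup hZb ⟨⟨hm.1.1.trans hy.1.le, hy.2⟩, hcon⟩
      exact absurd hy.1 (not_lt.2 this))
    have e2 := intervalIntegral.integral_add_adjacent_intervals (ii h ih 0 z x hxT hxT.1) (ii h ih x hxT t ht hm.1.2)
    have e3 := hint0 0 z x hxT hxT.1
    have e4 : 0 ≤ max (u 0) 0 := le_max_right _ _
    have e5 := hm.2
    linarith
  · push Not at hex
    have := cmp 0 z ht.1 (fun y hy => hex y ⟨hy.1.le, hy.2⟩)
    have e4 : u 0 ≤ max (u 0) 0 := le_max_left _ _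
    linarith


lemma discrete_bounds {n : ℕ} {T : ℝ} (hT : 0 < T) {β γ : Fin n → ℝ → ℝ}
    {A : Fin n → Fin n → ℝ → ℝ} {s i r : Fin n → ℝ → ℝ}
    (hsol : IsGraphSIRSol n (Icc 0 T) β γ A s i r)
    (hβ0 : ∀ k t, 0 ≤ β k t) (hA0 : ∀ j k t, 0 ≤ A j k t) (hγ0 : ∀ k t, 0 ≤ γ k t)
    (iβA : ∀ j k, IntegrableOn (fun t => β k t * A j k t) (Icc 0 T))
    (iγ : ∀ j, IntegrableOn (γ j) (Icc 0 T))
    (hs0 : ∀ j, 0 ≤ s j 0 ∧ s j 0 ≤ 1) (hi0 : ∀ j, 0 ≤ i j 0) :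
    ∀ j, ∀ t ∈ Icc 0 T, (0 ≤ s j t ∧ s j t ≤ 1) ∧ 0 ≤ i j t ∧
      s j t + i j t + r j t = s j 0 + i j 0 + r j 0 := by
  obtain ⟨hcont, heq⟩ := hsol
  set F : Fin n → ℝ → ℝ := fun j τ => 1 / (n : ℝ) * ∑ k : Fin n, β k τ * A j k τ * i k τ with hF
  have iF : ∀ j, IntegrableOn (F j) (Icc 0 T) := by
    intro j
    refine Integrable.const_mul ?_ _
    refine integrable_finsetSum _ fun k _ => ?_
    exact (iβA j k).mul_continuousOn (hcont k).2.1 isCompact_Icc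
  have isF : ∀ j, IntegrableOn (fun τ => s j τ * F j τ) (Icc 0 T) := fun j =>
    (iF j).continuousOn_mul (hcont j).1 isCompact_Icc
  have iγi : ∀ j, IntegrableOn (fun τ => γ j τ * i j τ) (Icc 0 T) := fun j =>
    (iγ j).mul_continuousOn (hcont j).2.1 isCompact_Icc
  have ii : ∀ g : ℝ → ℝ, IntegrableOn g (Icc 0 T) → ∀ y ∈ Icc 0 T, IntervalIntegrable g volume 0 y := by
    intro g hg y hy
    rw [intervalIntegrable_iff_integrableOn_Icc_of_le hy.1]
    exact hg.mono_set (Icc_subset_Icc le_rfl hy.2)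
  -- nonnegativity of s
  have s_nonneg : ∀ j, ∀ t ∈ Icc 0 T, 0 ≤ s j t := by
    intro j t ht
    have hm : ContinuousOn (fun τ => max (-(s j τ)) 0) (Icc 0 T) :=
      ((hcont j).1.neg).sup continuousOn_const
    have iaf : IntegrableOn (fun τ => |F j τ| * max (-(s j τ)) 0) (Icc 0 T) :=
      IntegrableOn.mul_continuousOn (iF j).abs hm isCompact_Icc
    have h1 := pos_part_le hT (u := fun t => -(s j t)) (g := fun τ => s j τ * F j τ)
      (h := fun τ => |F j τ| * max (-(s j τ)) 0) (isF j) iaf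
      (by intro t ht; have := (heq j t ht).1; simp only [hF]; linarith)
      (ae_of_all _ fun τ => mul_nonneg (abs_nonneg _) (le_max_right _ _))
      (ae_of_all _ fun τ hτ => by
        rw [max_eq_left hτ.le]
        nlinarith [neg_abs_le (F j τ)])
    have h0 : max (-(s j 0)) 0 = 0 := max_eq_right (by linarith [(hs0 j).1])
    simp only [h0] at h1
    have h2 := gronwall_L1 (b := 0) (a := fun τ => |F j τ|) (f := fun τ => max (-(s j τ)) 0) hT
      (iF j).abs (fun _ => abs_nonneg _) iaf
      (by filter_upwards [ae_restrict_mem measurableSet_Icc] with τ hτ using h1 τ hτ) t ht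
    have h3 := h1 t ht
    have h4 : -(s j t) ≤ max (-(s j t)) 0 := le_max_left _ _
    simp only [zero_mul] at h2
    linarith
  -- nonnegativity of i
  set c : Fin n → Fin n → ℝ → ℝ := fun j k τ => s j τ * (1 / (n:ℝ) * (β k τ * A j k τ)) with hc
  have ic : ∀ j k, IntegrableOn (c j k) (Icc 0 T) := fun j k =>
    IntegrableOn.continuousOn_mul (hcont j).1 ((iβA j k).const_mul _) isCompact_Icc
  have c0 : ∀ j k, ∀ τ ∈ Icc 0 T, 0 ≤ c j k τ := fun j k τ hτ =>
    mul_nonneg (s_nonneg j τ hτ) (mul_nonneg (by positivity) (mul_nonneg (hβ0 _ _) (hA0 _ _ _)))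
  set m : Fin n → ℝ → ℝ := fun k τ => max (-(i k τ)) 0 with hmdef
  have m0 : ∀ k τ, 0 ≤ m k τ := fun k τ => le_max_right _ _
  have hm : ∀ k, ContinuousOn (m k) (Icc 0 T) := fun k =>
    ((hcont k).2.1.neg).sup continuousOn_const
  have icm : ∀ j k, IntegrableOn (fun τ => c j k τ * m k τ) (Icc 0 T) := fun j k =>
    (ic j k).mul_continuousOn (hm k) isCompact_Icc
  have i1 : ∀ j, ∀ t ∈ Icc 0 T, m j t ≤ ∫ τ in (0:ℝ)..t, ∑ k, c j k τ * m k τ := by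
    intro j
    have h1 := pos_part_le hT (u := fun t => -(i j t)) (g := fun τ => -(s j τ * F j τ - γ j τ * i j τ))
      (h := fun τ => ∑ k, c j k τ * m k τ) ((isF j).sub (iγi j)).neg
      (integrable_finsetSum _ fun k _ => icm j k)
      (by
        intro t ht
        have := (heq j t ht).2.1
        rw [intervalIntegral.integral_neg]
        simp only [hF]; linarith)
      (by
        filter_upwards [ae_restrict_mem measurableSet_Icc] with τ hτ
        exact Finset.sum_nonneg fun k _ => mul_nonneg (c0 j k τ hτ) (m0 k τ))
      (by
        filter_upwards [ae_restrict_mem measurableSet_Icc] with τ hτ hpos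
        have e1 : s j τ * F j τ = ∑ k, c j k τ * i k τ := by
          simp only [hF, hc, Finset.mul_sum]
          refine Finset.sum_congr rfl fun k _ => by ring
        have e2 : -(∑ k, c j k τ * i k τ) ≤ ∑ k, c j k τ * m k τ := by
          rw [← Finset.sum_neg_distrib]
          refine Finset.sum_le_sum fun k _ => ?_
          have : -(i k τ) ≤ m k τ := le_max_left _ _
          nlinarith [c0 j k τ hτ]
        have e3 : γ j τ * i j τ ≤ 0 := mul_nonpos_of_nonneg_of_nonpos (hγ0 _ _) (by linarith)
        rw [e1]; linarith)
    have h0 : max (-(i j 0)) 0 = 0 := max_eq_right (by linarith [hi0 j])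
    simp only [h0, zero_add] at h1
    exact h1
  have i_nonneg : ∀ j, ∀ t ∈ Icc 0 T, 0 ≤ i j t := by
    have iaf : IntegrableOn (fun τ => (∑ j, ∑ k, |c j k τ|) * ∑ k, m k τ) (Icc 0 T) := by
      refine IntegrableOn.mul_continuousOn ?_ (continuousOn_finsetSum _ fun k _ => hm k) isCompact_Icc
      exact integrable_finsetSum _ fun j _ => integrable_finsetSum _ fun k _ => (ic j k).abs
    have key : ∀ t ∈ Icc 0 T, ∑ j, m j t ≤ 0 + ∫ τ in (0:ℝ)..t, (∑ j, ∑ k, |c j k τ|) * ∑ k, m k τ := by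
      intro t ht
      rw [zero_add]
      calc ∑ j, m j t ≤ ∑ j, ∫ τ in (0:ℝ)..t, ∑ k, c j k τ * m k τ :=
            Finset.sum_le_sum fun j _ => i1 j t ht
        _ = ∫ τ in (0:ℝ)..t, ∑ j, ∑ k, c j k τ * m k τ := by
            rw [intervalIntegral.integral_finsetSum]
            intro j _
            exact ii _ (integrable_finsetSum _ fun k _ => icm j k) t ht
        _ ≤ _ := by
            refine intervalIntegral.integral_mono_on ht.1 ?_ (ii _ iaf t ht) ?_
            · exact ii _ (integrable_finsetSum _ fun j _ => integrable_finsetSum _ fun k _ => icm j k) t ht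
            · intro τ hτ
              simp only [Finset.sum_mul]
              refine Finset.sum_le_sum fun j _ => Finset.sum_le_sum fun k _ => ?_
              refine mul_le_mul (le_abs_self _) ?_ (m0 _ _) (abs_nonneg _)
              exact Finset.single_le_sum (fun k _ => m0 k τ) (Finset.mem_univ k)
    intro j t ht
    have h2 := gronwall_L1 (b := 0) (a := fun τ => ∑ j, ∑ k, |c j k τ|) (f := fun τ => ∑ k, m k τ) hT
      (integrable_finsetSum _ fun j _ => integrable_finsetSum _ fun k _ => (ic j k).abs)
      (fun _ => Finset.sum_nonneg fun _ _ => Finset.sum_nonneg fun _ _ => abs_nonneg _) iaf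
      (by filter_upwards [ae_restrict_mem measurableSet_Icc] with τ hτ using key τ hτ) t ht
    have h3 := key t ht
    have h4 : -(i j t) ≤ m j t := le_max_left _ _
    have h5 : m j t ≤ ∑ k, m k t := Finset.single_le_sum (fun k _ => m0 k t) (Finset.mem_univ j)
    simp only [zero_mul] at h2
    linarith
  have F0 : ∀ j, ∀ t ∈ Icc 0 T, 0 ≤ F j t := by
    intro j t ht
    refine mul_nonneg (by positivity) (Finset.sum_nonneg fun k _ => ?_)
    exact mul_nonneg (mul_nonneg (hβ0 _ _) (hA0 _ _ _)) (i_nonneg k t ht)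
  intro j t ht
  refine ⟨⟨s_nonneg j t ht, ?_⟩, i_nonneg j t ht, ?_⟩
  · have h1 := (heq j t ht).1
    have h2 : 0 ≤ ∫ τ in (0:ℝ)..t, s j τ * F j τ := by
      refine intervalIntegral.integral_nonneg ht.1 fun τ hτ => ?_
      have hτ' : τ ∈ Icc 0 T := ⟨hτ.1, hτ.2.trans ht.2⟩
      exact mul_nonneg (s_nonneg j τ hτ') (F0 j τ hτ')
    have h3 := (hs0 j).2
    rw [h1]
    simp only [hF] at h2
    linarith
  · obtain ⟨h1, h2, h3⟩ := heq j t ht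
    rw [intervalIntegral.integral_sub (ii _ (isF j) t ht) (ii _ (iγi j) t ht)] at h2
    rw [h1, h2, h3]
    ring


lemma weak_1d {T c : ℝ} (hT : 0 < T) {U G : ℝ → ℝ}
    (iU : IntegrableOn U (Icc 0 T)) (iG : IntegrableOn G (Icc 0 T))
    (h : ∀ θ : ℝ → ℝ, ContDiff ℝ (⊤ : ℕ∞) θ → HasCompactSupport θ → tsupport θ ⊆ Ioo 0 T →
      (∫ t in Icc (0:ℝ) T, (U t * θ t + G t * ∫ τ in T..t, θ τ)) + c * (∫ τ in T..0, θ τ) = 0) :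
    ∀ᵐ t ∂(volume.restrict (Icc (0:ℝ) T)), U t = c + ∫ τ in (0:ℝ)..t, G τ := by
  set H : ℝ → ℝ := fun t => ∫ τ in (0:ℝ)..t, G τ with hH
  have iG' : IntervalIntegrable G volume 0 T := by
    rwa [intervalIntegrable_iff_integrableOn_Icc_of_le hT.le]
  have acH : AbsolutelyContinuousOnInterval H 0 T :=
    iG'.absolutelyContinuousOnInterval_intervalIntegral (by simp)
  have cH : ContinuousOn H (Icc 0 T) := by
    have := acH.continuousOn; rwa [uIcc_of_le hT.le] at this
  have iH : IntegrableOn H (Icc 0 T) := cH.integrableOn_compact isCompact_Icc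
  have main : ∀ᵐ t ∂(volume : Measure ℝ), t ∈ Ioo 0 T → U t - (c + H t) = 0 := by
    refine isOpen_Ioo.ae_eq_zero_of_integral_contDiff_smul_eq_zero ?_ ?_
    · refine IntegrableOn.locallyIntegrableOn ?_
      refine IntegrableOn.mono_set ?_ Ioo_subset_Icc_self
      exact iU.sub ((integrable_const c).add iH)
    · intro θ hθ hcs hsupp
      have cθ : Continuous θ := hθ.continuous
      set Θ : ℝ → ℝ := fun t => ∫ τ in T..t, θ τ with hΘ
      have dΘ : ∀ t, HasDerivAt Θ (θ t) t := fun t =>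
        intervalIntegral.integral_hasDerivAt_right (cθ.intervalIntegrable _ _)
          (cθ.stronglyMeasurableAtFilter _ _) cθ.continuousAt
      have cΘ : ContDiff ℝ 1 Θ := by
        rw [contDiff_one_iff_deriv]
        refine ⟨fun t => (dΘ t).differentiableAt, ?_⟩
        have : deriv Θ = θ := funext fun t => (dΘ t).deriv
        rw [this]; exact cθ
      have acΘ : AbsolutelyContinuousOnInterval Θ 0 T :=
        cΘ.contDiffOn.absolutelyContinuousOnInterval
      have bp := acH.integral_mul_deriv_eq_deriv_mul acΘ
      have ΘT : Θ T = 0 := by simp [hΘ]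
      have H0 : H 0 = 0 := by simp [hH]
      rw [ΘT, H0] at bp
      have e1 : ∫ x in (0:ℝ)..T, H x * deriv Θ x = ∫ x in (0:ℝ)..T, H x * θ x := by
        refine intervalIntegral.integral_congr fun x _ => ?_
        simp only [(dΘ x).deriv]
      have e2 : ∫ x in (0:ℝ)..T, deriv H x * Θ x = ∫ x in (0:ℝ)..T, G x * Θ x := by
        refine intervalIntegral.integral_congr_ae ?_
        filter_upwards [iG'.ae_hasDerivAt_integral] with x hx hx'
        rw [(hx (uIoc_subset_uIcc hx') 0 (by simp)).deriv]
      rw [e1, e2] at bp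
      have toI : ∀ f : ℝ → ℝ, ∫ x in (0:ℝ)..T, f x = ∫ x in Icc 0 T, f x := fun f => by
        rw [intervalIntegral.integral_of_le hT.le, integral_Icc_eq_integral_Ioc]
      rw [toI, toI] at bp
      have hh := h θ hθ hcs hsupp
      have i1 : IntegrableOn (fun t => U t * θ t) (Icc 0 T) := iU.mul_continuousOn cθ.continuousOn isCompact_Icc
      have i2 : IntegrableOn (fun t => G t * Θ t) (Icc 0 T) := iG.mul_continuousOn cΘ.continuous.continuousOn isCompact_Icc
      have i3 : IntegrableOn (fun t => H t * θ t) (Icc 0 T) := iH.mul_continuousOn cθ.continuousOn isCompact_Icc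
      have i4 : IntegrableOn (fun t => c * θ t) (Icc 0 T) := (continuous_const.mul cθ).continuousOn.integrableOn_compact isCompact_Icc
      rw [integral_add i1 i2] at hh
      have e3 : ∫ x, θ x • (U x - (c + H x)) = ∫ x in Icc 0 T, θ x • (U x - (c + H x)) := by
        rw [setIntegral_eq_integral_of_forall_compl_eq_zero]
        intro x hx
        have : x ∉ tsupport θ := fun h => hx (Ioo_subset_Icc_self (hsupp h))
        rw [image_eq_zero_of_notMem_tsupport this, zero_smul]
      have e4 : ∫ x in Icc 0 T, θ x • (U x - (c + H x)) = ∫ x in Icc 0 T, (U x * θ x - c * θ x - H x * θ x) := by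
        refine integral_congr_ae (ae_of_all _ fun x => ?_)
        simp only [smul_eq_mul]; ring
      have i14 : IntegrableOn (fun x => U x * θ x - c * θ x) (Icc 0 T) := i1.sub i4
      rw [e3, e4, integral_sub i14 i3, integral_sub i1 i4, integral_const_mul, ← toI θ]
      have e5 : Θ 0 = - ∫ x in (0:ℝ)..T, θ x := by
        simp only [hΘ]; rw [intervalIntegral.integral_symm]
      have hh' : (∫ t in Icc 0 T, U t * θ t) + (∫ t in Icc 0 T, G t * Θ t) + c * Θ 0 = 0 := hh
      rw [e5] at hh'
      linarith
  have : volume.restrict (Icc (0:ℝ) T) = volume.restrict (Ioo (0:ℝ) T) :=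
    Measure.restrict_congr_set Ioo_ae_eq_Icc.symm
  rw [this]
  filter_upwards [ae_restrict_of_ae main, ae_restrict_mem measurableSet_Ioo] with t h1 h2
  have := h1 h2
  linarith

lemma ae_zero_of_rect {μ ν : Measure ℝ} [IsFiniteMeasure μ] [IsFiniteMeasure ν] {h : ℝ × ℝ → ℝ}
    (ih : Integrable h (ν.prod μ))
    (hr : ∀ B C : Set ℝ, MeasurableSet B → MeasurableSet C → ∫ z in B ×ˢ C, h z ∂(ν.prod μ) = 0) :
    ∀ᵐ z ∂(ν.prod μ), h z = 0 := by
  have key : ∀ S : Set (ℝ × ℝ), MeasurableSet S → ∫ z in S, h z ∂(ν.prod μ) = 0 := by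
    intro S hS
    induction S, hS using MeasurableSpace.induction_on_inter generateFrom_prod.symm isPiSystem_prod with
    | empty => simp
    | basic t ht =>
      obtain ⟨B, hB, C, hC, rfl⟩ := ht
      exact hr B C hB hC
    | compl t ht iht =>
      have h1 := integral_add_compl ht ih
      have h2 := hr univ univ MeasurableSet.univ MeasurableSet.univ
      rw [univ_prod_univ, setIntegral_univ] at h2
      linarith
    | iUnion f hd hf ihf =>
      rw [integral_iUnion hf hd ih.integrableOn]
      simp [ihf]
  exact ih.ae_eq_zero_of_forall_setIntegral_eq_zero (fun S hS _ => key S hS)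

lemma primitive_rep {T : ℝ} (g : ℝ → ℝ) {t : ℝ} (ht : t ∈ Icc 0 T) :
    ∫ τ in (0:ℝ)..t, g τ = ∫ τ in Icc 0 T, (Iic t).indicator g τ := by
  rw [intervalIntegral.integral_of_le ht.1, ← integral_Icc_eq_integral_Ioc,
    setIntegral_indicator measurableSet_Iic]
  congr 2
  ext x; constructor
  · intro hx; exact ⟨⟨hx.1, hx.2.trans ht.2⟩, hx.2⟩
  · intro hx; exact ⟨hx.1.1, hx.2⟩

lemma measurable_primitive_rep {T : ℝ} {g : ℝ → ℝ → ℝ} (hg : Measurable (fun p : ℝ × ℝ => g p.1 p.2)) :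
    Measurable (fun p : ℝ × ℝ => ∫ τ in Icc 0 T, (Iic p.1).indicator (fun τ => g τ p.2) τ) := by
  have : Measurable (fun q : (ℝ × ℝ) × ℝ => (Iic q.1.1).indicator (fun τ => g τ q.1.2) q.2) := by
    have hm : MeasurableSet {q : (ℝ × ℝ) × ℝ | q.2 ≤ q.1.1} :=
      measurableSet_le measurable_snd measurable_fst.fst
    have h2 : Measurable (fun q : (ℝ × ℝ) × ℝ => g q.2 q.1.2) :=
      hg.comp (measurable_snd.prodMk measurable_fst.snd)
    have := h2.indicator hm
    convert this using 2
    simp [indicator]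
  exact (this.stronglyMeasurable.integral_prod_right' (ν := volume.restrict (Icc 0 T))).measurable

lemma weak_2d {T : ℝ} (hT : 0 < T) {u g : ℝ → ℝ → ℝ} {u0 : ℝ → ℝ}
    (hg : Measurable (fun p : ℝ × ℝ => g p.1 p.2))
    (iu : Integrable (fun p : ℝ × ℝ => u p.1 p.2) ((volume.restrict (Icc 0 T)).prod (volume.restrict (Icc (0:ℝ) 1))))
    (ig : Integrable (fun p : ℝ × ℝ => g p.1 p.2) ((volume.restrict (Icc 0 T)).prod (volume.restrict (Icc (0:ℝ) 1))))
    (iu0 : IntegrableOn u0 (Icc 0 1))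
    (hw : ∀ φ : ℝ → ℝ → ℝ, IsTest T φ →
      (∫ t in Icc (0:ℝ) T, ∫ x in Icc (0:ℝ) 1, (u t x * deriv (fun τ => φ τ x) t + g t x * φ t x))
        + (∫ x in Icc (0:ℝ) 1, u0 x * φ 0 x) = 0) :
    ∀ᵐ p ∂((volume.restrict (Icc 0 T)).prod (volume.restrict (Icc (0:ℝ) 1))),
      u p.1 p.2 = u0 p.2 + ∫ τ in (0:ℝ)..p.1, g τ p.2 := by
  set ν := volume.restrict (Icc (0:ℝ) T) with hν
  set μ := volume.restrict (Icc (0:ℝ) 1) with hμ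
  set I : ℝ × ℝ → ℝ := fun p => ∫ τ in Icc 0 T, (Iic p.1).indicator (fun τ => g τ p.2) τ with hI
  have mI : Measurable I := measurable_primitive_rep hg
  have iI : Integrable I (ν.prod μ) := by
    have hb : Integrable (fun p : ℝ × ℝ => ∫ τ, ‖g τ p.2‖ ∂ν) (ν.prod μ) :=
      Integrable.comp_snd (f := fun x => ∫ τ, ‖g τ x‖ ∂ν) ig.integral_norm_prod_right ν
    refine hb.mono mI.aestronglyMeasurable ?_
    have hx : ∀ᵐ x ∂μ, Integrable (fun τ => g τ x) ν := ig.prod_left_ae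
    have hx' : ∀ᵐ p ∂(ν.prod μ), Integrable (fun τ => g τ p.2) ν :=
      Measure.quasiMeasurePreserving_snd.ae hx
    filter_upwards [hx'] with p hp
    rw [Real.norm_of_nonneg (integral_nonneg fun _ => norm_nonneg _)]
    refine (norm_integral_le_integral_norm _).trans ?_
    refine integral_mono_ae ?_ hp.norm (ae_of_all _ fun τ => ?_)
    · exact (hp.indicator measurableSet_Iic).norm
    · exact norm_indicator_le_norm_self _ _
  set h : ℝ × ℝ → ℝ := fun p => u p.1 p.2 - (u0 p.2 + I p) with hh
  have ih : Integrable h (ν.prod μ) := iu.sub ((Integrable.comp_snd iu0 ν).add iI)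
  have step1 : ∀ χ : ℝ → ℝ, ContDiff ℝ (⊤ : ℕ∞) χ → HasCompactSupport χ →
      ∀ᵐ t ∂ν, ∫ x, χ x * h (t, x) ∂μ = 0 := by
    intro χ hχ hcs
    obtain ⟨M, hM⟩ := hcs.exists_bound_of_continuous hχ.continuous
    have mχ : AEStronglyMeasurable (fun p : ℝ × ℝ => χ p.2) (ν.prod μ) :=
      (hχ.continuous.comp continuous_snd).aestronglyMeasurable
    have bχ : ∀ f : ℝ × ℝ → ℝ, Integrable f (ν.prod μ) → Integrable (fun p => χ p.2 * f p) (ν.prod μ) :=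
      fun f hf => hf.bdd_mul mχ (ae_of_all _ fun p => hM p.2)
    have bχ1 : Integrable (fun x => χ x * u0 x) μ :=
      Integrable.bdd_mul iu0 hχ.continuous.aestronglyMeasurable (ae_of_all _ fun p => hM p)
    have iuχ := bχ _ iu
    have igχ := bχ _ ig
    have iIχ := bχ _ iI
    have w := weak_1d hT (U := fun t => ∫ x, χ x * u t x ∂μ) (G := fun t => ∫ x, χ x * g t x ∂μ)
      (c := ∫ x, χ x * u0 x ∂μ) iuχ.integral_prod_left igχ.integral_prod_left ?_
    · filter_upwards [w, ae_restrict_mem measurableSet_Icc, iuχ.prod_right_ae, iIχ.prod_right_ae] with t h1 h2 h3 h4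
      have e1 : ∫ τ in (0:ℝ)..t, ∫ x, χ x * g τ x ∂μ = ∫ x, χ x * I (t, x) ∂μ := by
        have : ∀ x, χ x * I (t,x) = ∫ τ in (0:ℝ)..t, χ x * g τ x := by
          intro x
          rw [intervalIntegral.integral_const_mul, primitive_rep _ h2]
        simp only [this]
        simp only [intervalIntegral.integral_of_le h2.1]
        rw [integral_integral_swap]
        refine Integrable.mono_measure igχ ?_
        refine Measure.prod_mono ?_ le_rfl
        exact Measure.restrict_mono (Ioc_subset_Icc_self.trans (Icc_subset_Icc le_rfl h2.2)) le_rfl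
      have e2 : ∀ x, χ x * h (t,x) = χ x * u t x - (χ x * u0 x + χ x * I (t,x)) := fun x => by
        simp only [hh]; ring
      simp only [e2]
      have h34 : Integrable (fun x => χ x * u0 x + χ x * I (t,x)) μ := bχ1.add h4
      rw [integral_sub h3 h34, integral_add bχ1 h4, ← e1]
      linarith
    · intro θ hθ hcθ hsupp
      set Θ : ℝ → ℝ := fun t => ∫ τ in T..t, θ τ with hΘ
      have cθ := hθ.continuous
      have dΘ : ∀ t, HasDerivAt Θ (θ t) t := fun t =>
        intervalIntegral.integral_hasDerivAt_right (cθ.intervalIntegrable _ _)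
          (cθ.stronglyMeasurableAtFilter _ _) cθ.continuousAt
      have cΘ : ContDiff ℝ (⊤ : ℕ∞) Θ := by
        rw [contDiff_infty_iff_deriv]
        refine ⟨fun t => (dΘ t).differentiableAt, ?_⟩
        have : deriv Θ = θ := funext fun t => (dΘ t).deriv
        rw [this]; exact hθ
      have test : IsTest T (fun t x => Θ t * χ x) := by
        refine ⟨(cΘ.comp contDiff_fst).mul (hχ.comp contDiff_snd), ?_⟩
        obtain ⟨T', hT', hz⟩ : ∃ T' < T, ∀ t, T' < t → θ t = 0 := by
          rcases (tsupport θ).eq_empty_or_nonempty with he | hne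
          · refine ⟨0, hT, fun t _ => image_eq_zero_of_notMem_tsupport (by simp [he])⟩
          · obtain ⟨m, hm1, hm2⟩ := hcθ.isCompact.exists_isGreatest hne
            exact ⟨m, (hsupp hm1).2, fun t ht => image_eq_zero_of_notMem_tsupport fun hc => absurd (hm2 hc) (not_le.2 ht)⟩
        refine ⟨T', hT', fun t x ht => ?_⟩
        have : Θ t = 0 := by
          simp only [hΘ]
          refine intervalIntegral.integral_zero_ae (ae_of_all _ fun τ hτ => hz τ ?_)
          have := hτ.1
          exact lt_of_le_of_lt (le_min hT'.le ht) this
        simp [this]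
      have := hw _ test
      have e1 : ∀ t x, deriv (fun τ => Θ τ * χ x) t = θ t * χ x := fun t x => ((dΘ t).mul_const _).deriv
      simp only [e1] at this
      have e2 : ∫ x in Icc (0:ℝ) 1, u0 x * (Θ 0 * χ x) = (∫ x, χ x * u0 x ∂μ) * Θ 0 := by
        rw [← integral_mul_const]
        refine integral_congr_ae (ae_of_all _ fun x => ?_)
        ring
      have e3 : ∫ t in Icc (0:ℝ) T, ∫ x in Icc (0:ℝ) 1, (u t x * (θ t * χ x) + g t x * (Θ t * χ x))
          = ∫ t in Icc 0 T, ((∫ x, χ x * u t x ∂μ) * θ t + (∫ x, χ x * g t x ∂μ) * Θ t) := by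
        refine integral_congr_ae ?_
        filter_upwards [iuχ.prod_right_ae, igχ.prod_right_ae] with t h1 h2
        rw [← integral_mul_const, ← integral_mul_const, ← integral_add (h1.mul_const _) (h2.mul_const _)]
        refine integral_congr_ae (ae_of_all _ fun x => ?_)
        simp only []
        ring
      rw [e2, e3] at this
      exact this
  have step2 : ∀ B : Set ℝ, MeasurableSet B → ∀ᵐ x ∂μ, ∫ t in B, h (t, x) ∂ν = 0 := by
    intro B hB
    have ihB : Integrable h ((ν.restrict B).prod μ) :=
      ih.mono_measure (Measure.prod_mono Measure.restrict_le_self le_rfl)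
    refine ae_eq_zero_of_integral_contDiff_smul_eq_zero ihB.integral_prod_right.locallyIntegrable ?_
    intro χ hχ hcs
    obtain ⟨M, hM⟩ := hcs.exists_bound_of_continuous hχ.continuous
    have mχ : AEStronglyMeasurable (fun p : ℝ × ℝ => χ p.2) ((ν.restrict B).prod μ) :=
      (hχ.continuous.comp continuous_snd).aestronglyMeasurable
    have ihχ : Integrable (fun p => χ p.2 * h p) ((ν.restrict B).prod μ) :=
      ihB.bdd_mul mχ (ae_of_all _ fun p => hM p.2)
    simp only [smul_eq_mul, ← integral_const_mul]
    rw [← integral_integral_swap (f := fun t x => χ x * h (t, x)) ihχ]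
    refine integral_eq_zero_of_ae (ae_restrict_of_ae (step1 χ hχ hcs))
  have step3 : ∀ᵐ z ∂(ν.prod μ), h z = 0 := by
    refine ae_zero_of_rect ih fun B C hB hC => ?_
    rw [← Measure.prod_restrict]
    have ihBC : Integrable h ((ν.restrict B).prod (μ.restrict C)) :=
      ih.mono_measure (Measure.prod_mono Measure.restrict_le_self Measure.restrict_le_self)
    rw [integral_prod_symm _ ihBC]
    exact integral_eq_zero_of_ae (ae_restrict_of_ae (step2 B hB))
  have mem : ∀ᵐ p ∂(ν.prod μ), p.1 ∈ Icc (0:ℝ) T :=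
    Measure.quasiMeasurePreserving_fst.ae (ae_restrict_mem measurableSet_Icc)
  filter_upwards [step3, mem] with p h1 h2
  rw [primitive_rep _ h2]
  simp only [hh, hI] at h1
  linarith


/-- Lebesgue measure on the unit interval. -/
noncomputable def mu01 : Measure ℝ := volume.restrict (Icc (0:ℝ) 1)

instance : IsProbabilityMeasure mu01 := ⟨by simp [mu01]⟩

lemma Inj_meas (n : ℕ) (j : Fin n) : MeasurableSet (Inj n j) := measurableSet_Ioo

lemma Inj_vol (n : ℕ) (j : Fin n) : volume (Inj n j) = ENNReal.ofReal (1 / n) := by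
  unfold Inj; rw [Real.volume_Ioo]; congr 1; ring

lemma Inj_vol_real (n : ℕ) (j : Fin n) : (volume (Inj n j)).toReal = 1 / n := by
  rw [Inj_vol, ENNReal.toReal_ofReal (by positivity)]

lemma Inj_sub (n : ℕ) (j : Fin n) : Inj n j ⊆ Icc 0 1 := by
  intro x hx
  have hn : (0:ℝ) < n := by exact_mod_cast j.pos
  have h1 : ((j:ℕ):ℝ) + 1 ≤ n := by exact_mod_cast j.isLt
  refine ⟨le_trans (by positivity) hx.1.le, hx.2.le.trans ?_⟩
  rw [div_le_one hn]; exact h1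

lemma Inj_unique {n : ℕ} {j k : Fin n} {x : ℝ} (hj : x ∈ Inj n j) (hk : x ∈ Inj n k) : j = k := by
  have hn : (0:ℝ) < n := by exact_mod_cast j.pos
  simp only [Inj, mem_Ioo, div_lt_iff₀ hn, lt_div_iff₀ hn] at hj hk
  have a1 : ((j:ℕ):ℝ) < (k:ℕ) + 1 := by linarith
  have a2 : ((k:ℕ):ℝ) < (j:ℕ) + 1 := by linarith
  have b1 : (j:ℕ) < (k:ℕ) + 1 := by exact_mod_cast a1
  have b2 : (k:ℕ) < (j:ℕ) + 1 := by exact_mod_cast a2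
  exact Fin.ext (by omega)

lemma stepFn_eq {n : ℕ} {j : Fin n} {x : ℝ} (hj : x ∈ Inj n j) (v : Fin n → ℝ) :
    stepFn n v x = v j := by
  unfold stepFn
  rw [Finset.sum_eq_single j]
  · rw [indicator_of_mem hj]
  · intro k _ hk
    rw [indicator_of_notMem]
    intro h; exact hk (Inj_unique h hj)
  · simp

lemma stepKer_eq {n : ℕ} {j : Fin n} {x : ℝ} (hj : x ∈ Inj n j) (A : Fin n → Fin n → ℝ) (y : ℝ) :
    stepKer n A x y = stepFn n (A j) y := by
  unfold stepKer stepFn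
  rw [Finset.sum_eq_single j]
  · refine Finset.sum_congr rfl fun k _ => ?_
    rw [indicator_of_mem hj]
  · intro k _ hk
    refine Finset.sum_eq_zero fun l _ => ?_
    rw [indicator_of_notMem]
    intro h; exact hk (Inj_unique h hj)
  · simp

lemma mem_Inj_of_not_grid {n : ℕ} (hn : 0 < n) {x : ℝ} (hx : x ∈ Icc (0:ℝ) 1)
    (hg : ∀ k : ℕ, x ≠ (k:ℝ) / n) : ∃ j, x ∈ Inj n j := by
  have hn' : (0:ℝ) < n := by exact_mod_cast hn
  have h0 : 0 ≤ x * n := mul_nonneg hx.1 hn'.le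
  have hlt : x < 1 := lt_of_le_of_ne hx.2 (by have := hg n; rwa [div_self hn'.ne'] at this)
  have h1 : ⌊x * n⌋₊ < n := by
    rw [Nat.floor_lt h0]; nlinarith
  refine ⟨⟨⌊x*n⌋₊, h1⟩, ?_, ?_⟩
  · simp only
    have h2 : (⌊x*n⌋₊ : ℝ) / n ≤ x := by rw [div_le_iff₀ hn']; exact Nat.floor_le h0
    exact lt_of_le_of_ne h2 (Ne.symm (hg _))
  · simp only
    rw [lt_div_iff₀ hn']; exact Nat.lt_floor_add_one _

lemma ae_grid : ∀ᵐ x ∂mu01, ∀ n : ℕ, 0 < n → ∃ j, x ∈ Inj n j := by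
  have : ∀ᵐ x ∂(volume : Measure ℝ), ∀ n k : ℕ, x ≠ (k:ℝ) / n := by
    rw [ae_all_iff]; intro n
    rw [ae_all_iff]; intro k
    exact Measure.ae_ne volume _
  filter_upwards [ae_restrict_of_ae this, ae_restrict_mem measurableSet_Icc] with x h1 h2 n hn
  exact mem_Inj_of_not_grid hn h2 (h1 n)

lemma mu01_eq_sum {n : ℕ} (hn : 0 < n) :
    mu01 = Measure.sum fun j : Fin n => volume.restrict (Inj n j) := by
  rw [← Measure.restrict_iUnion]
  · unfold mu01
    refine Measure.restrict_congr_set ?_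
    have hsub : (⋃ j, Inj n j) ⊆ Icc (0:ℝ) 1 := iUnion_subset (Inj_sub n)
    have := ae_grid
    unfold mu01 at this
    rw [ae_restrict_iff' measurableSet_Icc] at this
    filter_upwards [this] with x hx
    have : (x ∈ Icc (0:ℝ) 1) = (x ∈ ⋃ j, Inj n j) := by
      refine propext ⟨fun h => ?_, fun h => hsub h⟩
      obtain ⟨j, hj⟩ := hx h n hn
      exact mem_iUnion.2 ⟨j, hj⟩
    exact this
  · intro j k hjk
    exact disjoint_left.2 fun x hj hk => hjk (Inj_unique hj hk)
  · exact Inj_meas n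

lemma integral_mu01 {n : ℕ} (hn : 0 < n) {f : ℝ → ℝ} (hf : Integrable f mu01) :
    ∫ x, f x ∂mu01 = ∑ j : Fin n, ∫ x in Inj n j, f x := by
  rw [mu01_eq_sum hn] at hf ⊢
  rw [integral_sum_measure hf, tsum_fintype]

lemma stepFn_meas (n : ℕ) (v : Fin n → ℝ) : Measurable (stepFn n v) := by
  unfold stepFn
  refine Finset.measurable_sum _ fun j _ => ?_
  exact measurable_const.indicator (Inj_meas n j)

lemma stepFn_bound (n : ℕ) (v : Fin n → ℝ) (x : ℝ) : |stepFn n v x| ≤ ∑ j, |v j| := by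
  unfold stepFn
  refine (Finset.abs_sum_le_sum_abs _ _).trans (Finset.sum_le_sum fun j _ => ?_)
  by_cases h : x ∈ Inj n j
  · rw [indicator_of_mem h]
  · rw [indicator_of_notMem h]; simp

lemma stepFn_integrable (n : ℕ) (v : Fin n → ℝ) : Integrable (stepFn n v) mu01 :=
  Integrable.of_bound (stepFn_meas n v).aestronglyMeasurable _ (ae_of_all _ (stepFn_bound n v))

lemma integral_stepFn {n : ℕ} (hn : 0 < n) (v : Fin n → ℝ) :
    ∫ x, stepFn n v x ∂mu01 = 1 / n * ∑ j, v j := by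
  rw [integral_mu01 hn (stepFn_integrable n v), Finset.mul_sum]
  refine Finset.sum_congr rfl fun j _ => ?_
  rw [setIntegral_congr_fun (Inj_meas n j) (g := fun _ => v j) (fun x hx => stepFn_eq hx v)]
  simp [Measure.real, Inj_vol_real]

lemma stepKer_meas (n : ℕ) (A : Fin n → Fin n → ℝ) :
    Measurable (fun p : ℝ × ℝ => stepKer n A p.1 p.2) := by
  unfold stepKer
  refine Finset.measurable_sum _ fun j _ => Finset.measurable_sum _ fun k _ => ?_
  have h1 : Measurable (fun p : ℝ × ℝ => (Inj n k).indicator (fun _ => A j k) p.2) :=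
    (measurable_const.indicator (Inj_meas n k)).comp measurable_snd
  exact h1.indicator (measurable_fst (Inj_meas n j))

lemma stepKer_bound (n : ℕ) (A : Fin n → Fin n → ℝ) (x y : ℝ) :
    |stepKer n A x y| ≤ ∑ j, ∑ k, |A j k| := by
  unfold stepKer
  refine (Finset.abs_sum_le_sum_abs _ _).trans (Finset.sum_le_sum fun j _ => ?_)
  refine (Finset.abs_sum_le_sum_abs _ _).trans (Finset.sum_le_sum fun k _ => ?_)
  by_cases h : x ∈ Inj n j
  · rw [indicator_of_mem h]
    by_cases h : y ∈ Inj n k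
    · rw [indicator_of_mem h]
    · rw [indicator_of_notMem h]; simp
  · rw [indicator_of_notMem h]; simp

lemma stepKer_integrable (n : ℕ) (A : Fin n → Fin n → ℝ) :
    Integrable (fun p : ℝ × ℝ => stepKer n A p.1 p.2) (mu01.prod mu01) :=
  Integrable.of_bound (stepKer_meas n A).aestronglyMeasurable _ (ae_of_all _ fun p => stepKer_bound n A p.1 p.2)

lemma integral_stepKer {n : ℕ} (hn : 0 < n) (A : Fin n → Fin n → ℝ) :
    ∫ p : ℝ × ℝ, stepKer n A p.1 p.2 ∂(mu01.prod mu01) = 1 / (n:ℝ)^2 * ∑ j, ∑ k, A j k := by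
  rw [integral_prod _ (stepKer_integrable n A)]
  have : ∀ᵐ x ∂mu01, ∫ y, stepKer n A x y ∂mu01 = stepFn n (fun j => 1 / n * ∑ k, A j k) x := by
    filter_upwards [ae_grid] with x hx
    obtain ⟨j, hj⟩ := hx n hn
    rw [stepFn_eq hj]
    simp only [stepKer_eq hj]
    exact integral_stepFn hn _
  rw [integral_congr_ae this, integral_stepFn hn, ← Finset.mul_sum]
  ring

lemma prod_restrict_Inj (n : ℕ) (j k : Fin n) :
    (volume.restrict (Inj n j)).prod (volume.restrict (Inj n k)) =
      (volume : Measure (ℝ × ℝ)).restrict (Inj n j ×ˢ Inj n k) := by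
  rw [Measure.prod_restrict, Measure.volume_eq_prod]

lemma restrict_Inj_le (n : ℕ) (j : Fin n) : volume.restrict (Inj n j) ≤ mu01 :=
  Measure.restrict_mono (Inj_sub n j) le_rfl

lemma avg2_eq {n : ℕ} (j k : Fin n) {U : ℝ → ℝ → ℝ}
    (hU : Integrable (fun p : ℝ × ℝ => U p.1 p.2) (mu01.prod mu01)) :
    avg2 n j k U = (n:ℝ)^2 * ∫ p in Inj n j ×ˢ Inj n k, U p.1 p.2 := by
  unfold avg2
  rw [← prod_restrict_Inj, integral_prod]
  exact hU.mono_measure (Measure.prod_mono (restrict_Inj_le n j) (restrict_Inj_le n k))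

lemma integral_step_avg2 {n : ℕ} (hn : 0 < n) {U : ℝ → ℝ → ℝ}
    (hU : Integrable (fun p : ℝ × ℝ => U p.1 p.2) (mu01.prod mu01)) :
    ∫ p : ℝ × ℝ, stepKer n (fun j k => avg2 n j k U) p.1 p.2 ∂(mu01.prod mu01) =
      ∫ p : ℝ × ℝ, U p.1 p.2 ∂(mu01.prod mu01) := by
  have hn' : (0:ℝ) < n := by exact_mod_cast hn
  rw [integral_stepKer hn, integral_prod _ hU, integral_mu01 hn hU.integral_prod_left, Finset.mul_sum]
  refine Finset.sum_congr rfl fun j _ => ?_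
  have : ∀ᵐ x ∂(volume.restrict (Inj n j)), ∫ y, U x y ∂mu01 = ∑ k : Fin n, ∫ y in Inj n k, U x y := by
    have := hU.prod_right_ae
    have := (Measure.absolutelyContinuous_of_le (restrict_Inj_le n j)).ae_le this
    filter_upwards [this] with x hx
    exact integral_mu01 hn hx
  rw [integral_congr_ae this, integral_finsetSum, Finset.mul_sum]
  · refine Finset.sum_congr rfl fun k _ => ?_
    unfold avg2
    field_simp
  · intro k _
    have : Integrable (fun p : ℝ × ℝ => U p.1 p.2) ((volume.restrict (Inj n j)).prod (volume.restrict (Inj n k))) :=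
      hU.mono_measure (Measure.prod_mono (restrict_Inj_le n j) (restrict_Inj_le n k))
    exact this.integral_prod_left

lemma avg2_jensen {n : ℕ} (j k : Fin n) {U : ℝ → ℝ → ℝ}
    (hU : Integrable (fun p : ℝ × ℝ => U p.1 p.2) (mu01.prod mu01))
    (hU2 : Integrable (fun p : ℝ × ℝ => U p.1 p.2 ^ 2) (mu01.prod mu01)) :
    (avg2 n j k U)^2 ≤ avg2 n j k (fun x y => U x y ^ 2) := by
  have hn : 0 < n := j.pos
  have hn' : (0:ℝ) < n := by exact_mod_cast hn
  rw [avg2_eq j k hU, avg2_eq j k hU2, ← prod_restrict_Inj]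
  set ρ := (volume.restrict (Inj n j)).prod (volume.restrict (Inj n k)) with hρ
  have le : ρ ≤ mu01.prod mu01 := Measure.prod_mono (restrict_Inj_le n j) (restrict_Inj_le n k)
  have iU := hU.mono_measure le
  have iU2 := hU2.mono_measure le
  have fin : IsFiniteMeasure ρ := ⟨lt_of_le_of_lt (le univ) (measure_lt_top _ _)⟩
  have vol : ρ.real univ = 1 / (n:ℝ)^2 := by
    simp only [Measure.real, hρ, ← univ_prod_univ, Measure.prod_prod, Measure.restrict_apply_univ,
      ENNReal.toReal_mul, Inj_vol_real]
    ring
  set I := ∫ p, U p.1 p.2 ∂ρ with hI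
  set m := (n:ℝ)^2 * I with hm
  have key : 0 ≤ ∫ p, (U p.1 p.2 - m)^2 ∂ρ := integral_nonneg fun p => sq_nonneg _
  have e : ∫ p, (U p.1 p.2 - m)^2 ∂ρ = ∫ p, U p.1 p.2 ^ 2 ∂ρ - 2 * m * I + m^2 * (1 / (n:ℝ)^2) := by
    have : ∀ p : ℝ × ℝ, (U p.1 p.2 - m)^2 = U p.1 p.2 ^2 - 2 * m * U p.1 p.2 + m^2 := fun p => by ring
    simp only [this]
    have i1 : Integrable (fun p : ℝ × ℝ => U p.1 p.2 ^2 - 2 * m * U p.1 p.2) ρ := iU2.sub (iU.const_mul _)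
    rw [integral_add i1 (integrable_const _), integral_sub iU2 (iU.const_mul _), integral_const_mul, integral_const, vol]
    simp only [smul_eq_mul]; ring
  rw [e] at key
  have hI' : I = m / (n:ℝ)^2 := by rw [hm]; field_simp
  rw [hI'] at key
  have : ∫ p, U p.1 p.2 ^ 2 ∂ρ ≥ m^2 / (n:ℝ)^2 := by
    have : 2 * m * (m / (n:ℝ)^2) - m^2 * (1/(n:ℝ)^2) = m^2 / (n:ℝ)^2 := by ring
    linarith
  rw [ge_iff_le, div_le_iff₀ (by positivity)] at this
  linarith

lemma closedBall_mid (n : ℕ) (j : Fin n) :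
    Metric.closedBall ((2 * ((j:ℕ):ℝ) + 1) / (2 * n)) (1 / (2 * n)) = Icc (((j:ℕ):ℝ) / n) ((((j:ℕ):ℝ) + 1) / n) := by
  have hn : (0:ℝ) < n := by exact_mod_cast j.pos
  rw [Real.closedBall_eq_Icc]
  congr 1 <;> field_simp <;> ring

lemma tendsto_delta : Tendsto (fun n : ℕ => 1 / (2 * (n:ℝ))) atTop (nhdsWithin 0 (Ioi 0)) := by
  rw [tendsto_nhdsWithin_iff]
  constructor
  · have : Tendsto (fun n : ℕ => (1/2) * (1 / (n:ℝ))) atTop (nhds ((1/2) * 0)) :=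
      tendsto_one_div_atTop_nhds_zero_nat.const_mul _
    rw [mul_zero] at this
    refine this.congr fun n => ?_
    ring
  · filter_upwards [eventually_gt_atTop 0] with n hn
    have : (0:ℝ) < n := by exact_mod_cast hn
    exact mem_Ioi.2 (by positivity)

lemma tendsto_step_avg1 {f : ℝ → ℝ} (hf : Integrable f mu01) :
    ∀ᵐ x ∂mu01, Tendsto (fun n => stepFn n (fun j => avg1 n j f) x) atTop (nhds (f x)) := by
  set g := (Icc (0:ℝ) 1).indicator f with hg
  have ig : Integrable g := by rw [hg, integrable_indicator_iff measurableSet_Icc]; exact hf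
  have L := IsUnifLocDoublingMeasure.ae_tendsto_average (μ := (volume : Measure ℝ)) ig.locallyIntegrable 1
  filter_upwards [ae_restrict_of_ae L, ae_grid, ae_restrict_mem measurableSet_Icc] with x h1 h2 h3
  have : ∀ n : ℕ, ∃ w : ℝ, 0 < n → ∃ j : Fin n, x ∈ Inj n j ∧ w = (2 * ((j:ℕ):ℝ) + 1) / (2 * n) := by
    intro n
    by_cases hn : 0 < n
    · obtain ⟨j, hj⟩ := h2 n hn
      exact ⟨_, fun _ => ⟨j, hj, rfl⟩⟩
    · exact ⟨0, fun h => absurd h hn⟩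
  choose w hw using this
  have h4 := h1 w _ tendsto_delta (by
    filter_upwards [eventually_gt_atTop 0] with n hn
    obtain ⟨j, hj, e⟩ := hw n hn
    rw [one_mul, e, closedBall_mid]
    exact Ioo_subset_Icc_self hj)
  have e0 : g x = f x := indicator_of_mem h3 f
  rw [e0] at h4
  refine h4.congr' ?_
  filter_upwards [eventually_gt_atTop 0] with n hn
  obtain ⟨j, hj, e⟩ := hw n hn
  have hn' : (0:ℝ) < n := by exact_mod_cast hn
  rw [stepFn_eq hj, e, closedBall_mid]
  unfold avg1
  have hae : Icc (((j:ℕ):ℝ) / n) ((((j:ℕ):ℝ) + 1) / n) =ᵐ[volume] Inj n j := Ioo_ae_eq_Icc.symm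
  rw [setAverage_congr hae, setAverage_eq, Measure.real, Inj_vol_real]
  rw [setIntegral_congr_fun (Inj_meas n j) (g := f) (fun y hy => indicator_of_mem (Inj_sub n j hy) f)]
  simp

lemma tendsto_step_avg2 {U : ℝ → ℝ → ℝ}
    (hU : Integrable (fun p : ℝ × ℝ => U p.1 p.2) (mu01.prod mu01)) :
    ∀ᵐ p ∂(mu01.prod mu01), Tendsto (fun n => stepKer n (fun j k => avg2 n j k U) p.1 p.2) atTop
      (nhds (U p.1 p.2)) := by
  set f : ℝ × ℝ → ℝ := fun p => U p.1 p.2 with hf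
  set Q : Set (ℝ × ℝ) := Icc (0:ℝ) 1 ×ˢ Icc (0:ℝ) 1 with hQ
  have mQ : MeasurableSet Q := measurableSet_Icc.prod measurableSet_Icc
  have hμ : mu01.prod mu01 = (volume : Measure (ℝ × ℝ)).restrict Q := by
    unfold mu01; rw [Measure.prod_restrict, Measure.volume_eq_prod]
  set g := Q.indicator f with hg
  have ig : Integrable g := by
    rw [hg, integrable_indicator_iff mQ]
    unfold IntegrableOn
    rw [← hμ]; exact hU
  have L := IsUnifLocDoublingMeasure.ae_tendsto_average (μ := (volume : Measure (ℝ × ℝ))) ig.locallyIntegrable 1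
  have g1 : ∀ᵐ p ∂(mu01.prod mu01), ∀ n : ℕ, 0 < n → ∃ j, p.1 ∈ Inj n j :=
    Measure.quasiMeasurePreserving_fst.ae ae_grid
  have g2 : ∀ᵐ p ∂(mu01.prod mu01), ∀ n : ℕ, 0 < n → ∃ j, p.2 ∈ Inj n j :=
    Measure.quasiMeasurePreserving_snd.ae ae_grid
  have L' : ∀ᵐ x ∂(mu01.prod mu01), ∀ (w : ℕ → ℝ × ℝ) (δ : ℕ → ℝ) (_ : Tendsto δ atTop (nhdsWithin 0 (Ioi 0)))
        (_ : ∀ᶠ j in atTop, x ∈ Metric.closedBall (w j) (1 * δ j)),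
        Tendsto (fun j => ⨍ y in Metric.closedBall (w j) (δ j), g y) atTop (nhds (g x)) := by
    rw [hμ]
    filter_upwards [ae_restrict_of_ae L] with x hx w δ h1 h2
    exact hx w δ h1 h2
  have hmem : ∀ᵐ p ∂(mu01.prod mu01), p ∈ Q := by rw [hμ]; exact ae_restrict_mem mQ
  filter_upwards [L', g1, g2, hmem] with p h1 h2 h2' h3
  have : ∀ n : ℕ, ∃ w : ℝ × ℝ, 0 < n → ∃ j k : Fin n, p.1 ∈ Inj n j ∧ p.2 ∈ Inj n k ∧
      w = ((2 * ((j:ℕ):ℝ) + 1) / (2 * n), (2 * ((k:ℕ):ℝ) + 1) / (2 * n)) := by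
    intro n
    by_cases hn : 0 < n
    · obtain ⟨j, hj⟩ := h2 n hn
      obtain ⟨k, hk⟩ := h2' n hn
      exact ⟨_, fun _ => ⟨j, k, hj, hk, rfl⟩⟩
    · exact ⟨0, fun h => absurd h hn⟩
  choose w hw using this
  have h4 := h1 w _ tendsto_delta (by
    filter_upwards [eventually_gt_atTop 0] with n hn
    obtain ⟨j, k, hj, hk, e⟩ := hw n hn
    rw [one_mul, e, ← closedBall_prod_same, closedBall_mid, closedBall_mid]
    exact ⟨Ioo_subset_Icc_self hj, Ioo_subset_Icc_self hk⟩)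
  have e0 : g p = f p := indicator_of_mem h3 f
  rw [e0] at h4
  refine h4.congr' ?_
  filter_upwards [eventually_gt_atTop 0] with n hn
  obtain ⟨j, k, hj, hk, e⟩ := hw n hn
  have hn' : (0:ℝ) < n := by exact_mod_cast hn
  rw [stepKer_eq hj, stepFn_eq hk, e, ← closedBall_prod_same, closedBall_mid, closedBall_mid, avg2_eq j k hU]
  have hae : Icc (((j:ℕ):ℝ) / n) ((((j:ℕ):ℝ) + 1) / n) ×ˢ Icc (((k:ℕ):ℝ) / n) ((((k:ℕ):ℝ) + 1) / n)
      =ᵐ[volume] Inj n j ×ˢ Inj n k := by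
    rw [Measure.volume_eq_prod]
    exact Measure.set_prod_ae_eq Ioo_ae_eq_Icc.symm Ioo_ae_eq_Icc.symm
  rw [setAverage_congr hae, setAverage_eq]
  have hv : (volume : Measure (ℝ × ℝ)).real (Inj n j ×ˢ Inj n k) = 1 / (n:ℝ)^2 := by
    rw [Measure.volume_eq_prod, Measure.real, Measure.prod_prod, ENNReal.toReal_mul, Inj_vol_real, Inj_vol_real]
    ring
  rw [hv]
  rw [setIntegral_congr_fun ((Inj_meas n j).prod (Inj_meas n k)) (g := f)
    (fun y hy => indicator_of_mem (show y ∈ Q from ⟨Inj_sub n j hy.1, Inj_sub n k hy.2⟩) f)]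
  simp
  left; rfl


lemma gDCT {α : Type*} [MeasurableSpace α] {μ : Measure α} {g H : ℕ → α → ℝ} {K : α → ℝ}
    (mg : ∀ n, AEStronglyMeasurable (g n) μ) (iH : ∀ n, Integrable (H n) μ) (iK : Integrable K μ)
    (g0 : ∀ n x, 0 ≤ g n x) (gH : ∀ n x, g n x ≤ H n x) (hK0 : ∀ x, 0 ≤ K x)
    (hg : ∀ᵐ x ∂μ, Tendsto (fun n => g n x) atTop (nhds 0))
    (hH : ∀ᵐ x ∂μ, Tendsto (fun n => H n x) atTop (nhds (K x)))
    (hint : Tendsto (fun n => ∫ x, H n x ∂μ) atTop (nhds (∫ x, K x ∂μ))) :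
    Tendsto (fun n => ∫ x, g n x ∂μ) atTop (nhds 0) := by
  have ig : ∀ n, Integrable (g n) μ := fun n => (iH n).mono' (mg n) (ae_of_all _ fun x => by
    rw [Real.norm_eq_abs, abs_of_nonneg (g0 n x)]; exact gH n x)
  have i1 : ∀ n, Integrable (fun x => min (g n x) (K x)) μ := fun n => (ig n).inf iK
  have i2 : ∀ n, Integrable (fun x => max (K x - H n x) 0) μ := fun n => (iK.sub (iH n)).sup (integrable_zero _ _ _)
  have t1 : Tendsto (fun n => ∫ x, min (g n x) (K x) ∂μ) atTop (nhds (∫ x, (0:ℝ) ∂μ)) := by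
    refine tendsto_integral_of_dominated_convergence K (fun n => (i1 n).aestronglyMeasurable) iK ?_ ?_
    · intro n; refine ae_of_all _ fun x => ?_
      rw [Real.norm_eq_abs, abs_of_nonneg (le_min (g0 n x) (hK0 x))]; exact min_le_right _ _
    · filter_upwards [hg] with x hx
      have := hx.min (tendsto_const_nhds (x := K x))
      rwa [min_eq_left (hK0 x)] at this
  have t2 : Tendsto (fun n => ∫ x, max (K x - H n x) 0 ∂μ) atTop (nhds (∫ x, (0:ℝ) ∂μ)) := by
    refine tendsto_integral_of_dominated_convergence K (fun n => (i2 n).aestronglyMeasurable) iK ?_ ?_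
    · intro n; refine ae_of_all _ fun x => ?_
      rw [Real.norm_eq_abs, abs_of_nonneg (le_max_right _ _)]
      exact max_le (by linarith [(g0 n x).trans (gH n x)]) (hK0 x)
    · filter_upwards [hH] with x hx
      have := ((tendsto_const_nhds (x := K x)).sub hx).max (tendsto_const_nhds (x := (0:ℝ)))
      simpa using this
  rw [integral_zero] at t1 t2
  have t3 := (t1.add (hint.sub_const (∫ x, K x ∂μ))).add t2
  simp only [sub_self, add_zero] at t3
  refine squeeze_zero (fun n => integral_nonneg (g0 n)) (fun n => ?_) t3
  have i3 : Integrable (fun x => H n x - K x) μ := (iH n).sub iK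
  have i4 : Integrable (fun x => min (g n x) (K x) + (H n x - K x)) μ := (i1 n).add i3
  rw [← integral_sub (iH n) iK, ← integral_add (i1 n) i3, ← integral_add i4 (i2 n)]
  refine integral_mono (ig n) (i4.add (i2 n)) fun x => ?_
  beta_reduce
  have := gH n x
  rcases min_cases (g n x) (K x) with h | h <;> rcases max_cases (K x - H n x) 0 with h' | h' <;> linarith

lemma stepFn_cases (n : ℕ) (x : ℝ) :
    (∃ j, ∀ v : Fin n → ℝ, stepFn n v x = v j) ∨ ∀ v : Fin n → ℝ, stepFn n v x = 0 := by
  by_cases h : ∃ j, x ∈ Inj n j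
  · obtain ⟨j, hj⟩ := h
    exact Or.inl ⟨j, fun v => stepFn_eq hj v⟩
  · push Not at h
    refine Or.inr fun v => ?_
    unfold stepFn
    exact Finset.sum_eq_zero fun j _ => indicator_of_notMem (h j) _

lemma stepKer_cases (n : ℕ) (x y : ℝ) :
    (∃ j k, ∀ A : Fin n → Fin n → ℝ, stepKer n A x y = A j k) ∨ ∀ A : Fin n → Fin n → ℝ, stepKer n A x y = 0 := by
  by_cases h : ∃ j, x ∈ Inj n j
  · obtain ⟨j, hj⟩ := h
    rcases stepFn_cases n y with ⟨k, hk⟩ | hk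
    · exact Or.inl ⟨j, k, fun A => by rw [stepKer_eq hj, hk]⟩
    · exact Or.inr fun A => by rw [stepKer_eq hj, hk]
  · push Not at h
    refine Or.inr fun v => ?_
    unfold stepKer
    exact Finset.sum_eq_zero fun j _ => Finset.sum_eq_zero fun k _ => indicator_of_notMem (h j) _

lemma avg1_mem {n : ℕ} (j : Fin n) {b : ℝ → ℝ} {C : ℝ} (mb : Measurable b) (hb : ∀ x, 0 ≤ b x ∧ b x ≤ C) :
    0 ≤ avg1 n j b ∧ avg1 n j b ≤ C := by
  have hn : (0:ℝ) < n := by exact_mod_cast j.pos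
  unfold avg1
  constructor
  · exact mul_nonneg hn.le (integral_nonneg fun x => (hb x).1)
  · have hfin : IsFiniteMeasure (volume.restrict (Inj n j)) := ⟨by rw [Measure.restrict_apply_univ, Inj_vol]; exact ENNReal.ofReal_lt_top⟩
    have : ∫ x in Inj n j, b x ≤ ∫ x in Inj n j, C := by
      refine integral_mono (Integrable.of_bound mb.aestronglyMeasurable C (ae_of_all _ fun x => ?_)) (integrable_const _) fun x => (hb x).2
      rw [Real.norm_eq_abs, abs_of_nonneg (hb x).1]; exact (hb x).2
    have e : ∫ x in Inj n j, C = 1 / n * C := by simp [Measure.real, Inj_vol_real]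
    rw [e] at this
    calc (n:ℝ) * ∫ x in Inj n j, b x ≤ n * (1 / n * C) := mul_le_mul_of_nonneg_left this hn.le
      _ = C := by field_simp

lemma avg2_nonneg {n : ℕ} (j k : Fin n) {U : ℝ → ℝ → ℝ} (h : ∀ x y, 0 ≤ U x y) : 0 ≤ avg2 n j k U :=
  mul_nonneg (by positivity) (integral_nonneg fun x => integral_nonneg fun y => h x y)

lemma stepFn_mem {n : ℕ} {v : Fin n → ℝ} {C : ℝ} (hC : 0 ≤ C) (h : ∀ j, 0 ≤ v j ∧ v j ≤ C) (x : ℝ) :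
    0 ≤ stepFn n v x ∧ stepFn n v x ≤ C := by
  rcases stepFn_cases n x with ⟨j, hj⟩ | hj
  · rw [hj]; exact h j
  · rw [hj]; exact ⟨le_rfl, hC⟩

lemma stepKer_nonneg {n : ℕ} {A : Fin n → Fin n → ℝ} (h : ∀ j k, 0 ≤ A j k) (x y : ℝ) : 0 ≤ stepKer n A x y := by
  rcases stepKer_cases n x y with ⟨j, k, hj⟩ | hj
  · rw [hj]; exact h j k
  · rw [hj]

lemma stepKer_jensen {U : ℝ → ℝ → ℝ}
    (hU : Integrable (fun p : ℝ × ℝ => U p.1 p.2) (mu01.prod mu01))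
    (hU2 : Integrable (fun p : ℝ × ℝ => U p.1 p.2 ^ 2) (mu01.prod mu01)) (n : ℕ) (x y : ℝ) :
    (stepKer n (fun j k => avg2 n j k U) x y)^2 ≤ stepKer n (fun j k => avg2 n j k (fun x y => U x y ^ 2)) x y := by
  rcases stepKer_cases n x y with ⟨j, k, hj⟩ | hj
  · rw [hj, hj]; exact avg2_jensen j k hU hU2
  · rw [hj, hj]; simp

lemma integral_stepKer_sq_le {U : ℝ → ℝ → ℝ}
    (hU : Integrable (fun p : ℝ × ℝ => U p.1 p.2) (mu01.prod mu01))
    (hU2 : Integrable (fun p : ℝ × ℝ => U p.1 p.2 ^ 2) (mu01.prod mu01)) {n : ℕ} (hn : 0 < n) :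
    ∫ p : ℝ × ℝ, (stepKer n (fun j k => avg2 n j k U) p.1 p.2)^2 ∂(mu01.prod mu01) ≤
      ∫ p : ℝ × ℝ, U p.1 p.2 ^ 2 ∂(mu01.prod mu01) := by
  rw [← integral_step_avg2 (U := fun x y => U x y ^ 2) hn hU2]
  refine integral_mono_of_nonneg (ae_of_all _ fun p => sq_nonneg _) (stepKer_integrable _ _) (ae_of_all _ fun p => ?_)
  exact stepKer_jensen hU hU2 n p.1 p.2

lemma pw_bound {C b b' U U' : ℝ} (hb : 0 ≤ b ∧ b ≤ C) (hb' : 0 ≤ b' ∧ b' ≤ C) :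
    (b * U - b' * U')^2 ≤ 2 * C^2 * (U^2 + U'^2) := by
  have h1 : b^2 ≤ C^2 := pow_le_pow_left₀ hb.1 hb.2 2
  have h2 : b'^2 ≤ C^2 := pow_le_pow_left₀ hb'.1 hb'.2 2
  nlinarith [sq_nonneg (b * U + b' * U'), mul_le_mul_of_nonneg_right h1 (sq_nonneg U), mul_le_mul_of_nonneg_right h2 (sq_nonneg U')]

lemma slice_conv {U : ℝ → ℝ → ℝ} {b : ℝ → ℝ} {C : ℝ} (hC : 0 ≤ C)
    (mU : Measurable (fun p : ℝ × ℝ => U p.1 p.2)) (mb : Measurable b) (hb : ∀ x, 0 ≤ b x ∧ b x ≤ C)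
    (hU : Integrable (fun p : ℝ × ℝ => U p.1 p.2) (mu01.prod mu01))
    (hU2 : Integrable (fun p : ℝ × ℝ => U p.1 p.2 ^ 2) (mu01.prod mu01)) :
    Tendsto (fun n => ∫ p : ℝ × ℝ, (b p.2 * U p.1 p.2 -
      stepFn n (fun j => avg1 n j b) p.2 * stepKer n (fun j k => avg2 n j k U) p.1 p.2)^2 ∂(mu01.prod mu01)) atTop (nhds 0) := by
  have ib : Integrable b mu01 := Integrable.of_bound mb.aestronglyMeasurable C (ae_of_all _ fun x => by
    rw [Real.norm_eq_abs, abs_of_nonneg (hb x).1]; exact (hb x).2)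
  refine gDCT (H := fun n p => 2 * C^2 * (U p.1 p.2 ^ 2 + stepKer n (fun j k => avg2 n j k (fun x y => U x y ^ 2)) p.1 p.2))
    (K := fun p => 2 * C^2 * (U p.1 p.2 ^ 2 + U p.1 p.2 ^ 2)) ?_ ?_ ?_ ?_ ?_ ?_ ?_ ?_ ?_
  · intro n
    exact ((((mb.comp measurable_snd).mul mU).sub (((stepFn_meas _ _).comp measurable_snd).mul (stepKer_meas _ _))).pow_const 2).aestronglyMeasurable
  · intro n; exact (hU2.add (stepKer_integrable _ _)).const_mul _
  · exact (hU2.add hU2).const_mul _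
  · intro n p; positivity
  · intro n p
    refine (pw_bound (hb p.2) (stepFn_mem hC (fun j => avg1_mem j mb hb) p.2)).trans ?_
    have := stepKer_jensen hU hU2 n p.1 p.2
    exact mul_le_mul_of_nonneg_left (by linarith) (by positivity)
  · intro p; positivity
  · filter_upwards [tendsto_step_avg2 hU, Measure.quasiMeasurePreserving_snd.ae (tendsto_step_avg1 ib)] with p h1 h2
    have := ((tendsto_const_nhds (x := b p.2 * U p.1 p.2)).sub (h2.mul h1)).pow 2
    simpa using this
  · filter_upwards [tendsto_step_avg2 (U := fun x y => U x y ^ 2) hU2] with p h1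
    exact (h1.const_add _).const_mul _
  · refine tendsto_const_nhds.congr' ?_
    filter_upwards [eventually_gt_atTop 0] with n hn
    rw [integral_const_mul, integral_const_mul, integral_add hU2 hU2, integral_add hU2 (stepKer_integrable _ _), integral_step_avg2 (U := fun x y => U x y ^ 2) hn hU2]

lemma slice_conv1 {b : ℝ → ℝ} {C : ℝ} (hC : 0 ≤ C) (mb : Measurable b) (hb : ∀ x, 0 ≤ b x ∧ b x ≤ C) :
    Tendsto (fun n => ∫ x, (b x - stepFn n (fun j => avg1 n j b) x)^2 ∂mu01) atTop (nhds 0) := by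
  have ib : Integrable b mu01 := Integrable.of_bound mb.aestronglyMeasurable C (ae_of_all _ fun x => by
    rw [Real.norm_eq_abs, abs_of_nonneg (hb x).1]; exact (hb x).2)
  rw [show (0:ℝ) = ∫ x, (0:ℝ) ∂mu01 by simp]
  refine tendsto_integral_of_dominated_convergence (fun _ => C^2) ?_ (integrable_const _) ?_ ?_
  · intro n; exact ((mb.sub (stepFn_meas _ _)).pow_const 2).aestronglyMeasurable
  · intro n; refine ae_of_all _ fun x => ?_
    have h1 := hb x
    have h2 := stepFn_mem hC (fun j => avg1_mem j mb hb) x (n := n)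
    rw [Real.norm_eq_abs, abs_of_nonneg (sq_nonneg _)]
    exact sq_le_sq' (by linarith) (by linarith)
  · filter_upwards [tendsto_step_avg1 ib] with x h2
    have := ((tendsto_const_nhds (x := b x)).sub h2).pow 2
    simpa using this

lemma meas_avg1 {β : ℝ → ℝ → ℝ} (h : Measurable (fun p : ℝ × ℝ => β p.1 p.2)) {n : ℕ} (j : Fin n) :
    Measurable (fun t => avg1 n j (β t)) := by
  unfold avg1
  exact (h.stronglyMeasurable.integral_prod_right' (ν := volume.restrict (Inj n j))).measurable.const_mul _

lemma meas_avg2 {W : ℝ → ℝ → ℝ → ℝ} (h : Measurable (fun p : ℝ × ℝ × ℝ => W p.1 p.2.1 p.2.2)) {n : ℕ} (j k : Fin n) :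
    Measurable (fun t => avg2 n j k (W t)) := by
  unfold avg2
  have h' : Measurable (fun p : (ℝ × ℝ) × ℝ => W p.1.1 p.1.2 p.2) :=
    h.comp (measurable_fst.fst.prodMk (measurable_fst.snd.prodMk measurable_snd))
  have h1 := (h'.stronglyMeasurable.integral_prod_right' (ν := volume.restrict (Inj n k)))
  exact (h1.integral_prod_right' (ν := volume.restrict (Inj n j))).measurable.const_mul _

lemma meas_stepFn_t {n : ℕ} {v : Fin n → ℝ → ℝ} (h : ∀ j, Measurable (v j)) :
    Measurable (fun p : ℝ × ℝ => stepFn n (fun j => v j p.1) p.2) := by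
  unfold stepFn
  refine Finset.measurable_sum _ fun j _ => ?_
  exact ((h j).comp measurable_fst).indicator (measurable_snd (Inj_meas n j))

lemma meas_stepKer_t {n : ℕ} {A : Fin n → Fin n → ℝ → ℝ} (h : ∀ j k, Measurable (A j k)) :
    Measurable (fun p : ℝ × ℝ × ℝ => stepKer n (fun j k => A j k p.1) p.2.1 p.2.2) := by
  unfold stepKer
  refine Finset.measurable_sum _ fun j _ => Finset.measurable_sum _ fun k _ => ?_
  have h1 : Measurable (fun p : ℝ × ℝ × ℝ => (Inj n k).indicator (fun _ => A j k p.1) p.2.2) :=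
    ((h j k).comp measurable_fst).indicator (measurable_snd.snd (Inj_meas n k))
  exact h1.indicator (measurable_snd.fst (Inj_meas n j))



lemma ii_of {T t : ℝ} {g : ℝ → ℝ} (hg : IntegrableOn g (Icc 0 T)) (ht : t ∈ Icc 0 T) :
    IntervalIntegrable g volume 0 t := by
  rw [intervalIntegrable_iff_integrableOn_Icc_of_le ht.1]
  exact hg.mono_set (Icc_subset_Icc le_rfl ht.2)

lemma cs_int {α : Type*} [MeasurableSpace α] {μ : Measure α} {f g : α → ℝ}
    (mf : AEStronglyMeasurable f μ) (mg : AEStronglyMeasurable g μ)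
    (f2 : Integrable (fun x => f x ^ 2) μ) (g2 : Integrable (fun x => g x ^ 2) μ) :
    Integrable (fun x => f x * g x) μ ∧
    (∫ x, f x * g x ∂μ)^2 ≤ (∫ x, f x ^ 2 ∂μ) * ∫ x, g x ^ 2 ∂μ := by
  have fg : Integrable (fun x => f x * g x) μ := by
    refine (f2.add g2).mono' (mf.mul mg) (ae_of_all _ fun x => ?_)
    simp only [Pi.add_apply, Real.norm_eq_abs]
    rw [abs_le]; constructor <;> nlinarith [sq_nonneg (f x + g x), sq_nonneg (f x - g x), sq_nonneg (f x), sq_nonneg (g x)]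
  refine ⟨fg, ?_⟩
  have key : ∀ c : ℝ, 0 ≤ (∫ x, g x ^ 2 ∂μ) * (c * c) + (2 * ∫ x, f x * g x ∂μ) * c + ∫ x, f x ^ 2 ∂μ := by
    intro c
    have h : 0 ≤ ∫ x, (f x + c * g x)^2 ∂μ := integral_nonneg fun x => sq_nonneg _
    have e : ∫ x, (f x + c * g x)^2 ∂μ = ∫ x, (f x ^2 + ((2 * c) * (f x * g x) + (c * c) * g x ^ 2)) ∂μ := by
      congr 1; ext x; ring
    have i2 : Integrable (fun x => (2 * c) * (f x * g x) + (c * c) * g x ^ 2) μ := (fg.const_mul _).add (g2.const_mul _)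
    rw [e, integral_add f2 i2, integral_add (fg.const_mul _) (g2.const_mul _), integral_const_mul, integral_const_mul] at h
    linarith
  have := discrim_le_zero key
  unfold discrim at this
  nlinarith

lemma err_s {T S0 : ℝ} (hT : 0 < T) {sf F sj Fj : ℝ → ℝ}
    (iF : IntegrableOn F (Icc 0 T)) (iFj : IntegrableOn Fj (Icc 0 T)) (F0 : ∀ t, 0 ≤ F t)
    (ms : Measurable sf) (bs : ∀ t, 0 ≤ sf t ∧ sf t ≤ 1)
    (hsf : ∀ᵐ t ∂(volume.restrict (Icc (0:ℝ) T)), sf t = S0 - ∫ τ in (0:ℝ)..t, sf τ * F τ)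
    (hsj : ∀ t ∈ Icc 0 T, sj t = sj 0 - ∫ τ in (0:ℝ)..t, sj τ * Fj τ)
    (bj : ∀ t ∈ Icc 0 T, 0 ≤ sj t ∧ sj t ≤ 1) (cj : ContinuousOn sj (Icc 0 T)) :
    ∀ᵐ t ∂(volume.restrict (Icc (0:ℝ) T)), |sf t - sj t| ≤ |S0 - sj 0| + ∫ τ in (0:ℝ)..t, |F τ - Fj τ| := by
  have i1 : IntegrableOn (fun τ => sf τ * F τ) (Icc 0 T) :=
    Integrable.bdd_mul (c := 1) iF ms.aestronglyMeasurable (ae_of_all _ fun t => by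
      rw [Real.norm_eq_abs, abs_of_nonneg (bs t).1]; exact (bs t).2)
  have i2 : IntegrableOn (fun τ => sj τ * Fj τ) (Icc 0 T) := iFj.continuousOn_mul cj isCompact_Icc
  set S : ℝ → ℝ := fun t => S0 - ∫ τ in (0:ℝ)..t, sf τ * F τ with hS
  have h3 : IntegrableOn (fun τ => |F τ - Fj τ|) (Icc 0 T) := (iF.sub iFj).abs
  have mem : ∀ᵐ t ∂(volume.restrict (Icc (0:ℝ) T)), t ∈ Icc 0 T := ae_restrict_mem measurableSet_Icc
  have S00 : S 0 = S0 := by simp [hS]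
  have A := pos_part_le hT (u := fun t => S t - sj t) (g := fun τ => sj τ * Fj τ - sf τ * F τ) (h := fun τ => |F τ - Fj τ|)
    (i2.sub i1) h3 (by
      intro t ht
      rw [intervalIntegral.integral_sub (ii_of i2 ht) (ii_of i1 ht)]
      have := hsj t ht
      simp only [hS]; rw [this]; simp; ring)
    (ae_of_all _ fun t => abs_nonneg _) (by
      filter_upwards [hsf, mem] with t h1 h2 h4
      have e : sf t = S t := h1
      have b := bj t h2
      rw [← e] at h4
      have := F0 t
      have a1 := neg_abs_le (F t - Fj t)
      nlinarith [mul_nonneg h4.le this, abs_nonneg (F t - Fj t), mul_le_mul_of_nonneg_left a1 b.1,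
        mul_le_mul_of_nonneg_right b.2 (abs_nonneg (F t - Fj t))])
  have B := pos_part_le hT (u := fun t => sj t - S t) (g := fun τ => sf τ * F τ - sj τ * Fj τ) (h := fun τ => |F τ - Fj τ|)
    (i1.sub i2) h3 (by
      intro t ht
      rw [intervalIntegral.integral_sub (ii_of i1 ht) (ii_of i2 ht)]
      have := hsj t ht
      simp only [hS]; rw [this]; simp; ring)
    (ae_of_all _ fun t => abs_nonneg _) (by
      filter_upwards [hsf, mem] with t h1 h2 h4
      have e : sf t = S t := h1
      have b := bj t h2
      rw [← e] at h4
      have := F0 t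
      have a1 := le_abs_self (F t - Fj t)
      nlinarith [mul_nonneg h4.le this, abs_nonneg (F t - Fj t), mul_le_mul_of_nonneg_left a1 b.1,
        mul_le_mul_of_nonneg_right b.2 (abs_nonneg (F t - Fj t))])
  filter_upwards [hsf, mem] with t h1 h2
  have a := A t h2
  have b := B t h2
  have e : sf t = S t := h1
  rw [e, ← S00]
  beta_reduce at a b
  have m1 : max (S 0 - sj 0) 0 ≤ |S 0 - sj 0| := max_le (le_abs_self _) (abs_nonneg _)
  have m2 : max (sj 0 - S 0) 0 ≤ |S 0 - sj 0| := max_le (by rw [abs_sub_comm]; exact le_abs_self _) (abs_nonneg _)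
  have n1 := le_max_left (S t - sj t) 0
  have n2 := le_max_left (sj t - S t) 0
  rw [abs_le]; constructor <;> linarith

lemma err_r {T R0 : ℝ} {rf g rj gj : ℝ → ℝ}
    (ig : IntegrableOn g (Icc 0 T)) (igj : IntegrableOn gj (Icc 0 T))
    (hrf : ∀ᵐ t ∂(volume.restrict (Icc (0:ℝ) T)), rf t = R0 + ∫ τ in (0:ℝ)..t, g τ)
    (hrj : ∀ t ∈ Icc 0 T, rj t = rj 0 + ∫ τ in (0:ℝ)..t, gj τ) :
    ∀ᵐ t ∂(volume.restrict (Icc (0:ℝ) T)), |rf t - rj t| ≤ |R0 - rj 0| + ∫ τ in (0:ℝ)..t, |g τ - gj τ| := by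
  filter_upwards [hrf, ae_restrict_mem measurableSet_Icc] with t h1 h2
  have e : rf t - rj t = (R0 - rj 0) + ∫ τ in (0:ℝ)..t, (g τ - gj τ) := by
    rw [intervalIntegral.integral_sub (ii_of ig h2) (ii_of igj h2), h1, hrj t h2]; ring
  rw [e]
  exact (abs_add_le _ _).trans (by gcongr; exact intervalIntegral.abs_integral_le_integral_abs h2.1)

/-- one-dimensional squaring step -/
lemma sq_step {T E0 : ℝ} {E q Q : ℝ → ℝ} (mq : Measurable q)
    (iQ : IntegrableOn Q (Icc 0 T)) (hE : ∀ t, 0 ≤ E t) (q0 : ∀ t, 0 ≤ q t)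
    (hqQ : ∀ᵐ t ∂(volume.restrict (Icc (0:ℝ) T)), q t ^ 2 ≤ Q t)
    (h : ∀ᵐ t ∂(volume.restrict (Icc (0:ℝ) T)), E t ≤ E0 + ∫ τ in (0:ℝ)..t, q τ) :
    ∀ᵐ t ∂(volume.restrict (Icc (0:ℝ) T)), E t ^ 2 ≤ 2 * E0 ^ 2 + 2 * T * ∫ τ in (0:ℝ)..t, Q τ := by
  have iq2 : IntegrableOn (fun t => q t ^ 2) (Icc 0 T) := by
    refine Integrable.mono' iQ (mq.pow_const 2).aestronglyMeasurable ?_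
    filter_upwards [hqQ] with t ht
    rw [Real.norm_eq_abs, abs_of_nonneg (sq_nonneg _)]; exact ht
  filter_upwards [h, ae_restrict_mem measurableSet_Icc] with t h1 h2
  set ν := volume.restrict (Ioc 0 t) with hν
  have hle : ν ≤ volume.restrict (Icc 0 T) :=
    Measure.restrict_mono (Ioc_subset_Icc_self.trans (Icc_subset_Icc le_rfl h2.2)) le_rfl
  have cs := (cs_int (μ := ν) (f := q) (g := fun _ => (1:ℝ)) mq.aestronglyMeasurable
    aestronglyMeasurable_const (Integrable.mono_measure iq2 hle) (by simp)).2
  have e1 : ∫ τ in (0:ℝ)..t, q τ = ∫ τ, q τ * 1 ∂ν := by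
    rw [intervalIntegral.integral_of_le h2.1]; simp [hν]
  have e2 : ∫ x, (1:ℝ)^2 ∂ν = t := by simp [hν, Measure.real, ENNReal.toReal_ofReal h2.1]
  have e3 : ∫ x, q x ^ 2 ∂ν ≤ ∫ τ in (0:ℝ)..t, Q τ := by
    rw [intervalIntegral.integral_of_le h2.1]
    exact integral_mono_ae (Integrable.mono_measure iq2 hle) (Integrable.mono_measure iQ hle) (ae_mono hle hqQ)
  have e4 : 0 ≤ ∫ x, q x ^ 2 ∂ν := integral_nonneg fun x => sq_nonneg _
  rw [e2] at cs
  rw [e1] at h1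
  set I := ∫ τ, q τ * 1 ∂ν
  have I0 : 0 ≤ I := integral_nonneg fun x => by simpa using q0 x
  have h3 : E t ^ 2 ≤ (E0 + I)^2 := pow_le_pow_left₀ (hE t) h1 2
  have h5 : I ^ 2 ≤ T * ∫ τ in (0:ℝ)..t, Q τ := by
    calc I^2 ≤ (∫ x, q x ^ 2 ∂ν) * t := cs
      _ ≤ (∫ x, q x ^ 2 ∂ν) * T := by gcongr; exact h2.2
      _ ≤ (∫ τ in (0:ℝ)..t, Q τ) * T := by gcongr; exact h2.1.trans h2.2
      _ = _ := by ring
  nlinarith [sq_nonneg (E0 - I)]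

lemma gron_2d {T B : ℝ} (hT : 0 < T) {E Q : ℝ → ℝ → ℝ} {E0 a d : ℝ → ℝ}
    (mE : Measurable (fun p : ℝ × ℝ => E p.1 p.2)) (hE : ∀ t x, 0 ≤ E t x ∧ E t x ≤ B)
    (mE0 : Measurable E0) (hE0 : ∀ x, 0 ≤ E0 x ∧ E0 x ≤ B)
    (mQ : Measurable (fun p : ℝ × ℝ => Q p.1 p.2))
    (iQ : Integrable (fun p : ℝ × ℝ => Q p.1 p.2) ((volume.restrict (Icc 0 T)).prod mu01))
    (ha : IntegrableOn a (Icc 0 T)) (ha0 : ∀ t, 0 ≤ a t)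
    (hd : IntegrableOn d (Icc 0 T)) (hd0 : ∀ t, 0 ≤ d t)
    (h : ∀ᵐ x ∂mu01, ∀ᵐ t ∂(volume.restrict (Icc (0:ℝ) T)),
      E t x ^ 2 ≤ 2 * E0 x ^ 2 + 2 * T * ∫ τ in (0:ℝ)..t, Q τ x)
    (hQ : ∀ᵐ t ∂(volume.restrict (Icc (0:ℝ) T)), ∫ x, Q t x ∂mu01 ≤ d t + a t * ∫ x, E t x ^ 2 ∂mu01) :
    ∀ᵐ t ∂(volume.restrict (Icc (0:ℝ) T)), ∫ x, E t x ^ 2 ∂mu01 ≤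
      (2 * (∫ x, E0 x ^ 2 ∂mu01) + 2 * T * ∫ t in Icc 0 T, d t) * Real.exp (2 * T * ∫ t in Icc 0 T, a t) := by
  set ν := volume.restrict (Icc (0:ℝ) T) with hν
  set G : ℝ → ℝ := fun t => ∫ x, E t x ^ 2 ∂mu01 with hG
  have mem : ∀ᵐ t ∂ν, t ∈ Icc 0 T := ae_restrict_mem measurableSet_Icc
  have mE2 : Measurable (fun p : ℝ × ℝ => E p.1 p.2 ^ 2) := mE.pow_const 2
  have mG : Measurable G := (mE2.stronglyMeasurable.integral_prod_right' (ν := mu01)).measurable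
  have G0 : ∀ t, 0 ≤ G t := fun t => integral_nonneg fun x => sq_nonneg _
  have E2b : ∀ t x, E t x ^ 2 ≤ B ^ 2 := fun t x => pow_le_pow_left₀ (hE t x).1 (hE t x).2 2
  have iE2 : ∀ t, Integrable (fun x => E t x ^ 2) mu01 := fun t =>
    Integrable.of_bound (mE2.comp (measurable_const.prodMk measurable_id)).aestronglyMeasurable (B^2) (ae_of_all _ fun x => by
      rw [Real.norm_eq_abs, abs_of_nonneg (sq_nonneg _)]; exact E2b t x)
  have Gb : ∀ t, G t ≤ B^2 := fun t => by
    have := integral_mono (iE2 t) (integrable_const (B^2)) (E2b t)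
    simpa using this
  have iE0 : Integrable (fun x => E0 x ^ 2) mu01 :=
    Integrable.of_bound (mE0.pow_const 2).aestronglyMeasurable (B^2) (ae_of_all _ fun x => by
      rw [Real.norm_eq_abs, abs_of_nonneg (sq_nonneg _)]; exact pow_le_pow_left₀ (hE0 x).1 (hE0 x).2 2)
  have iaG : IntegrableOn (fun t => a t * G t) (Icc 0 T) := by
    refine Integrable.mul_bdd (c := B^2) ha mG.aestronglyMeasurable (ae_of_all _ fun t => ?_)
    rw [Real.norm_eq_abs, abs_of_nonneg (G0 t)]; exact Gb t
  -- swap order of a.e.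
  have mP : Measurable (fun p : ℝ × ℝ => ∫ τ in Icc 0 T, (Iic p.1).indicator (fun τ => Q τ p.2) τ) :=
    measurable_primitive_rep mQ
  have hsw : ∀ᵐ t ∂ν, ∀ᵐ x ∂mu01, E t x ^ 2 ≤ 2 * E0 x ^ 2 + 2 * T * ∫ τ in Icc 0 T, (Iic t).indicator (fun τ => Q τ x) τ := by
    rw [Measure.ae_ae_comm]
    · filter_upwards [h] with x hx
      filter_upwards [hx, mem] with t h1 h2
      rwa [primitive_rep _ h2] at h1
    · exact measurableSet_le mE2 ((((mE0.comp measurable_snd).pow_const 2).const_mul 2).add (mP.const_mul _))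
  have iQt : IntegrableOn (fun t => ∫ x, Q t x ∂mu01) (Icc 0 T) := iQ.integral_prod_left
  have main : ∀ᵐ t ∂ν, G t ≤ (2 * (∫ x, E0 x ^ 2 ∂mu01) + 2 * T * ∫ t in Icc 0 T, d t) + ∫ τ in (0:ℝ)..t, (2 * T * a τ) * G τ := by
    filter_upwards [hsw, mem] with t h1 h2
    have hle : volume.restrict (Ioc 0 t) ≤ ν :=
      Measure.restrict_mono (Ioc_subset_Icc_self.trans (Icc_subset_Icc le_rfl h2.2)) le_rfl
    have iQ' : Integrable (fun p : ℝ × ℝ => Q p.1 p.2) ((volume.restrict (Ioc 0 t)).prod mu01) :=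
      Integrable.mono_measure iQ (Measure.prod_mono hle le_rfl)
    have iP : Integrable (fun x => ∫ τ in (0:ℝ)..t, Q τ x) mu01 := by
      simp only [intervalIntegral.integral_of_le h2.1]
      exact iQ'.integral_prod_right
    have s1 : G t ≤ ∫ x, (2 * E0 x ^ 2 + 2 * T * ∫ τ in (0:ℝ)..t, Q τ x) ∂mu01 := by
      refine integral_mono_ae (iE2 t) ((iE0.const_mul 2).add (iP.const_mul _)) ?_
      filter_upwards [h1] with x hx
      rw [← primitive_rep _ h2] at hx
      exact hx
    rw [integral_add (iE0.const_mul 2) (iP.const_mul _), integral_const_mul, integral_const_mul] at s1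
    have s2 : ∫ x, (∫ τ in (0:ℝ)..t, Q τ x) ∂mu01 = ∫ τ in (0:ℝ)..t, ∫ x, Q τ x ∂mu01 := by
      simp only [intervalIntegral.integral_of_le h2.1]
      rw [integral_integral_swap]
      exact iQ'.swap
    have s3 : ∫ τ in (0:ℝ)..t, ∫ x, Q τ x ∂mu01 ≤ ∫ τ in (0:ℝ)..t, (d τ + a τ * G τ) := by
      simp only [intervalIntegral.integral_of_le h2.1]
      exact integral_mono_ae (Integrable.mono_measure iQt hle) (Integrable.mono_measure (hd.add iaG) hle) (ae_mono hle hQ)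
    rw [intervalIntegral.integral_add (ii_of hd h2) (ii_of iaG h2)] at s3
    have s4 : ∫ τ in (0:ℝ)..t, d τ ≤ ∫ τ in Icc 0 T, d τ := by
      rw [intervalIntegral.integral_of_le h2.1]
      exact integral_mono_measure hle (ae_of_all _ hd0) hd
    have s5 : ∫ τ in (0:ℝ)..t, (2 * T * a τ) * G τ = 2 * T * ∫ τ in (0:ℝ)..t, a τ * G τ := by
      rw [← intervalIntegral.integral_const_mul]; congr 1; ext τ; ring
    rw [s2] at s1
    rw [s5]
    have s6 := mul_le_mul_of_nonneg_left (s3.trans (add_le_add_left s4 _)) (show 0 ≤ 2 * T by linarith)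
    rw [mul_add] at s6
    linarith
  have gr := gronwall_L1 hT (a := fun t => 2 * T * a t) (f := G) (ha.const_mul _)
    (fun t => mul_nonneg (by linarith) (ha0 t)) (by
      have : IntegrableOn (fun t => 2 * T * (a t * G t)) (Icc 0 T) := iaG.const_mul (2*T)
      refine this.congr (ae_of_all _ fun t => ?_); simp only; ring) main
  filter_upwards [main, mem] with t h1 h2
  refine h1.trans ((gr t h2).trans ?_)
  have hb : 0 ≤ 2 * (∫ x, E0 x ^ 2 ∂mu01) + 2 * T * ∫ t in Icc 0 T, d t := by
    have u1 : 0 ≤ ∫ x, E0 x ^ 2 ∂mu01 := integral_nonneg fun x => sq_nonneg _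
    have u2 : 0 ≤ ∫ t in Icc 0 T, d t := integral_nonneg hd0
    positivity
  refine mul_le_mul_of_nonneg_left (Real.exp_le_exp.2 ?_) hb
  rw [intervalIntegral.integral_const_mul]
  refine mul_le_mul_of_nonneg_left ?_ (by linarith)
  rw [intervalIntegral.integral_of_le h2.1]
  exact integral_mono_measure (Measure.restrict_mono (Ioc_subset_Icc_self.trans (Icc_subset_Icc le_rfl h2.2)) le_rfl) (ae_of_all _ ha0) ha


lemma int_bdd {f : ℝ → ℝ} {C : ℝ} (mf : Measurable f) (hf : ∀ x, |f x| ≤ C) : Integrable f mu01 :=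
  Integrable.of_bound mf.aestronglyMeasurable C (ae_of_all _ hf)

lemma meas_slice {f : ℝ → ℝ → ℝ} (h : Measurable (fun p : ℝ × ℝ => f p.1 p.2)) (x : ℝ) : Measurable (f x) :=
  h.comp (measurable_prodMk_left (x := x))

lemma slice_q {n : ℕ} (hn : 0 < n) {C : ℝ} (hC : 0 ≤ C) {u b I e : ℝ → ℝ} {B i : Fin n → ℝ}
    {A : Fin n → Fin n → ℝ} {x : ℝ} {j : Fin n} (hx : x ∈ Inj n j)
    (mu : Measurable u) (u2 : Integrable (fun y => u y ^ 2) mu01)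
    (mb : Measurable b) (hb : ∀ y, 0 ≤ b y ∧ b y ≤ C)
    (mI : Measurable I) (hI : ∀ y, 0 ≤ I y ∧ I y ≤ 1)
    (hB : ∀ k, 0 ≤ B k ∧ B k ≤ C)
    (ie : Integrable (fun y => e y ^ 2) mu01)
    (he : ∀ᵐ y ∂mu01, |I y - stepFn n i y| ≤ e y) :
    ((∫ y, b y * u y * I y ∂mu01) - 1 / (n:ℝ) * ∑ k, B k * A j k * i k)^2 ≤
      2 * (∫ y, (b y * u y - stepFn n B y * stepKer n A x y)^2 ∂mu01) +
      2 * C^2 * (∫ y, stepKer n A x y ^ 2 ∂mu01) * ∫ y, e y ^ 2 ∂mu01 := by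
  have bb : ∀ y, 0 ≤ stepFn n B y ∧ stepFn n B y ≤ C := stepFn_mem hC hB
  have mK : Measurable (fun y => stepKer n A x y) := meas_slice (stepKer_meas n A) x
  have iK2 : Integrable (fun y => stepKer n A x y ^ 2) mu01 := by
    refine int_bdd (mK.pow_const 2) (C := (∑ j, ∑ k, |A j k|)^2) fun y => ?_
    rw [abs_of_nonneg (sq_nonneg _), ← sq_abs]
    exact pow_le_pow_left₀ (abs_nonneg _) (stepKer_bound n A x y) 2
  have mf : Measurable (fun y => b y * u y - stepFn n B y * stepKer n A x y) :=
    (mb.mul mu).sub ((stepFn_meas n B).mul mK)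
  have f2 : Integrable (fun y => (b y * u y - stepFn n B y * stepKer n A x y)^2) mu01 := by
    refine ((u2.add iK2).const_mul (2 * C^2)).mono' (mf.pow_const 2).aestronglyMeasurable (ae_of_all _ fun y => ?_)
    rw [Real.norm_eq_abs, abs_of_nonneg (sq_nonneg _)]
    exact pw_bound (hb y) (bb y)
  have I2le : ∀ y, I y ^ 2 ≤ 1 := fun y => pow_le_one₀ (hI y).1 (hI y).2
  have I2 : Integrable (fun y => I y ^ 2) mu01 := int_bdd (mI.pow_const 2) (C := 1) fun y => by
    rw [abs_of_nonneg (sq_nonneg _)]; exact I2le y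
  obtain ⟨i1, c1⟩ := cs_int (μ := mu01) mf.aestronglyMeasurable mI.aestronglyMeasurable f2 I2
  have mg : Measurable (fun y => stepFn n B y * (I y - stepFn n i y)) :=
    (stepFn_meas n B).mul (mI.sub (stepFn_meas n i))
  have gle : ∀ᵐ y ∂mu01, (stepFn n B y * (I y - stepFn n i y))^2 ≤ C^2 * e y ^ 2 := by
    filter_upwards [he] with y hy
    rw [mul_pow]
    refine mul_le_mul (pow_le_pow_left₀ (bb y).1 (bb y).2 2) ?_ (sq_nonneg _) (sq_nonneg _)
    rw [← sq_abs]; exact pow_le_pow_left₀ (abs_nonneg _) hy 2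
  have g2 : Integrable (fun y => (stepFn n B y * (I y - stepFn n i y))^2) mu01 := by
    refine (ie.const_mul (C^2)).mono' (mg.pow_const 2).aestronglyMeasurable ?_
    filter_upwards [gle] with y hy
    rw [Real.norm_eq_abs, abs_of_nonneg (sq_nonneg _)]; exact hy
  obtain ⟨i2, c2⟩ := cs_int (μ := mu01) mK.aestronglyMeasurable mg.aestronglyMeasurable iK2 g2
  have g2le : ∫ y, (stepFn n B y * (I y - stepFn n i y))^2 ∂mu01 ≤ C^2 * ∫ y, e y ^ 2 ∂mu01 := by
    rw [← integral_const_mul]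
    exact integral_mono_ae g2 (ie.const_mul _) gle
  have I2i : ∫ y, I y ^ 2 ∂mu01 ≤ 1 := by
    have := integral_mono I2 (integrable_const 1) I2le
    simpa using this
  have eF : 1 / (n:ℝ) * ∑ k, B k * A j k * i k = ∫ y, stepFn n (fun k => B k * A j k * i k) y ∂mu01 :=
    (integral_stepFn hn _).symm
  have ebu : Integrable (fun y => b y * u y * I y) mu01 := by
    have := i1.add (Integrable.mul_bdd (c := 1) (f := fun y => stepFn n B y * stepKer n A x y) (g := I)
      (by
        obtain ⟨h, _⟩ := cs_int (μ := mu01) (stepFn_meas n B).aestronglyMeasurable mK.aestronglyMeasurable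
          (int_bdd ((stepFn_meas n B).pow_const 2) (C := C^2) fun y => by
            rw [abs_of_nonneg (sq_nonneg _)]; exact pow_le_pow_left₀ (bb y).1 (bb y).2 2) iK2
        exact h) mI.aestronglyMeasurable (ae_of_all _ fun y => by
          rw [Real.norm_eq_abs, abs_of_nonneg (hI y).1]; exact (hI y).2))
    refine this.congr (ae_of_all _ fun y => ?_)
    simp only [Pi.add_apply]; ring
  rw [eF, ← integral_sub ebu (stepFn_integrable n _)]
  have e2 : ∫ y, (b y * u y * I y - stepFn n (fun k => B k * A j k * i k) y) ∂mu01 =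
      (∫ y, (b y * u y - stepFn n B y * stepKer n A x y) * I y ∂mu01) +
      ∫ y, stepKer n A x y * (stepFn n B y * (I y - stepFn n i y)) ∂mu01 := by
    rw [← integral_add i1 i2]
    congr 1; ext y
    rw [stepKer_eq hx]
    rcases stepFn_cases n y with ⟨k, hk⟩ | hk
    · simp only [hk]; ring
    · simp only [hk]; ring
  rw [e2]
  set P := ∫ y, (b y * u y - stepFn n B y * stepKer n A x y) * I y ∂mu01
  set P' := ∫ y, stepKer n A x y * (stepFn n B y * (I y - stepFn n i y)) ∂mu01
  set X := ∫ y, (b y * u y - stepFn n B y * stepKer n A x y)^2 ∂mu01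
  set Y := ∫ y, stepKer n A x y ^ 2 ∂mu01
  have X0 : 0 ≤ X := integral_nonneg fun y => sq_nonneg _
  have Y0 : 0 ≤ Y := integral_nonneg fun y => sq_nonneg _
  have k1 : P^2 ≤ X := c1.trans (by nlinarith)
  have k2 : P'^2 ≤ Y * (C^2 * ∫ y, e y ^ 2 ∂mu01) := c2.trans (mul_le_mul_of_nonneg_left g2le Y0)
  nlinarith [sq_nonneg (P - P')]

lemma slice_q2 {C g g' I i e : ℝ} (hg' : 0 ≤ g' ∧ g' ≤ C) (hI : 0 ≤ I ∧ I ≤ 1) (he : |I - i| ≤ e) :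
    (g * I - g' * i)^2 ≤ 2 * (g - g')^2 + 2 * C^2 * e^2 := by
  have e1 : g * I - g' * i = (g - g') * I + g' * (I - i) := by ring
  have h1 : ((g - g') * I)^2 ≤ (g - g')^2 := by
    rw [mul_pow]
    have : I^2 ≤ 1 := pow_le_one₀ hI.1 hI.2
    nlinarith [sq_nonneg (g - g')]
  have h2 : (g' * (I - i))^2 ≤ C^2 * e^2 := by
    rw [mul_pow]
    refine mul_le_mul (pow_le_pow_left₀ hg'.1 hg'.2 2) ?_ (sq_nonneg _) (sq_nonneg _)
    rw [← sq_abs]; exact pow_le_pow_left₀ (abs_nonneg _) he 2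
  rw [e1]
  nlinarith [sq_nonneg ((g - g') * I - g' * (I - i))]


structure Coef (T C : ℝ) (W : ℝ → ℝ → ℝ → ℝ) (β γ : ℝ → ℝ → ℝ) : Prop where
  hT : 0 < T
  hC : 0 ≤ C
  mW : Measurable (fun p : ℝ × ℝ × ℝ => W p.1 p.2.1 p.2.2)
  W0 : ∀ t x y, 0 ≤ W t x y
  W2 : ∀ t, Integrable (fun p : ℝ × ℝ => W t p.1 p.2 ^ 2) (mu01.prod mu01)
  W2x : ∀ t x, Integrable (fun y => W t x y ^ 2) mu01
  iw2 : IntegrableOn (fun t => ∫ p : ℝ × ℝ, W t p.1 p.2 ^ 2 ∂(mu01.prod mu01)) (Icc 0 T)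
  mβ : Measurable (fun p : ℝ × ℝ => β p.1 p.2)
  mγ : Measurable (fun p : ℝ × ℝ => γ p.1 p.2)
  hβ : ∀ t x, 0 ≤ β t x ∧ β t x ≤ C
  hγ : ∀ t x, 0 ≤ γ t x ∧ γ t x ≤ C

noncomputable def w2f (W : ℝ → ℝ → ℝ → ℝ) (t : ℝ) : ℝ := ∫ p : ℝ × ℝ, W t p.1 p.2 ^ 2 ∂(mu01.prod mu01)

noncomputable def dfun (W : ℝ → ℝ → ℝ → ℝ) (β : ℝ → ℝ → ℝ) (n : ℕ) (t x y : ℝ) : ℝ :=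
  (β t y * W t x y - stepFn n (fun j => avg1 n j (β t)) y * stepKer n (fun j k => avg2 n j k (W t)) x y)^2

noncomputable def Dn (W : ℝ → ℝ → ℝ → ℝ) (β : ℝ → ℝ → ℝ) (n : ℕ) (t : ℝ) : ℝ :=
  ∫ p : ℝ × ℝ, dfun W β n t p.1 p.2 ∂(mu01.prod mu01)

noncomputable def Gn (γ : ℝ → ℝ → ℝ) (n : ℕ) (t : ℝ) : ℝ :=
  ∫ x, (γ t x - stepFn n (fun j => avg1 n j (γ t)) x)^2 ∂mu01

section coef
variable {T C : ℝ} {W : ℝ → ℝ → ℝ → ℝ} {β γ : ℝ → ℝ → ℝ}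

lemma meas_3to21 {f : ℝ → ℝ → ℝ → ℝ} (h : Measurable (fun p : ℝ × ℝ × ℝ => f p.1 p.2.1 p.2.2)) :
    Measurable (fun p : (ℝ × ℝ) × ℝ => f p.1.1 p.1.2 p.2) :=
  h.comp (measurable_fst.fst.prodMk (measurable_fst.snd.prodMk measurable_snd))

lemma meas_slice3 {f : ℝ → ℝ → ℝ → ℝ} (h : Measurable (fun p : ℝ × ℝ × ℝ => f p.1 p.2.1 p.2.2)) (t : ℝ) :
    Measurable (fun p : ℝ × ℝ => f t p.1 p.2) :=
  h.comp (measurable_prodMk_left (x := t))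

lemma meas_int3 {f : ℝ → ℝ → ℝ → ℝ} (h : Measurable (fun p : ℝ × ℝ × ℝ => f p.1 p.2.1 p.2.2)) :
    Measurable (fun p : ℝ × ℝ => ∫ y, f p.1 p.2 y ∂mu01) :=
  ((meas_3to21 h).stronglyMeasurable.integral_prod_right' (ν := mu01)).measurable

lemma meas_int12 {f : ℝ → ℝ → ℝ → ℝ} (h : Measurable (fun p : ℝ × ℝ × ℝ => f p.1 p.2.1 p.2.2)) :
    Measurable (fun t => ∫ p : ℝ × ℝ, f t p.1 p.2 ∂(mu01.prod mu01)) :=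
  (h.stronglyMeasurable.integral_prod_right' (ν := mu01.prod mu01)).measurable

lemma Coef.W1 (h : Coef T C W β γ) (t : ℝ) : Integrable (fun p : ℝ × ℝ => W t p.1 p.2) (mu01.prod mu01) := by
  refine ((integrable_const (1:ℝ)).add (h.W2 t)).mono' (meas_slice3 h.mW t).aestronglyMeasurable (ae_of_all _ fun p => ?_)
  simp only [Pi.add_apply]
  rw [Real.norm_eq_abs, abs_of_nonneg (h.W0 _ _ _)]
  nlinarith [sq_nonneg (W t p.1 p.2 - 1)]

lemma Coef.W1x (h : Coef T C W β γ) (t x : ℝ) : Integrable (fun y => W t x y) mu01 := by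
  refine ((integrable_const (1:ℝ)).add (h.W2x t x)).mono' (meas_slice (meas_slice3 h.mW t) x).aestronglyMeasurable (ae_of_all _ fun p => ?_)
  simp only [Pi.add_apply]
  rw [Real.norm_eq_abs, abs_of_nonneg (h.W0 _ _ _)]
  nlinarith [sq_nonneg (W t x p - 1)]

lemma Coef.mWn (h : Coef T C W β γ) (n : ℕ) :
    Measurable (fun p : ℝ × ℝ × ℝ => stepKer n (fun j k => avg2 n j k (W p.1)) p.2.1 p.2.2) :=
  meas_stepKer_t (A := fun j k t => avg2 n j k (W t)) fun j k => meas_avg2 h.mW j k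

lemma Coef.mβn (h : Coef T C W β γ) (n : ℕ) :
    Measurable (fun p : ℝ × ℝ => stepFn n (fun j => avg1 n j (β p.1)) p.2) :=
  meas_stepFn_t (v := fun j t => avg1 n j (β t)) fun j => meas_avg1 h.mβ j

lemma Coef.mγn (h : Coef T C W β γ) (n : ℕ) :
    Measurable (fun p : ℝ × ℝ => stepFn n (fun j => avg1 n j (γ p.1)) p.2) :=
  meas_stepFn_t (v := fun j t => avg1 n j (γ t)) fun j => meas_avg1 h.mγ j

lemma Coef.mdfun (h : Coef T C W β γ) (n : ℕ) :
    Measurable (fun p : ℝ × ℝ × ℝ => dfun W β n p.1 p.2.1 p.2.2) := by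
  unfold dfun
  have hm : Measurable (fun p : ℝ × ℝ × ℝ => (p.1, p.2.2)) := measurable_fst.prodMk measurable_snd.snd
  exact (((h.mβ.comp hm).mul h.mW).sub (((h.mβn n).comp hm).mul (h.mWn n))).pow_const 2

lemma Coef.bβn (h : Coef T C W β γ) (n : ℕ) (t y : ℝ) :
    0 ≤ stepFn n (fun j => avg1 n j (β t)) y ∧ stepFn n (fun j => avg1 n j (β t)) y ≤ C :=
  stepFn_mem h.hC (fun j => avg1_mem j (meas_slice h.mβ t) (h.hβ t)) y

lemma Coef.bγn (h : Coef T C W β γ) (n : ℕ) (t y : ℝ) :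
    0 ≤ stepFn n (fun j => avg1 n j (γ t)) y ∧ stepFn n (fun j => avg1 n j (γ t)) y ≤ C :=
  stepFn_mem h.hC (fun j => avg1_mem j (meas_slice h.mγ t) (h.hγ t)) y

lemma Coef.iWn2 (h : Coef T C W β γ) (n : ℕ) (t : ℝ) :
    Integrable (fun p : ℝ × ℝ => stepKer n (fun j k => avg2 n j k (W t)) p.1 p.2 ^ 2) (mu01.prod mu01) := by
  refine Integrable.of_bound ((stepKer_meas n _).pow_const 2).aestronglyMeasurable ((∑ j, ∑ k, |avg2 n j k (W t)|)^2)
    (ae_of_all _ fun p => ?_)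
  rw [Real.norm_eq_abs, abs_of_nonneg (sq_nonneg _), ← sq_abs]
  exact pow_le_pow_left₀ (abs_nonneg _) (stepKer_bound n _ p.1 p.2) 2

lemma Coef.idfun (h : Coef T C W β γ) (n : ℕ) (t : ℝ) :
    Integrable (fun p : ℝ × ℝ => dfun W β n t p.1 p.2) (mu01.prod mu01) := by
  refine (((h.W2 t).add (h.iWn2 n t)).const_mul (2 * C^2)).mono' (meas_slice3 (h.mdfun n) t).aestronglyMeasurable
    (ae_of_all _ fun p => ?_)
  unfold dfun
  rw [Real.norm_eq_abs, abs_of_nonneg (sq_nonneg _)]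
  exact pw_bound (h.hβ _ _) (h.bβn n t _)

lemma Dn_nonneg (n : ℕ) (t : ℝ) : 0 ≤ Dn W β n t := integral_nonneg fun p => sq_nonneg _
lemma Gn_nonneg (n : ℕ) (t : ℝ) : 0 ≤ Gn γ n t := integral_nonneg fun p => sq_nonneg _
lemma w2f_nonneg (t : ℝ) : 0 ≤ w2f W t := integral_nonneg fun p => sq_nonneg _

lemma Coef.Dn_le (h : Coef T C W β γ) {n : ℕ} (hn : 0 < n) (t : ℝ) : Dn W β n t ≤ 4 * C^2 * w2f W t := by
  have h1 : Dn W β n t ≤ ∫ p : ℝ × ℝ, 2 * C^2 * (W t p.1 p.2 ^ 2 + stepKer n (fun j k => avg2 n j k (W t)) p.1 p.2 ^ 2) ∂(mu01.prod mu01) := by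
    refine integral_mono (h.idfun n t) (((h.W2 t).add (h.iWn2 n t)).const_mul (2 * C^2)) fun p => ?_
    exact pw_bound (h.hβ _ _) (h.bβn n t _)
  rw [integral_const_mul, integral_add (h.W2 t) (h.iWn2 n t)] at h1
  have h2 := integral_stepKer_sq_le (h.W1 t) (h.W2 t) hn
  unfold w2f
  nlinarith [sq_nonneg C]

lemma Coef.Gn_le (h : Coef T C W β γ) (n : ℕ) (t : ℝ) : Gn γ n t ≤ C^2 := by
  have h2 : ∀ x, (γ t x - stepFn n (fun j => avg1 n j (γ t)) x)^2 ≤ C^2 := fun x => by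
    have h1 := h.hγ t x
    have h2 := h.bγn n t x
    exact sq_le_sq' (by linarith) (by linarith)
  have := integral_mono_of_nonneg (μ := mu01) (ae_of_all _ fun x => sq_nonneg (γ t x - stepFn n (fun j => avg1 n j (γ t)) x)) (integrable_const (C^2)) (ae_of_all _ h2)
  simpa [Gn] using this

lemma Coef.mDn (h : Coef T C W β γ) (n : ℕ) : Measurable (Dn W β n) := meas_int12 (h.mdfun n)

lemma Coef.mGn (h : Coef T C W β γ) (n : ℕ) : Measurable (Gn γ n) :=
  (((h.mγ.sub (h.mγn n)).pow_const 2).stronglyMeasurable.integral_prod_right' (ν := mu01)).measurable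

lemma Coef.iw2' (h : Coef T C W β γ) : IntegrableOn (w2f W) (Icc 0 T) := h.iw2

lemma Coef.iDn (h : Coef T C W β γ) {n : ℕ} (hn : 0 < n) : IntegrableOn (Dn W β n) (Icc 0 T) := by
  refine (h.iw2'.const_mul (4*C^2)).mono' (h.mDn n).aestronglyMeasurable (ae_of_all _ fun t => ?_)
  rw [Real.norm_eq_abs, abs_of_nonneg (Dn_nonneg n t)]; exact h.Dn_le hn t

lemma Coef.iGn (h : Coef T C W β γ) (n : ℕ) : IntegrableOn (Gn γ n) (Icc 0 T) := by
  refine Integrable.of_bound (h.mGn n).aestronglyMeasurable (C^2) (ae_of_all _ fun t => ?_)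
  rw [Real.norm_eq_abs, abs_of_nonneg (Gn_nonneg n t)]; exact h.Gn_le n t

lemma Coef.tendsto_d (h : Coef T C W β γ) :
    Tendsto (fun n => ∫ t in Icc 0 T, (4 * Dn W β n t + 4 * Gn γ n t)) atTop (nhds 0) := by
  have e0 : ∫ t in Icc 0 T, (0:ℝ) = 0 := by simp
  suffices hh : Tendsto (fun n => ∫ t in Icc 0 T, (4 * Dn W β n t + 4 * Gn γ n t)) atTop (nhds (∫ t in Icc 0 T, (0:ℝ))) by
    rwa [e0] at hh
  refine tendsto_integral_filter_of_dominated_convergence (fun t => 4 * (4 * C^2 * w2f W t) + 4 * C^2) ?_ ?_ ?_ ?_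
  · exact Eventually.of_forall fun n => (((h.mDn n).const_mul 4).add ((h.mGn n).const_mul 4)).aestronglyMeasurable
  · filter_upwards [eventually_gt_atTop 0] with n hn
    refine ae_of_all _ fun t => ?_
    have h1 := Dn_nonneg (W := W) (β := β) n t
    have h2 := Gn_nonneg (γ := γ) n t
    rw [Real.norm_eq_abs, abs_of_nonneg (by linarith)]
    have := h.Dn_le hn t
    have := h.Gn_le n t
    linarith
  · exact ((h.iw2'.const_mul (4*C^2)).const_mul 4).add (integrable_const _)
  · refine ae_of_all _ fun t => ?_
    have h1 : Tendsto (fun n => Dn W β n t) atTop (nhds 0) :=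
      slice_conv h.hC (meas_slice3 h.mW t) (meas_slice h.mβ t) (h.hβ t) (h.W1 t) (h.W2 t)
    have h2 : Tendsto (fun n => Gn γ n t) atTop (nhds 0) :=
      slice_conv1 h.hC (meas_slice h.mγ t) (h.hγ t)
    simpa using (h1.const_mul 4).add (h2.const_mul 4)

lemma Coef.iA (h : Coef T C W β γ) {n : ℕ} (j k : Fin n) : IntegrableOn (fun t => avg2 n j k (W t)) (Icc 0 T) := by
  have hi : IntegrableOn (fun t => 1 + (n:ℝ)^2 * w2f W t) (Icc 0 T) := (integrable_const (1:ℝ)).add (h.iw2'.const_mul _)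
  refine hi.mono' (meas_avg2 h.mW j k).aestronglyMeasurable (ae_of_all _ fun t => ?_)
  have a0 := avg2_nonneg j k (h.W0 t)
  rw [Real.norm_eq_abs, abs_of_nonneg a0]
  have a1 := avg2_jensen j k (h.W1 t) (h.W2 t)
  have a2 : avg2 n j k (fun x y => W t x y ^ 2) ≤ (n:ℝ)^2 * w2f W t := by
    rw [avg2_eq (U := fun x y => W t x y ^ 2) j k (h.W2 t), ← prod_restrict_Inj]
    refine mul_le_mul_of_nonneg_left ?_ (by positivity)
    exact integral_mono_measure (Measure.prod_mono (restrict_Inj_le n j) (restrict_Inj_le n k)) (ae_of_all _ fun p => sq_nonneg _) (h.W2 t)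
  nlinarith [sq_nonneg (avg2 n j k (W t) - 1)]

lemma Coef.iβA (h : Coef T C W β γ) {n : ℕ} (j k : Fin n) :
    IntegrableOn (fun t => avg1 n k (β t) * avg2 n j k (W t)) (Icc 0 T) := by
  refine Integrable.bdd_mul (c := C) (h.iA j k) (meas_avg1 h.mβ k).aestronglyMeasurable (ae_of_all _ fun t => ?_)
  have := avg1_mem k (meas_slice h.mβ t) (h.hβ t)
  rw [Real.norm_eq_abs, abs_of_nonneg this.1]; exact this.2

/-- integrability on the time-space product from slices -/
lemma integrable_tx {f : ℝ → ℝ → ℝ} {g : ℝ → ℝ} (mf : Measurable (fun p : ℝ × ℝ => f p.1 p.2)) (f0 : ∀ t x, 0 ≤ f t x)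
    (hs : ∀ t, Integrable (f t) mu01) (hg : IntegrableOn g (Icc 0 T)) (hle : ∀ᵐ t ∂(volume.restrict (Icc (0:ℝ) T)), ∫ x, f t x ∂mu01 ≤ g t) :
    Integrable (fun p : ℝ × ℝ => f p.1 p.2) ((volume.restrict (Icc 0 T)).prod mu01) := by
  rw [integrable_prod_iff mf.aestronglyMeasurable]
  refine ⟨ae_of_all _ hs, ?_⟩
  refine Integrable.mono' hg ?_ ?_
  · exact (mf.norm.stronglyMeasurable.integral_prod_right' (ν := mu01)).aestronglyMeasurable
  · filter_upwards [hle] with t ht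
    have : ∫ y, ‖f t y‖ ∂mu01 = ∫ x, f t x ∂mu01 := by
      congr 1; ext y; rw [Real.norm_eq_abs, abs_of_nonneg (f0 t y)]
    rw [this, Real.norm_eq_abs, abs_of_nonneg (integral_nonneg (f0 t))]
    exact ht

noncomputable def Fc (W : ℝ → ℝ → ℝ → ℝ) (β ic : ℝ → ℝ → ℝ) (t x : ℝ) : ℝ := ∫ y, β t y * W t x y * ic t y ∂mu01

lemma Coef.mFc (h : Coef T C W β γ) {ic : ℝ → ℝ → ℝ} (mi : Measurable (fun p : ℝ × ℝ => ic p.1 p.2)) :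
    Measurable (fun p : ℝ × ℝ => Fc W β ic p.1 p.2) := by
  have hm : Measurable (fun p : ℝ × ℝ × ℝ => (p.1, p.2.2)) := measurable_fst.prodMk measurable_snd.snd
  exact meas_int3 (f := fun t x y => β t y * W t x y * ic t y) (((h.mβ.comp hm).mul h.mW).mul (mi.comp hm))

lemma Coef.Fc_nonneg (h : Coef T C W β γ) {ic : ℝ → ℝ → ℝ} (hi : ∀ t x, 0 ≤ ic t x ∧ ic t x ≤ 1) (t x : ℝ) :
    0 ≤ Fc W β ic t x :=
  integral_nonneg fun y => mul_nonneg (mul_nonneg (h.hβ t y).1 (h.W0 t x y)) (hi t y).1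

lemma Coef.iFc (h : Coef T C W β γ) {ic : ℝ → ℝ → ℝ} (mi : Measurable (fun p : ℝ × ℝ => ic p.1 p.2))
    (hi : ∀ t x, 0 ≤ ic t x ∧ ic t x ≤ 1) :
    Integrable (fun p : ℝ × ℝ => Fc W β ic p.1 p.2) ((volume.restrict (Icc 0 T)).prod mu01) := by
  have hle : ∀ t x, Fc W β ic t x ≤ 1 + C^2 * ∫ y, W t x y ^ 2 ∂mu01 := by
    intro t x
    have : Fc W β ic t x ≤ ∫ y, (1 + C^2 * W t x y ^ 2) ∂mu01 := by
      refine integral_mono_of_nonneg (ae_of_all _ fun y => mul_nonneg (mul_nonneg (h.hβ t y).1 (h.W0 t x y)) (hi t y).1)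
        ((integrable_const _).add ((h.W2x t x).const_mul _)) (ae_of_all _ fun y => ?_)
      have h1 := h.hβ t y
      have h2 := h.W0 t x y
      have h3 := hi t y
      have h4 : β t y * W t x y ≤ C * W t x y := mul_le_mul_of_nonneg_right h1.2 h2
      have h5 : β t y * W t x y * ic t y ≤ β t y * W t x y * 1 := mul_le_mul_of_nonneg_left h3.2 (mul_nonneg h1.1 h2)
      simp only
      nlinarith [sq_nonneg (C * W t x y - 1), sq_nonneg (C * W t x y)]
    rwa [integral_add (integrable_const _) ((h.W2x t x).const_mul _), integral_const_mul, integral_const, probReal_univ, one_smul] at this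
  have iω : ∀ t, Integrable (fun x => ∫ y, W t x y ^ 2 ∂mu01) mu01 := fun t => (h.W2 t).integral_prod_left
  have ib : ∀ t, Integrable (fun x => 1 + C^2 * ∫ y, W t x y ^ 2 ∂mu01) mu01 := fun t =>
    (integrable_const _).add ((iω t).const_mul _)
  have hgi : IntegrableOn (fun t => 1 + C^2 * w2f W t) (Icc 0 T) := (integrable_const (1:ℝ)).add (h.iw2'.const_mul _)
  refine integrable_tx (h.mFc mi) (h.Fc_nonneg hi) ?_ (g := fun t => 1 + C^2 * w2f W t)
    hgi (ae_of_all _ fun t => ?_)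
  · intro t
    refine (ib t).mono' (meas_slice (h.mFc mi) t).aestronglyMeasurable (ae_of_all _ fun x => ?_)
    rw [Real.norm_eq_abs, abs_of_nonneg (h.Fc_nonneg hi t x)]
    exact hle t x
  · have := integral_mono_of_nonneg (ae_of_all _ (h.Fc_nonneg hi t)) (ib t) (ae_of_all _ (hle t))
    rw [integral_add (integrable_const _) ((iω t).const_mul _), integral_const_mul, integral_const, probReal_univ, one_smul] at this
    unfold w2f
    rw [integral_prod _ (h.W2 t)]
    exact this

end coef


structure ContSol (T : ℝ) (W : ℝ → ℝ → ℝ → ℝ) (β γ : ℝ → ℝ → ℝ) (s0 r0 : ℝ → ℝ) (sc ic rc : ℝ → ℝ → ℝ) : Prop where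
  ms : Measurable (fun p : ℝ × ℝ => sc p.1 p.2)
  mi : Measurable (fun p : ℝ × ℝ => ic p.1 p.2)
  mr : Measurable (fun p : ℝ × ℝ => rc p.1 p.2)
  hs : ∀ t x, 0 ≤ sc t x ∧ sc t x ≤ 1
  hi : ∀ t x, 0 ≤ ic t x ∧ ic t x ≤ 1
  hr : ∀ t x, 0 ≤ rc t x ∧ rc t x ≤ 1
  ms0 : Measurable s0
  mr0 : Measurable r0
  hs0 : ∀ x, 0 ≤ s0 x ∧ s0 x ≤ 1
  hr0 : ∀ x, 0 ≤ r0 x ∧ r0 x ≤ 1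
  hsum : ∀ᵐ p ∂((volume.restrict (Icc 0 T)).prod mu01), sc p.1 p.2 + ic p.1 p.2 + rc p.1 p.2 = 1
  eqs : ∀ᵐ p ∂((volume.restrict (Icc 0 T)).prod mu01),
    sc p.1 p.2 = s0 p.2 - ∫ τ in (0:ℝ)..p.1, sc τ p.2 * Fc W β ic τ p.2
  eqr : ∀ᵐ p ∂((volume.restrict (Icc 0 T)).prod mu01),
    rc p.1 p.2 = r0 p.2 + ∫ τ in (0:ℝ)..p.1, γ τ p.2 * ic τ p.2

structure Disc (T : ℝ) (n : ℕ) (W : ℝ → ℝ → ℝ → ℝ) (β γ : ℝ → ℝ → ℝ) (s0 r0 : ℝ → ℝ) (s i r : Fin n → ℝ → ℝ) : Prop where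
  ms : ∀ j, Measurable (s j)
  mi : ∀ j, Measurable (i j)
  mr : ∀ j, Measurable (r j)
  cs : ∀ j, ContinuousOn (s j) (Icc 0 T)
  hs : ∀ j t, 0 ≤ s j t ∧ s j t ≤ 1
  hi : ∀ j t, 0 ≤ i j t ∧ i j t ≤ 1
  hr : ∀ j t, 0 ≤ r j t ∧ r j t ≤ 1
  hsum : ∀ j t, s j t + i j t + r j t = 1
  eqs : ∀ j, ∀ t ∈ Icc 0 T, s j t = s j 0 - ∫ τ in (0:ℝ)..t,
        s j τ * (1 / (n : ℝ) * ∑ k : Fin n, avg1 n k (β τ) * avg2 n j k (W τ) * i k τ)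
  eqr : ∀ j, ∀ t ∈ Icc 0 T, r j t = r j 0 + ∫ τ in (0:ℝ)..t, avg1 n j (γ τ) * i j τ
  is : ∀ j, s j 0 = avg1 n j s0
  ir : ∀ j, r j 0 = avg1 n j r0

noncomputable def Ef {n : ℕ} (sc rc : ℝ → ℝ → ℝ) (s r : Fin n → ℝ → ℝ) (t x : ℝ) : ℝ :=
  |sc t x - stepFn n (fun j => s j t) x| + |rc t x - stepFn n (fun j => r j t) x|

noncomputable def E0f (n : ℕ) (s0 r0 : ℝ → ℝ) (x : ℝ) : ℝ :=
  |s0 x - stepFn n (fun j => avg1 n j s0) x| + |r0 x - stepFn n (fun j => avg1 n j r0) x|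

lemma ae_swap' {μ ν : Measure ℝ} [SFinite μ] [SFinite ν] {P : ℝ × ℝ → Prop} (h : ∀ᵐ p ∂(ν.prod μ), P p) :
    ∀ᵐ x ∂μ, ∀ᵐ t ∂ν, P (t, x) :=
  Measure.ae_ae_of_ae_prod ((Measure.measurePreserving_swap (μ := μ) (ν := ν)).quasiMeasurePreserving.ae h)

lemma abs_diff_le_one {a b : ℝ} (ha : 0 ≤ a ∧ a ≤ 1) (hb : 0 ≤ b ∧ b ≤ 1) : |a - b| ≤ 1 := by
  rw [abs_le]; constructor <;> linarith [ha.1, ha.2, hb.1, hb.2]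

set_option maxHeartbeats 1000000 in
lemma core {T C : ℝ} {W : ℝ → ℝ → ℝ → ℝ} {β γ : ℝ → ℝ → ℝ} {s0 r0 : ℝ → ℝ} {sc ic rc : ℝ → ℝ → ℝ}
    {n : ℕ} {s i r : Fin n → ℝ → ℝ} (hn : 0 < n)
    (h : Coef T C W β γ) (hc : ContSol T W β γ s0 r0 sc ic rc) (hd : Disc T n W β γ s0 r0 s i r) :
    ∀ᵐ t ∂(volume.restrict (Icc (0:ℝ) T)), ∫ x, Ef sc rc s r t x ^ 2 ∂mu01 ≤
      (2 * (∫ x, E0f n s0 r0 x ^ 2 ∂mu01) + 2 * T * ∫ t in Icc 0 T, (4 * Dn W β n t + 4 * Gn γ n t)) *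
        Real.exp (2 * T * ∫ t in Icc 0 T, 4 * C^2 * (w2f W t + 1)) := by
  set E : ℝ → ℝ → ℝ := Ef sc rc s r with hEd
  set ν := volume.restrict (Icc (0:ℝ) T) with hν
  have mE : Measurable (fun p : ℝ × ℝ => E p.1 p.2) := by
    have a1 := hc.ms.sub (meas_stepFn_t hd.ms)
    have a2 := hc.mr.sub (meas_stepFn_t hd.mr)
    exact (measurable_norm.comp a1).add (measurable_norm.comp a2)
  have hE : ∀ t x, 0 ≤ E t x ∧ E t x ≤ 2 := fun t x => by
    refine ⟨add_nonneg (abs_nonneg _) (abs_nonneg _), ?_⟩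
    have a1 := abs_diff_le_one (hc.hs t x) (stepFn_mem zero_le_one (fun j => hd.hs j t) x)
    have a2 := abs_diff_le_one (hc.hr t x) (stepFn_mem zero_le_one (fun j => hd.hr j t) x)
    simp only [hEd, Ef]; linarith
  have mE0 : Measurable (E0f n s0 r0) := by
    have a1 := hc.ms0.sub (stepFn_meas n (fun j => avg1 n j s0))
    have a2 := hc.mr0.sub (stepFn_meas n (fun j => avg1 n j r0))
    exact (measurable_norm.comp a1).add (measurable_norm.comp a2)
  have hE0 : ∀ x, 0 ≤ E0f n s0 r0 x ∧ E0f n s0 r0 x ≤ 2 := fun x => by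
    refine ⟨add_nonneg (abs_nonneg _) (abs_nonneg _), ?_⟩
    have a1 := abs_diff_le_one (hc.hs0 x) (stepFn_mem zero_le_one (fun j => avg1_mem j hc.ms0 hc.hs0) x (n := n))
    have a2 := abs_diff_le_one (hc.hr0 x) (stepFn_mem zero_le_one (fun j => avg1_mem j hc.mr0 hc.hr0) x (n := n))
    simp only [E0f]; linarith
  have mE2 : Measurable (fun p : ℝ × ℝ => E p.1 p.2 ^ 2) := mE.pow_const 2
  set G : ℝ → ℝ := fun t => ∫ x, E t x ^ 2 ∂mu01 with hG
  have mG : Measurable G := (mE2.stronglyMeasurable.integral_prod_right' (ν := mu01)).measurable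
  have G0 : ∀ t, 0 ≤ G t := fun t => integral_nonneg fun x => sq_nonneg _
  have iE2 : ∀ t, Integrable (fun x => E t x ^ 2) mu01 := fun t =>
    int_bdd ((meas_slice mE t).pow_const 2) (C := 2^2) fun x => by
      rw [abs_of_nonneg (sq_nonneg _)]; exact pow_le_pow_left₀ (hE t x).1 (hE t x).2 2
  have Gb : ∀ t, G t ≤ 2^2 := fun t => by
    have := integral_mono (iE2 t) (integrable_const ((2:ℝ)^2)) (fun x => pow_le_pow_left₀ (hE t x).1 (hE t x).2 2)
    simpa using this
  -- the majorant
  set δ : ℝ → ℝ → ℝ := fun t x => ∫ y, dfun W β n t x y ∂mu01 with hδ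
  set ω : ℝ → ℝ → ℝ := fun t x => ∫ y, stepKer n (fun j k => avg2 n j k (W t)) x y ^ 2 ∂mu01 with hω
  set κ : ℝ → ℝ → ℝ := fun t x => (γ t x - stepFn n (fun j => avg1 n j (γ t)) x)^2 with hκ
  have mδ : Measurable (fun p : ℝ × ℝ => δ p.1 p.2) := meas_int3 (h.mdfun n)
  have mω : Measurable (fun p : ℝ × ℝ => ω p.1 p.2) :=
    meas_int3 (f := fun t x y => stepKer n (fun j k => avg2 n j k (W t)) x y ^ 2) ((h.mWn n).pow_const 2)
  have mκ : Measurable (fun p : ℝ × ℝ => κ p.1 p.2) := (h.mγ.sub (h.mγn n)).pow_const 2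
  have δ0 : ∀ t x, 0 ≤ δ t x := fun t x => integral_nonneg fun y => sq_nonneg _
  have ω0 : ∀ t x, 0 ≤ ω t x := fun t x => integral_nonneg fun y => sq_nonneg _
  have κ0 : ∀ t x, 0 ≤ κ t x := fun t x => sq_nonneg _
  have iδ : ∀ t, Integrable (δ t) mu01 := fun t => (h.idfun n t).integral_prod_left
  have iω : ∀ t, Integrable (ω t) mu01 := fun t => (h.iWn2 n t).integral_prod_left
  have iκ : ∀ t, Integrable (κ t) mu01 := fun t => int_bdd (meas_slice mκ t) (C := C^2) fun x => by
    rw [abs_of_nonneg (sq_nonneg _)]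
    have h1 := h.hγ t x
    have h2 := h.bγn n t x
    exact sq_le_sq' (by linarith) (by linarith)
  have eδ : ∀ t, ∫ x, δ t x ∂mu01 = Dn W β n t := fun t => by
    unfold Dn; rw [integral_prod _ (h.idfun n t)]
  have eω : ∀ t, ∫ x, ω t x ∂mu01 ≤ w2f W t := fun t => by
    have := integral_stepKer_sq_le (h.W1 t) (h.W2 t) hn
    rwa [integral_prod _ (h.iWn2 n t)] at this
  set Q : ℝ → ℝ → ℝ := fun t x => (4 * δ t x + (4 * C^2 * G t) * ω t x) + (4 * κ t x + (4 * C^2) * E t x ^ 2) with hQd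
  have mQ : Measurable (fun p : ℝ × ℝ => Q p.1 p.2) :=
    ((mδ.const_mul 4).add (((mG.comp measurable_fst).const_mul (4 * C^2)).mul mω)).add
      ((mκ.const_mul 4).add (mE2.const_mul _))
  have Q0 : ∀ t x, 0 ≤ Q t x := fun t x => by
    have := δ0 t x; have := ω0 t x; have := κ0 t x; have := G0 t
    positivity
  have iQ1 : ∀ t, Integrable (fun x => 4 * δ t x + (4 * C^2 * G t) * ω t x) mu01 := fun t =>
    ((iδ t).const_mul 4).add ((iω t).const_mul _)
  have iQ2 : ∀ t, Integrable (fun x => 4 * κ t x + (4 * C^2) * E t x ^ 2) mu01 := fun t =>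
    ((iκ t).const_mul 4).add ((iE2 t).const_mul _)
  have iQs : ∀ t, Integrable (Q t) mu01 := fun t => (iQ1 t).add (iQ2 t)
  have eQ : ∀ t, ∫ x, Q t x ∂mu01 ≤ (4 * Dn W β n t + 4 * Gn γ n t) + (4 * C^2 * (w2f W t + 1)) * G t := fun t => by
    simp only [hQd]
    rw [integral_add (iQ1 t) (iQ2 t), integral_add ((iδ t).const_mul 4) ((iω t).const_mul _),
      integral_add ((iκ t).const_mul 4) ((iE2 t).const_mul _), integral_const_mul, integral_const_mul,
      integral_const_mul, integral_const_mul, eδ]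
    have e1 : ∫ x, κ t x ∂mu01 = Gn γ n t := rfl
    have e2 : ∫ x, E t x ^ 2 ∂mu01 = G t := rfl
    rw [e1, e2]
    have := mul_le_mul_of_nonneg_left (eω t) (show 0 ≤ 4 * C^2 * G t by have := G0 t; positivity)
    linarith
  have ia : IntegrableOn (fun t => 4 * C^2 * (w2f W t + 1)) (Icc 0 T) :=
    (h.iw2'.add (integrable_const (1:ℝ))).const_mul _
  have a0 : ∀ t, 0 ≤ 4 * C^2 * (w2f W t + 1) := fun t => by
    have := w2f_nonneg (W := W) t; positivity
  have idd : IntegrableOn (fun t => 4 * Dn W β n t + 4 * Gn γ n t) (Icc 0 T) :=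
    ((h.iDn hn).const_mul 4).add ((h.iGn n).const_mul 4)
  have d0 : ∀ t, 0 ≤ 4 * Dn W β n t + 4 * Gn γ n t := fun t => by
    have h1 := Dn_nonneg (W := W) (β := β) n t
    have h2 := Gn_nonneg (γ := γ) n t
    positivity
  have iaG : IntegrableOn (fun t => (4 * C^2 * (w2f W t + 1)) * G t) (Icc 0 T) := by
    refine Integrable.mul_bdd (c := 2^2) ia mG.aestronglyMeasurable (ae_of_all _ fun t => ?_)
    rw [Real.norm_eq_abs, abs_of_nonneg (G0 t)]; exact Gb t
  have iQ : Integrable (fun p : ℝ × ℝ => Q p.1 p.2) (ν.prod mu01) :=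
    integrable_tx mQ Q0 iQs (idd.add iaG) (ae_of_all _ eQ)
  -- time-discrete forces
  set Fd : Fin n → ℝ → ℝ := fun j τ => 1 / (n : ℝ) * ∑ k : Fin n, avg1 n k (β τ) * avg2 n j k (W τ) * i k τ with hFd
  have iFd : ∀ j, IntegrableOn (Fd j) (Icc 0 T) := fun j => by
    refine Integrable.const_mul ?_ _
    refine integrable_finsetSum _ fun k _ => ?_
    exact Integrable.mul_bdd (c := 1) (h.iβA j k) (hd.mi k).aestronglyMeasurable (ae_of_all _ fun t => by
      rw [Real.norm_eq_abs, abs_of_nonneg (hd.hi k t).1]; exact (hd.hi k t).2)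
  have mFd : ∀ j, Measurable (Fd j) := fun j => by
    refine Measurable.const_mul ?_ _
    refine Finset.measurable_sum _ fun k _ => ?_
    exact ((meas_avg1 h.mβ k).mul (meas_avg2 h.mW j k)).mul (hd.mi k)
  have mF := h.mFc hc.mi
  have iF := h.iFc hc.mi hc.hi
  -- difference in the infected component
  have hI : ∀ t y, (∃ j, y ∈ Inj n j) → sc t y + ic t y + rc t y = 1 → |ic t y - stepFn n (fun j => i j t) y| ≤ E t y := by
    rintro t y ⟨j, hj⟩ hsum
    simp only [hEd, Ef]
    rw [stepFn_eq hj, stepFn_eq hj, stepFn_eq hj]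
    have e1 : ic t y - i j t = -(sc t y - s j t) + -(rc t y - r j t) := by linarith [hd.hsum j t]
    rw [e1]
    refine (abs_add_le _ _).trans ?_
    rw [abs_neg, abs_neg]
  have hIae : ∀ᵐ t ∂ν, ∀ᵐ y ∂mu01, |ic t y - stepFn n (fun j => i j t) y| ≤ E t y := by
    filter_upwards [Measure.ae_ae_of_ae_prod hc.hsum] with t ht
    filter_upwards [ht, ae_grid] with y h1 h2
    exact hI t y (h2 n hn) h1
  refine gron_2d h.hT mE hE mE0 hE0 mQ iQ ia a0 idd d0 ?_ (ae_of_all _ eQ)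
  filter_upwards [ae_grid, ae_swap' hc.hsum, ae_swap' hc.eqs, ae_swap' hc.eqr, iQ.prod_left_ae, iF.prod_left_ae] with x g1 g2 g3 g4 g5 g6
  obtain ⟨j, hj⟩ := g1 n hn
  have mFx : Measurable (fun τ => Fc W β ic τ x) := mF.comp (measurable_prodMk_right (y := x))
  have msx : Measurable (fun τ => sc τ x) := hc.ms.comp (measurable_prodMk_right (y := x))
  have mix : Measurable (fun τ => ic τ x) := hc.mi.comp (measurable_prodMk_right (y := x))
  have mγx : Measurable (fun τ => γ τ x) := h.mγ.comp (measurable_prodMk_right (y := x))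
  have mγi : Measurable (fun τ => avg1 n j (γ τ) * i j τ) := (meas_avg1 h.mγ j).mul (hd.mi j)
  have ig : IntegrableOn (fun τ => γ τ x * ic τ x) (Icc 0 T) := by
    refine Integrable.of_bound (mγx.mul mix).aestronglyMeasurable C (ae_of_all _ fun τ => ?_)
    have h1 := h.hγ τ x
    have h2 := hc.hi τ x
    rw [Real.norm_eq_abs, abs_of_nonneg (mul_nonneg h1.1 h2.1)]
    nlinarith [h1.1, h1.2, h2.1, h2.2]
  have bγj : ∀ τ, 0 ≤ avg1 n j (γ τ) ∧ avg1 n j (γ τ) ≤ C := fun τ => avg1_mem j (meas_slice h.mγ τ) (h.hγ τ)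
  have igj : IntegrableOn (fun τ => avg1 n j (γ τ) * i j τ) (Icc 0 T) := by
    refine Integrable.of_bound mγi.aestronglyMeasurable C (ae_of_all _ fun τ => ?_)
    have h1 := bγj τ
    have h2 := hd.hi j τ
    rw [Real.norm_eq_abs, abs_of_nonneg (mul_nonneg h1.1 h2.1)]
    nlinarith [h1.1, h1.2, h2.1, h2.2]
  have es := err_s h.hT (S0 := s0 x) (sf := fun τ => sc τ x) (F := fun τ => Fc W β ic τ x) (sj := s j) (Fj := Fd j)
    g6 (iFd j) (fun τ => h.Fc_nonneg hc.hi τ x) msx (fun τ => hc.hs τ x) g3 (hd.eqs j) (fun t _ => hd.hs j t) (hd.cs j)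
  have er := err_r (R0 := r0 x) (rf := fun τ => rc τ x) (rj := r j) ig igj g4 (hd.eqr j)
  have iA1 : IntegrableOn (fun τ => |Fc W β ic τ x - Fd j τ|) (Icc 0 T) := (g6.sub (iFd j)).abs
  have iA2 : IntegrableOn (fun τ => |γ τ x * ic τ x - avg1 n j (γ τ) * i j τ|) (Icc 0 T) := (ig.sub igj).abs
  refine sq_step (q := fun τ => |Fc W β ic τ x - Fd j τ| + |γ τ x * ic τ x - avg1 n j (γ τ) * i j τ|) ?_ g5
    (fun t => (hE t x).1) (fun t => by positivity) ?_ ?_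
  · exact (measurable_norm.comp (mFx.sub (mFd j))).add (measurable_norm.comp ((mγx.mul mix).sub mγi))
  · filter_upwards [g2, hIae] with τ k1 k2
    have q1 := slice_q hn h.hC (u := W τ x) (b := β τ) (I := ic τ) (e := E τ) (B := fun k => avg1 n k (β τ))
      (i := fun k => i k τ) (A := fun j k => avg2 n j k (W τ)) hj (meas_slice (meas_slice3 h.mW τ) x) (h.W2x τ x)
      (meas_slice h.mβ τ) (h.hβ τ) (meas_slice hc.mi τ) (hc.hi τ)
      (fun k => avg1_mem k (meas_slice h.mβ τ) (h.hβ τ)) (iE2 τ) k2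
    have k3 := hI τ x ⟨j, hj⟩ k1
    rw [stepFn_eq hj] at k3
    have q2 := slice_q2 (g := γ τ x) (bγj τ) (hc.hi τ x) k3
    have q1' : (Fc W β ic τ x - Fd j τ)^2 ≤ 2 * δ τ x + 2 * C^2 * ω τ x * G τ := q1
    have q3 : κ τ x = (γ τ x - avg1 n j (γ τ))^2 := by simp only [hκ]; rw [stepFn_eq hj]
    simp only [hQd]
    rw [q3]
    have z1 := sq_abs (Fc W β ic τ x - Fd j τ)
    have z2 := sq_abs (γ τ x * ic τ x - avg1 n j (γ τ) * i j τ)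
    nlinarith [sq_nonneg (|Fc W β ic τ x - Fd j τ| - |γ τ x * ic τ x - avg1 n j (γ τ) * i j τ|)]
  · filter_upwards [es, er, ae_restrict_mem measurableSet_Icc] with t k1 k2 k3
    rw [intervalIntegral.integral_add (ii_of iA1 k3) (ii_of iA2 k3)]
    simp only [hEd, Ef, E0f]
    rw [stepFn_eq hj, stepFn_eq hj, stepFn_eq hj, stepFn_eq hj, ← hd.is, ← hd.ir]
    linarith


lemma vol_restrict3 (T : ℝ) : (volume : Measure (ℝ × ℝ × ℝ)).restrict (Icc 0 T ×ˢ Icc (0:ℝ) 1 ×ˢ Icc (0:ℝ) 1)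
    = (volume.restrict (Icc 0 T)).prod (mu01.prod mu01) := by
  unfold mu01
  rw [Measure.prod_restrict, Measure.prod_restrict]; rfl

lemma vol_restrict2 (T : ℝ) : (volume : Measure (ℝ × ℝ)).restrict (Icc 0 T ×ˢ Icc (0:ℝ) 1)
    = (volume.restrict (Icc 0 T)).prod mu01 := by
  unfold mu01
  rw [Measure.prod_restrict]; rfl

lemma int_of_lint {α : Type*} [MeasurableSpace α] {μ : Measure α} {f : α → ℝ} (mf : Measurable f) (f0 : ∀ a, 0 ≤ f a)
    (h : ∫⁻ a, ENNReal.ofReal (f a) ∂μ < ⊤) : Integrable f μ := by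
  refine ⟨mf.aestronglyMeasurable, ?_⟩
  rw [hasFiniteIntegral_iff_ofReal (ae_of_all _ f0)]; exact h

lemma lint_of_int {α : Type*} [MeasurableSpace α] {μ : Measure α} {f : α → ℝ} (f0 : ∀ a, 0 ≤ f a)
    (h : Integrable f μ) : ∫⁻ a, ENNReal.ofReal (f a) ∂μ < ⊤ :=
  (hasFiniteIntegral_iff_ofReal (ae_of_all _ f0)).1 h.2

lemma cleanW {T : ℝ} {W : ℝ → ℝ → ℝ → ℝ}
    (mW : Measurable (fun p : ℝ × ℝ × ℝ => W p.1 p.2.1 p.2.2))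
    (hW0 : ∀ᵐ p ∂((volume.restrict (Icc 0 T)).prod (mu01.prod mu01)), 0 ≤ W p.1 p.2.1 p.2.2)
    (hW2 : Integrable (fun p : ℝ × ℝ × ℝ => (W p.1 p.2.1 p.2.2) ^ 2) ((volume.restrict (Icc 0 T)).prod (mu01.prod mu01))) :
    ∃ V : ℝ → ℝ → ℝ → ℝ, Measurable (fun p : ℝ × ℝ × ℝ => V p.1 p.2.1 p.2.2) ∧ (∀ t x y, 0 ≤ V t x y) ∧
      (∀ t, Integrable (fun p : ℝ × ℝ => V t p.1 p.2 ^ 2) (mu01.prod mu01)) ∧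
      (∀ t x, Integrable (fun y => V t x y ^ 2) mu01) ∧
      IntegrableOn (fun t => ∫ p : ℝ × ℝ, V t p.1 p.2 ^ 2 ∂(mu01.prod mu01)) (Icc 0 T) ∧
      ∀ᵐ t ∂(volume.restrict (Icc 0 T)), ∀ᵐ x ∂mu01, ∀ᵐ y ∂mu01, W t x y = V t x y := by
  set ν := volume.restrict (Icc 0 T) with hν
  set L1 : ℝ → ENNReal := fun t => ∫⁻ p : ℝ × ℝ, ENNReal.ofReal (W t p.1 p.2 ^ 2) ∂(mu01.prod mu01) with hL1
  set L2 : ℝ × ℝ → ENNReal := fun q => ∫⁻ y, ENNReal.ofReal (W q.1 q.2 y ^ 2) ∂mu01 with hL2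
  have mL1 : Measurable L1 := (ENNReal.measurable_ofReal.comp (mW.pow_const 2)).lintegral_prod_right'
  have mL2 : Measurable L2 := (ENNReal.measurable_ofReal.comp ((meas_3to21 mW).pow_const 2)).lintegral_prod_right'
  set A : Set (ℝ × ℝ × ℝ) := {p | L1 p.1 < ⊤ ∧ L2 (p.1, p.2.1) < ⊤} with hA
  have mA : MeasurableSet A :=
    (measurableSet_lt (mL1.comp measurable_fst) measurable_const).inter
      (measurableSet_lt (mL2.comp (measurable_fst.prodMk measurable_snd.fst)) measurable_const)
  set V : ℝ → ℝ → ℝ → ℝ := fun t x y => A.indicator (fun p => max (W p.1 p.2.1 p.2.2) 0) (t, x, y) with hV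
  have mV : Measurable (fun p : ℝ × ℝ × ℝ => V p.1 p.2.1 p.2.2) := (mW.max measurable_const).indicator mA
  have V0 : ∀ t x y, 0 ≤ V t x y := fun t x y => indicator_nonneg (fun p _ => le_max_right _ _) _
  have Vle : ∀ t x y, V t x y ^ 2 ≤ W t x y ^ 2 := by
    intro t x y
    simp only [hV, indicator]
    split_ifs
    · rcases le_total (W t x y) 0 with h | h
      · simp only [max_eq_right h]; nlinarith [sq_nonneg (W t x y)]
      · simp only [max_eq_left h]; exact le_refl _
    · nlinarith [sq_nonneg (W t x y)]
  have V2t : ∀ t, Integrable (fun p : ℝ × ℝ => V t p.1 p.2 ^ 2) (mu01.prod mu01) := by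
    intro t
    by_cases h : L1 t < ⊤
    · have := int_of_lint ((meas_slice3 mW t).pow_const 2) (fun a => sq_nonneg _) h
      refine this.mono' ((meas_slice3 mV t).pow_const 2).aestronglyMeasurable (ae_of_all _ fun p => ?_)
      rw [Real.norm_eq_abs, abs_of_nonneg (sq_nonneg _)]; exact Vle _ _ _
    · have : (fun p : ℝ × ℝ => V t p.1 p.2 ^ 2) = fun _ => 0 := by
        funext p
        have : (t, p.1, p.2) ∉ A := fun hh => h hh.1
        simp only [hV, indicator_of_notMem this]; norm_num
      rw [this]; exact integrable_zero _ _ _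
  have V2x : ∀ t x, Integrable (fun y => V t x y ^ 2) mu01 := by
    intro t x
    by_cases h : L2 (t, x) < ⊤
    · have := int_of_lint ((meas_slice (meas_slice3 mW t) x).pow_const 2) (fun a => sq_nonneg _) h
      refine this.mono' ((meas_slice (meas_slice3 mV t) x).pow_const 2).aestronglyMeasurable (ae_of_all _ fun p => ?_)
      rw [Real.norm_eq_abs, abs_of_nonneg (sq_nonneg _)]; exact Vle _ _ _
    · have : (fun y => V t x y ^ 2) = fun _ => 0 := by
        funext p
        have : (t, x, p) ∉ A := fun hh => h hh.2
        simp only [hV, indicator_of_notMem this]; norm_num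
      rw [this]; exact integrable_zero _ _ _
  have iV : Integrable (fun p : ℝ × ℝ × ℝ => V p.1 p.2.1 p.2.2 ^ 2) (ν.prod (mu01.prod mu01)) := by
    refine hW2.mono' (mV.pow_const 2).aestronglyMeasurable (ae_of_all _ fun p => ?_)
    rw [Real.norm_eq_abs, abs_of_nonneg (sq_nonneg _)]; exact Vle _ _ _
  refine ⟨V, mV, V0, V2t, V2x, iV.integral_prod_left, ?_⟩
  filter_upwards [Measure.ae_ae_of_ae_prod hW0, hW2.prod_right_ae] with t h1 h2
  have h2' : L1 t < ⊤ := lint_of_int (fun a => sq_nonneg _) h2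
  filter_upwards [Measure.ae_ae_of_ae_prod h1, h2.prod_right_ae] with x h3 h4
  have h4' : L2 (t, x) < ⊤ := lint_of_int (fun a => sq_nonneg _) h4
  filter_upwards [h3] with y h5
  have : (t, x, y) ∈ A := ⟨h2', h4'⟩
  simp only [hV, indicator_of_mem this]
  exact (max_eq_left h5).symm

noncomputable def clip (C a : ℝ) : ℝ := max 0 (min a C)
lemma clip_mem {C : ℝ} (hC : 0 ≤ C) (a : ℝ) : 0 ≤ clip C a ∧ clip C a ≤ C :=
  ⟨le_max_left _ _, max_le hC (min_le_right _ _)⟩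
lemma clip_eq {C a : ℝ} (h0 : 0 ≤ a) (h1 : a ≤ C) : clip C a = a := by
  unfold clip; rw [min_eq_left h1, max_eq_right h0]
lemma clip_cont (C : ℝ) : Continuous (clip C) := by unfold clip; fun_prop

lemma ae_Inj {n : ℕ} (j : Fin n) {P : ℝ → Prop} (h : ∀ᵐ x ∂mu01, P x) : ∀ᵐ x ∂(volume.restrict (Inj n j)), P x :=
  ae_restrict_of_ae_restrict_of_subset (Inj_sub n j) h

lemma avg1_congr {n : ℕ} (j : Fin n) {u v : ℝ → ℝ} (h : ∀ᵐ x ∂mu01, u x = v x) : avg1 n j u = avg1 n j v := by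
  unfold avg1; rw [integral_congr_ae (ae_Inj j h)]

lemma avg2_congr {n : ℕ} (j k : Fin n) {u v : ℝ → ℝ → ℝ} (h : ∀ᵐ x ∂mu01, ∀ᵐ y ∂mu01, u x y = v x y) :
    avg2 n j k u = avg2 n j k v := by
  unfold avg2
  congr 1
  refine integral_congr_ae (ae_Inj j ?_)
  filter_upwards [h] with x hx
  exact integral_congr_ae (ae_Inj k hx)


lemma build_cont {T C : ℝ} {W W' : ℝ → ℝ → ℝ → ℝ} {β γ β' γ' : ℝ → ℝ → ℝ} {s0 i0 r0 s0' r0' : ℝ → ℝ}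
    {sc ic rc sc' ic' rc' : ℝ → ℝ → ℝ} (h : Coef T C W' β' γ')
    (eW : ∀ᵐ t ∂(volume.restrict (Icc 0 T)), ∀ᵐ x ∂mu01, ∀ᵐ y ∂mu01, W t x y = W' t x y)
    (eβ : ∀ᵐ t ∂(volume.restrict (Icc 0 T)), ∀ᵐ x ∂mu01, β t x = β' t x)
    (eγ : ∀ᵐ t ∂(volume.restrict (Icc 0 T)), ∀ᵐ x ∂mu01, γ t x = γ' t x)
    (es : ∀ᵐ t ∂(volume.restrict (Icc 0 T)), ∀ᵐ x ∂mu01, sc t x = sc' t x)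
    (ei : ∀ᵐ t ∂(volume.restrict (Icc 0 T)), ∀ᵐ x ∂mu01, ic t x = ic' t x)
    (er : ∀ᵐ t ∂(volume.restrict (Icc 0 T)), ∀ᵐ x ∂mu01, rc t x = rc' t x)
    (es0 : ∀ᵐ x ∂mu01, s0 x = s0' x) (er0 : ∀ᵐ x ∂mu01, r0 x = r0' x)
    (hc : IsDistribSol T W β γ s0 i0 r0 sc ic rc)
    (ms : Measurable (fun p : ℝ × ℝ => sc' p.1 p.2))
    (mi : Measurable (fun p : ℝ × ℝ => ic' p.1 p.2))
    (mr : Measurable (fun p : ℝ × ℝ => rc' p.1 p.2))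
    (hs : ∀ t x, 0 ≤ sc' t x ∧ sc' t x ≤ 1)
    (hi : ∀ t x, 0 ≤ ic' t x ∧ ic' t x ≤ 1)
    (hr : ∀ t x, 0 ≤ rc' t x ∧ rc' t x ≤ 1)
    (ms0 : Measurable s0') (mr0 : Measurable r0')
    (hs0 : ∀ x, 0 ≤ s0' x ∧ s0' x ≤ 1) (hr0 : ∀ x, 0 ≤ r0' x ∧ r0' x ≤ 1)
    (hsum : ∀ᵐ p ∂((volume.restrict (Icc 0 T)).prod mu01), sc' p.1 p.2 + ic' p.1 p.2 + rc' p.1 p.2 = 1) :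
    ContSol T W' β' γ' s0' r0' sc' ic' rc' := by
  set ν := volume.restrict (Icc (0:ℝ) T) with hν
  have bdd : ∀ {f : ℝ → ℝ → ℝ} {c : ℝ}, Measurable (fun p : ℝ × ℝ => f p.1 p.2) → (∀ t x, 0 ≤ f t x ∧ f t x ≤ c) →
      Integrable (fun p : ℝ × ℝ => f p.1 p.2) (ν.prod mu01) := fun {f c} mf hf =>
    Integrable.of_bound mf.aestronglyMeasurable c (ae_of_all _ fun p => by
      rw [Real.norm_eq_abs, abs_of_nonneg (hf _ _).1]; exact (hf _ _).2)
  have bdd0 : ∀ {f : ℝ → ℝ}, Measurable f → (∀ x, 0 ≤ f x ∧ f x ≤ 1) → IntegrableOn f (Icc 0 1) := fun {f} mf hf =>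
    Integrable.of_bound mf.aestronglyMeasurable 1 (ae_of_all _ fun p => by
      rw [Real.norm_eq_abs, abs_of_nonneg (hf _).1]; exact (hf _).2)
  have eF : ∀ᵐ t ∂ν, ∀ᵐ x ∂mu01, (∫ y in Icc (0:ℝ) 1, β t y * W t x y * ic t y) = Fc W' β' ic' t x := by
    filter_upwards [eW, eβ, ei] with t h1 h2 h3
    filter_upwards [h1] with x h1
    refine integral_congr_ae ?_
    filter_upwards [h1, h2, h3] with y h1 h2 h3
    simp only [h1, h2, h3]
  refine ⟨ms, mi, mr, hs, hi, hr, ms0, mr0, hs0, hr0, hsum, ?_, ?_⟩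
  · have mg : Measurable (fun p : ℝ × ℝ => -(sc' p.1 p.2 * Fc W' β' ic' p.1 p.2)) := (ms.mul (h.mFc mi)).neg
    have ig : Integrable (fun p : ℝ × ℝ => -(sc' p.1 p.2 * Fc W' β' ic' p.1 p.2)) (ν.prod mu01) := by
      have := (Integrable.bdd_mul (c := 1) (h.iFc mi hi) ms.aestronglyMeasurable (ae_of_all _ fun p => by
        rw [Real.norm_eq_abs, abs_of_nonneg (hs _ _).1]; exact (hs _ _).2)).neg
      exact this
    have key := weak_2d h.hT (u := sc') (g := fun t x => -(sc' t x * Fc W' β' ic' t x)) (u0 := s0') mg (bdd ms hs) ig (bdd0 ms0 hs0) ?_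
    · filter_upwards [key] with p hp
      rw [hp, intervalIntegral.integral_neg]; rfl
    · intro φ hφ
      refine Eq.trans ?_ (hc.2.2.2.1 φ hφ)
      congr 1
      · refine integral_congr_ae ?_
        filter_upwards [eF, es] with t h1 h2
        refine integral_congr_ae ?_
        filter_upwards [h1, h2] with x h1 h2
        rw [h1, h2]; ring
      · refine integral_congr_ae ?_
        filter_upwards [es0] with x h1
        rw [h1]
  · have mg : Measurable (fun p : ℝ × ℝ => γ' p.1 p.2 * ic' p.1 p.2) := h.mγ.mul mi
    have ig : Integrable (fun p : ℝ × ℝ => γ' p.1 p.2 * ic' p.1 p.2) (ν.prod mu01) :=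
      bdd (f := fun t x => γ' t x * ic' t x) (c := C * 1) mg fun t x => ⟨mul_nonneg (h.hγ t x).1 (hi t x).1,
        mul_le_mul (h.hγ t x).2 (hi t x).2 (hi t x).1 h.hC⟩
    refine weak_2d h.hT (u := rc') (g := fun t x => γ' t x * ic' t x) (u0 := r0') mg (bdd mr hr) ig (bdd0 mr0 hr0) ?_
    intro φ hφ
    refine Eq.trans ?_ (hc.2.2.2.2.2 φ hφ)
    congr 1
    · refine integral_congr_ae ?_
      filter_upwards [eγ, er, ei] with t h1 h2 h3
      refine integral_congr_ae ?_
      filter_upwards [h1, h2, h3] with x h1 h2 h3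
      rw [h1, h2, h3]; ring
    · refine integral_congr_ae ?_
      filter_upwards [er0] with x h1
      rw [h1]

lemma ii_congr {T t : ℝ} (ht : t ∈ Icc 0 T) {f g : ℝ → ℝ} (h : ∀ᵐ τ ∂(volume.restrict (Icc 0 T)), f τ = g τ) :
    ∫ τ in (0:ℝ)..t, f τ = ∫ τ in (0:ℝ)..t, g τ := by
  rw [intervalIntegral.integral_of_le ht.1, intervalIntegral.integral_of_le ht.1]
  refine integral_congr_ae (ae_restrict_of_ae_restrict_of_subset ?_ h)
  exact fun x hx => ⟨hx.1.le, hx.2.trans ht.2⟩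

lemma build_disc {T C : ℝ} {n : ℕ} {W W' : ℝ → ℝ → ℝ → ℝ} {β γ β' γ' : ℝ → ℝ → ℝ} {s0 i0 r0 s0' i0' r0' : ℝ → ℝ}
    {s i r : Fin n → ℝ → ℝ} (h : Coef T C W' β' γ')
    (eW : ∀ᵐ t ∂(volume.restrict (Icc 0 T)), ∀ᵐ x ∂mu01, ∀ᵐ y ∂mu01, W t x y = W' t x y)
    (eβ : ∀ᵐ t ∂(volume.restrict (Icc 0 T)), ∀ᵐ x ∂mu01, β t x = β' t x)
    (eγ : ∀ᵐ t ∂(volume.restrict (Icc 0 T)), ∀ᵐ x ∂mu01, γ t x = γ' t x)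
    (es0 : ∀ᵐ x ∂mu01, s0 x = s0' x) (ei0 : ∀ᵐ x ∂mu01, i0 x = i0' x) (er0 : ∀ᵐ x ∂mu01, r0 x = r0' x)
    (ms0 : Measurable s0') (mi0 : Measurable i0') (mr0 : Measurable r0')
    (hs0 : ∀ x, 0 ≤ s0' x ∧ s0' x ≤ 1) (hi0 : ∀ x, 0 ≤ i0' x ∧ i0' x ≤ 1) (hr0 : ∀ x, 0 ≤ r0' x ∧ r0' x ≤ 1)
    (hsum0 : ∀ᵐ x ∂mu01, s0' x + i0' x + r0' x = 1)
    (hsol : IsGraphSIRSol n (Set.Icc 0 T)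
      (fun j t => avg1 n j (β t)) (fun j t => avg1 n j (γ t))
      (fun j k t => avg2 n j k (W t)) s i r)
    (hinit : ∀ j : Fin n, s j 0 = avg1 n j s0 ∧ i j 0 = avg1 n j i0 ∧ r j 0 = avg1 n j r0) :
    Disc T n W' β' γ' s0' r0' (fun j t => s j (clip T t)) (fun j t => i j (clip T t)) (fun j t => r j (clip T t)) := by
  have hT := h.hT
  have aβ : ∀ᵐ t ∂(volume.restrict (Icc 0 T)), ∀ j : Fin n, avg1 n j (β t) = avg1 n j (β' t) := by
    filter_upwards [eβ] with t ht j using avg1_congr j ht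
  have aγ : ∀ᵐ t ∂(volume.restrict (Icc 0 T)), ∀ j : Fin n, avg1 n j (γ t) = avg1 n j (γ' t) := by
    filter_upwards [eγ] with t ht j using avg1_congr j ht
  have aW : ∀ᵐ t ∂(volume.restrict (Icc 0 T)), ∀ j k : Fin n, avg2 n j k (W t) = avg2 n j k (W' t) := by
    filter_upwards [eW] with t ht j k using avg2_congr j k ht
  have hsol' : IsGraphSIRSol n (Set.Icc 0 T)
      (fun j t => avg1 n j (β' t)) (fun j t => avg1 n j (γ' t))
      (fun j k t => avg2 n j k (W' t)) s i r := by
    refine ⟨hsol.1, fun j t ht => ?_⟩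
    obtain ⟨h1, h2, h3⟩ := hsol.2 j t ht
    refine ⟨h1.trans ?_, h2.trans ?_, h3.trans ?_⟩
    · congr 1
      refine ii_congr ht ?_
      filter_upwards [aβ, aW] with τ b1 b2
      simp only [b1, b2]
    · congr 1
      refine ii_congr ht ?_
      filter_upwards [aβ, aW, aγ] with τ b1 b2 b3
      simp only [b1, b2, b3]
    · congr 1
      refine ii_congr ht ?_
      filter_upwards [aγ] with τ b3
      simp only [b3]
  have is : ∀ j, s j 0 = avg1 n j s0' := fun j => (hinit j).1.trans (avg1_congr j es0)
  have ii : ∀ j, i j 0 = avg1 n j i0' := fun j => (hinit j).2.1.trans (avg1_congr j ei0)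
  have ir : ∀ j, r j 0 = avg1 n j r0' := fun j => (hinit j).2.2.trans (avg1_congr j er0)
  have isum : ∀ j, s j 0 + i j 0 + r j 0 = 1 := by
    intro j
    have hn : 0 < n := lt_of_le_of_lt (Nat.zero_le _) j.2
    have b : ∀ {f : ℝ → ℝ}, Measurable f → (∀ x, 0 ≤ f x ∧ f x ≤ 1) → IntegrableOn f (Inj n j) := fun {f} mf hf => by
      have : IntegrableOn f (Icc 0 1) := Integrable.of_bound mf.aestronglyMeasurable 1 (ae_of_all _ fun p => by
        rw [Real.norm_eq_abs, abs_of_nonneg (hf _).1]; exact (hf _).2)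
      exact this.mono_set (Inj_sub n j)
    have e1 : avg1 n j s0' + avg1 n j i0' + avg1 n j r0' = avg1 n j (fun x => s0' x + i0' x + r0' x) := by
      unfold avg1
      have b2 : IntegrableOn (fun x => s0' x + i0' x) (Inj n j) := (b ms0 hs0).add (b mi0 hi0)
      beta_reduce
      rw [integral_add b2 (b mr0 hr0), integral_add (b ms0 hs0) (b mi0 hi0)]; ring
    have e2 : avg1 n j (fun _ => (1:ℝ)) = 1 := by
      unfold avg1 Inj
      have hn' : (0:ℝ) < n := by exact_mod_cast hn
      simp only [integral_const, smul_eq_mul, mul_one, Measure.real, Measure.restrict_apply_univ, Real.volume_Ioo]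
      rw [ENNReal.toReal_ofReal (by rw [← sub_div]; simp)]
      field_simp; ring
    rw [is, ii, ir, e1, avg1_congr j hsum0, e2]
  have bd := discrete_bounds hT hsol'
    (fun j t => (avg1_mem j (meas_slice h.mβ t) (h.hβ t)).1)
    (fun j k t => avg2_nonneg j k (h.W0 t))
    (fun j t => (avg1_mem j (meas_slice h.mγ t) (h.hγ t)).1)
    (fun j k => h.iβA j k)
    (fun j => Integrable.of_bound (meas_avg1 h.mγ j).aestronglyMeasurable C (ae_of_all _ fun t => by
      have := avg1_mem j (meas_slice h.mγ t) (h.hγ t)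
      rw [Real.norm_eq_abs, abs_of_nonneg this.1]; exact this.2))
    (fun j => by rw [is]; exact avg1_mem j ms0 hs0)
    (fun j => by rw [ii]; exact (avg1_mem j mi0 hi0).1)
  have rpos : ∀ j, ∀ t ∈ Icc 0 T, 0 ≤ r j t := by
    intro j t ht
    rw [(hsol'.2 j t ht).2.2]
    have a1 : 0 ≤ r j 0 := by rw [ir]; exact (avg1_mem j mr0 hr0).1
    have a2 : 0 ≤ ∫ τ in (0:ℝ)..t, avg1 n j (γ' τ) * i j τ :=
      intervalIntegral.integral_nonneg ht.1 fun τ hτ =>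
        mul_nonneg (avg1_mem j (meas_slice h.mγ τ) (h.hγ τ)).1 (bd j τ ⟨hτ.1, hτ.2.trans ht.2⟩).2.1
    exact add_nonneg a1 a2
  have cm : ∀ t, clip T t ∈ Icc 0 T := fun t => clip_mem hT.le t
  have ce : ∀ t ∈ Icc 0 T, clip T t = t := fun t ht => clip_eq ht.1 ht.2
  have c0 : clip T 0 = 0 := clip_eq le_rfl hT.le
  have mcl : ∀ {f : ℝ → ℝ}, ContinuousOn f (Icc 0 T) → Continuous (fun t => f (clip T t)) := fun hf =>
    hf.comp_continuous (clip_cont T) cm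
  have all : ∀ j, ∀ t ∈ Icc 0 T, (0 ≤ s j t ∧ s j t ≤ 1) ∧ (0 ≤ i j t ∧ i j t ≤ 1) ∧ (0 ≤ r j t ∧ r j t ≤ 1) ∧ s j t + i j t + r j t = 1 := by
    intro j t ht
    obtain ⟨h1, h2, h3⟩ := bd j t ht
    have h4 := rpos j t ht
    rw [isum] at h3
    exact ⟨h1, ⟨h2, by linarith [h1.1]⟩, ⟨h4, by linarith [h1.1]⟩, h3⟩
  have aecl : ∀ᵐ τ ∂(volume.restrict (Icc 0 T)), clip T τ = τ := by
    filter_upwards [ae_restrict_mem measurableSet_Icc] with τ hτ using ce τ hτ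
  exact {
    ms := fun j => (mcl (hsol.1 j).1).measurable
    mi := fun j => (mcl (hsol.1 j).2.1).measurable
    mr := fun j => (mcl (hsol.1 j).2.2).measurable
    cs := fun j => (mcl (hsol.1 j).1).continuousOn
    hs := fun j t => (all j _ (cm t)).1
    hi := fun j t => (all j _ (cm t)).2.1
    hr := fun j t => (all j _ (cm t)).2.2.1
    hsum := fun j t => (all j _ (cm t)).2.2.2
    eqs := fun j t ht => by
      simp only [ce t ht, c0]
      rw [(hsol'.2 j t ht).1]
      congr 1
      refine ii_congr ht ?_
      filter_upwards [aecl] with τ hτ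
      simp only [hτ]
    eqr := fun j t ht => by
      simp only [ce t ht, c0]
      rw [(hsol'.2 j t ht).2.2]
      congr 1
      refine ii_congr ht ?_
      filter_upwards [aecl] with τ hτ
      simp only [hτ]
    is := fun j => by simp only [c0]; exact is j
    ir := fun j => by simp only [c0]; exact ir j }


lemma L2dist_le {f g E : ℝ → ℝ} {B : ℝ} (iE : Integrable (fun x => E x ^ 2) mu01)
    (h : ∀ᵐ x ∂mu01, |f x - g x| ≤ E x) (hB : ∫ x, E x ^ 2 ∂mu01 ≤ B) : L2dist f g ≤ Real.sqrt B := by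
  unfold L2dist
  refine Real.sqrt_le_sqrt (le_trans ?_ hB)
  refine integral_mono_of_nonneg (ae_of_all _ fun x => sq_nonneg _) iE ?_
  filter_upwards [h] with x hx
  beta_reduce
  rw [← sq_abs]; exact pow_le_pow_left₀ (abs_nonneg _) hx 2

lemma final_bound {T : ℝ} {W : ℝ → ℝ → ℝ → ℝ} {β γ : ℝ → ℝ → ℝ} {s0 r0 : ℝ → ℝ} {sc ic rc sc' ic' rc' : ℝ → ℝ → ℝ}
    {n : ℕ} {s i r : Fin n → ℝ → ℝ} {B : ℝ} (hn : 0 < n)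
    (hc : ContSol T W β γ s0 r0 sc' ic' rc')
    (hd : Disc T n W β γ s0 r0 (fun j t => s j (clip T t)) (fun j t => i j (clip T t)) (fun j t => r j (clip T t)))
    (es : ∀ᵐ t ∂(volume.restrict (Icc 0 T)), ∀ᵐ x ∂mu01, sc t x = sc' t x)
    (ei : ∀ᵐ t ∂(volume.restrict (Icc 0 T)), ∀ᵐ x ∂mu01, ic t x = ic' t x)
    (er : ∀ᵐ t ∂(volume.restrict (Icc 0 T)), ∀ᵐ x ∂mu01, rc t x = rc' t x)
    (hb : ∀ᵐ t ∂(volume.restrict (Icc (0:ℝ) T)), ∫ x, Ef sc' rc' (fun j t => s j (clip T t)) (fun j t => r j (clip T t)) t x ^ 2 ∂mu01 ≤ B) :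
    ∀ᵐ t ∂(volume.restrict (Icc (0:ℝ) T)),
      L2dist (sc t) (fun x => stepFn n (fun j => s j t) x)
        + L2dist (ic t) (fun x => stepFn n (fun j => i j t) x)
        + L2dist (rc t) (fun x => stepFn n (fun j => r j t) x) ≤ 3 * Real.sqrt B := by
  have hsum := Measure.ae_ae_of_ae_prod hc.hsum
  filter_upwards [es, ei, er, hb, hsum, ae_restrict_mem measurableSet_Icc] with t h1 h2 h3 h4 h5 ht
  have hcl : clip T t = t := clip_eq ht.1 ht.2
  set E : ℝ → ℝ := Ef sc' rc' (fun j t => s j (clip T t)) (fun j t => r j (clip T t)) t with hE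
  have Ee : ∀ x, E x = |sc' t x - stepFn n (fun j => s j t) x| + |rc' t x - stepFn n (fun j => r j t) x| := fun x => by
    simp only [hE, Ef, hcl]
  have ds : ∀ j, 0 ≤ s j t ∧ s j t ≤ 1 := fun j => by have := hd.hs j t; simpa only [hcl] using this
  have dr : ∀ j, 0 ≤ r j t ∧ r j t ≤ 1 := fun j => by have := hd.hr j t; simpa only [hcl] using this
  have dsum : ∀ j, s j t + i j t + r j t = 1 := fun j => by have := hd.hsum j t; simpa only [hcl] using this
  have mE : Measurable E := by
    have : E = fun x => |sc' t x - stepFn n (fun j => s j t) x| + |rc' t x - stepFn n (fun j => r j t) x| := funext Ee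
    rw [this]
    exact (measurable_norm.comp ((meas_slice hc.ms t).sub (stepFn_meas n _))).add
      (measurable_norm.comp ((meas_slice hc.mr t).sub (stepFn_meas n _)))
  have iE : Integrable (fun x => E x ^ 2) mu01 := by
    refine int_bdd (mE.pow_const 2) (C := 2^2) fun x => ?_
    have a1 := abs_diff_le_one (hc.hs t x) (stepFn_mem zero_le_one ds x)
    have a2 := abs_diff_le_one (hc.hr t x) (stepFn_mem zero_le_one dr x)
    rw [abs_of_nonneg (sq_nonneg _)]
    refine pow_le_pow_left₀ ?_ ?_ 2
    · rw [Ee]; positivity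
    · rw [Ee]; linarith
  have b1 : L2dist (sc t) (fun x => stepFn n (fun j => s j t) x) ≤ √B := by
    refine L2dist_le iE ?_ h4
    filter_upwards [h1] with x hx
    rw [hx, Ee]; exact le_add_of_nonneg_right (abs_nonneg _)
  have b2 : L2dist (rc t) (fun x => stepFn n (fun j => r j t) x) ≤ √B := by
    refine L2dist_le iE ?_ h4
    filter_upwards [h3] with x hx
    rw [hx, Ee]; exact le_add_of_nonneg_left (abs_nonneg _)
  have b3 : L2dist (ic t) (fun x => stepFn n (fun j => i j t) x) ≤ √B := by
    refine L2dist_le iE ?_ h4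
    filter_upwards [h2, h5, ae_grid] with x hx hx5 hg
    obtain ⟨j, hj⟩ := hg n hn
    rw [hx, Ee, stepFn_eq hj, stepFn_eq hj, stepFn_eq hj]
    have := dsum j
    have e : ic' t x - i j t = -((sc' t x - s j t) + (rc' t x - r j t)) := by
      have hx5' : sc' t x + ic' t x + rc' t x = 1 := hx5
      linarith
    rw [e, abs_neg]; exact abs_add_le _ _
  linarith

lemma essSup_bounds {T : ℝ} (hT : 0 < T) {f : ℝ → ℝ} {B : ℝ} (f0 : ∀ t, 0 ≤ f t)
    (hf : ∀ᵐ t ∂(volume.restrict (Icc (0:ℝ) T)), f t ≤ B) :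
    0 ≤ essSup f (volume.restrict (Icc (0:ℝ) T)) ∧ essSup f (volume.restrict (Icc (0:ℝ) T)) ≤ B := by
  have hne : NeZero (volume.restrict (Icc (0:ℝ) T)) := ⟨by
    rw [Ne, Measure.restrict_eq_zero, Real.volume_Icc]
    simpa using hT⟩
  have low : ∀ a, (∀ᵐ t ∂(volume.restrict (Icc (0:ℝ) T)), f t ≤ a) → 0 ≤ a := fun a ha => by
    obtain ⟨t, ht⟩ := ha.exists
    exact (f0 t).trans ht
  unfold essSup
  rw [limsup_eq]
  refine ⟨le_csInf ⟨B, hf⟩ fun a ha => low a ha, csInf_le ⟨0, fun a ha => low a ha⟩ hf⟩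

lemma tendsto_E0 {s0 r0 : ℝ → ℝ} (ms0 : Measurable s0) (mr0 : Measurable r0)
    (hs0 : ∀ x, 0 ≤ s0 x ∧ s0 x ≤ 1) (hr0 : ∀ x, 0 ≤ r0 x ∧ r0 x ≤ 1) :
    Tendsto (fun n => ∫ x, E0f n s0 r0 x ^ 2 ∂mu01) atTop (nhds 0) := by
  have i1 : ∀ {f : ℝ → ℝ} (n : ℕ), Measurable f → (∀ x, 0 ≤ f x ∧ f x ≤ 1) →
      Integrable (fun x => (f x - stepFn n (fun j => avg1 n j f) x)^2) mu01 := fun {f} n mf hf => by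
    refine int_bdd ((mf.sub (stepFn_meas n _)).pow_const 2) (C := 1^2) fun x => ?_
    rw [abs_of_nonneg (sq_nonneg _), ← sq_abs]
    exact pow_le_pow_left₀ (abs_nonneg _) (abs_diff_le_one (hf x) (stepFn_mem zero_le_one (fun j => avg1_mem j mf hf) x)) 2
  have lim := ((slice_conv1 zero_le_one ms0 hs0).const_mul 2).add ((slice_conv1 zero_le_one mr0 hr0).const_mul 2)
  simp only [mul_zero, add_zero] at lim
  refine squeeze_zero (fun n => integral_nonneg fun x => sq_nonneg _) (fun n => ?_) lim
  rw [← integral_const_mul, ← integral_const_mul, ← integral_add ((i1 n ms0 hs0).const_mul 2) ((i1 n mr0 hr0).const_mul 2)]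
  refine integral_mono_of_nonneg (ae_of_all _ fun x => sq_nonneg _) (((i1 n ms0 hs0).const_mul 2).add ((i1 n mr0 hr0).const_mul 2)) (ae_of_all _ fun x => ?_)
  simp only [E0f, Pi.add_apply]
  rw [← sq_abs (s0 x - _), ← sq_abs (r0 x - _)]
  nlinarith [sq_nonneg (|s0 x - stepFn n (fun j => avg1 n j s0) x| - |r0 x - stepFn n (fun j => avg1 n j r0) x|)]

/-- deterministic approximation, $L^2$ case (Theorem 1.3). -/
theorem graphSIR_deterministic_approx_L2
    (T : ℝ) (hT : 0 < T)
    (W : ℝ → ℝ → ℝ → ℝ)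
    (hWmeas : Measurable (fun p : ℝ × ℝ × ℝ => W p.1 p.2.1 p.2.2))
    (hWL1 : IntegrableOn (fun p : ℝ × ℝ × ℝ => W p.1 p.2.1 p.2.2)
      (Set.Icc 0 T ×ˢ Set.Icc (0:ℝ) 1 ×ˢ Set.Icc (0:ℝ) 1))
    (hW0 : ∀ᵐ p ∂((volume : Measure (ℝ × ℝ × ℝ)).restrict
      (Set.Icc 0 T ×ˢ Set.Icc (0:ℝ) 1 ×ˢ Set.Icc (0:ℝ) 1)), 0 ≤ W p.1 p.2.1 p.2.2)
    (hWsym : ∀ᵐ p ∂((volume : Measure (ℝ × ℝ × ℝ)).restrict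
      (Set.Icc 0 T ×ˢ Set.Icc (0:ℝ) 1 ×ˢ Set.Icc (0:ℝ) 1)),
      W p.1 p.2.1 p.2.2 = W p.1 p.2.2 p.2.1)
    (β γ : ℝ → ℝ → ℝ)
    (hβm : Measurable (fun p : ℝ × ℝ => β p.1 p.2))
    (hγm : Measurable (fun p : ℝ × ℝ => γ p.1 p.2))
    (hβb : ∃ C : ℝ, ∀ᵐ p ∂((volume : Measure (ℝ × ℝ)).restrict
      (Set.Icc 0 T ×ˢ Set.Icc (0:ℝ) 1)), |β p.1 p.2| ≤ C)
    (hγb : ∃ C : ℝ, ∀ᵐ p ∂((volume : Measure (ℝ × ℝ)).restrict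
      (Set.Icc 0 T ×ˢ Set.Icc (0:ℝ) 1)), |γ p.1 p.2| ≤ C)
    (hβ0 : ∀ᵐ p ∂((volume : Measure (ℝ × ℝ)).restrict
      (Set.Icc 0 T ×ˢ Set.Icc (0:ℝ) 1)), 0 ≤ β p.1 p.2)
    (hγ0 : ∀ᵐ p ∂((volume : Measure (ℝ × ℝ)).restrict
      (Set.Icc 0 T ×ˢ Set.Icc (0:ℝ) 1)), 0 ≤ γ p.1 p.2)
    (s0 i0 r0 : ℝ → ℝ)
    (hs0m : Measurable s0) (hi0m : Measurable i0) (hr0m : Measurable r0)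
    (hinit : ∀ᵐ x ∂(volume.restrict (Set.Icc (0:ℝ) 1)),
      0 ≤ s0 x ∧ s0 x ≤ 1 ∧ 0 ≤ i0 x ∧ i0 x ≤ 1 ∧ 0 ≤ r0 x ∧ r0 x ≤ 1 ∧
      s0 x + i0 x + r0 x = 1)
    -- the discrete solutions, with averaged coefficients and averaged initial data
    (s i r : (n : ℕ) → Fin n → ℝ → ℝ)
    (hsol : ∀ n : ℕ, IsGraphSIRSol n (Set.Icc 0 T)
      (fun j t => avg1 n j (β t)) (fun j t => avg1 n j (γ t))
      (fun j k t => avg2 n j k (W t)) (s n) (i n) (r n))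
    (hinitn : ∀ n (j : Fin n),
      s n j 0 = avg1 n j s0 ∧ i n j 0 = avg1 n j i0 ∧ r n j 0 = avg1 n j r0)
    -- the continuum solution
    (sc ic rc : ℝ → ℝ → ℝ)
    (hc : IsDistribSol T W β γ s0 i0 r0 sc ic rc)
    (hcb : ∀ᵐ p ∂((volume : Measure (ℝ × ℝ)).restrict (Set.Icc 0 T ×ˢ Set.Icc (0:ℝ) 1)),
      0 ≤ sc p.1 p.2 ∧ sc p.1 p.2 ≤ 1 ∧ 0 ≤ ic p.1 p.2 ∧ ic p.1 p.2 ≤ 1 ∧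
      0 ≤ rc p.1 p.2 ∧ rc p.1 p.2 ≤ 1 ∧ sc p.1 p.2 + ic p.1 p.2 + rc p.1 p.2 = 1)
    (hWL2 : IntegrableOn (fun p : ℝ × ℝ × ℝ => (W p.1 p.2.1 p.2.2) ^ 2)
      (Set.Icc 0 T ×ˢ Set.Icc (0:ℝ) 1 ×ˢ Set.Icc (0:ℝ) 1)) :
    Tendsto (fun n => essSup (fun t =>
        L2dist (sc t) (fun x => stepFn n (fun j => s n j t) x)
        + L2dist (ic t) (fun x => stepFn n (fun j => i n j t) x)
        + L2dist (rc t) (fun x => stepFn n (fun j => r n j t) x))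
      (volume.restrict (Set.Icc 0 T))) atTop (nhds 0) := by
  rw [vol_restrict3] at hW0
  rw [IntegrableOn, vol_restrict3] at hWL2
  rw [vol_restrict2] at hβ0 hγ0 hcb
  obtain ⟨C1, hC1⟩ := hβb
  obtain ⟨C2, hC2⟩ := hγb
  rw [vol_restrict2] at hC1 hC2
  obtain ⟨V, mV, V0, V2, V2x, iV, eW⟩ := cleanW hWmeas hW0 hWL2
  set C : ℝ := max 0 (max C1 C2) with hC
  have C0 : 0 ≤ C := le_max_left _ _
  have hC1' : C1 ≤ C := (le_max_left _ _).trans (le_max_right _ _)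
  have hC2' : C2 ≤ C := (le_max_right _ _).trans (le_max_right _ _)
  have mc : ∀ (D : ℝ) {f : ℝ → ℝ → ℝ}, Measurable (fun p : ℝ × ℝ => f p.1 p.2) →
      Measurable (fun p : ℝ × ℝ => clip D (f p.1 p.2)) := fun D f hf => (clip_cont D).measurable.comp hf
  have mc0 : ∀ (D : ℝ) {f : ℝ → ℝ}, Measurable f →
      Measurable (fun x => clip D (f x)) := fun D f hf => (clip_cont D).measurable.comp hf
  have hcoef : Coef T C V (fun t x => clip C (β t x)) (fun t x => clip C (γ t x)) :=
    { hT := hT, hC := C0, mW := mV, W0 := V0, W2 := V2, W2x := V2x, iw2 := iV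
      mβ := mc C hβm, mγ := mc C hγm
      hβ := fun t x => clip_mem C0 _, hγ := fun t x => clip_mem C0 _ }
  have eβ : ∀ᵐ t ∂(volume.restrict (Icc 0 T)), ∀ᵐ x ∂mu01, β t x = clip C (β t x) := by
    refine Measure.ae_ae_of_ae_prod (p := fun p : ℝ × ℝ => β p.1 p.2 = clip C (β p.1 p.2)) ?_
    filter_upwards [hβ0, hC1] with p h1 h2
    exact (clip_eq h1 ((le_abs_self _).trans (h2.trans hC1'))).symm
  have eγ : ∀ᵐ t ∂(volume.restrict (Icc 0 T)), ∀ᵐ x ∂mu01, γ t x = clip C (γ t x) := by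
    refine Measure.ae_ae_of_ae_prod (p := fun p : ℝ × ℝ => γ p.1 p.2 = clip C (γ p.1 p.2)) ?_
    filter_upwards [hγ0, hC2] with p h1 h2
    exact (clip_eq h1 ((le_abs_self _).trans (h2.trans hC2'))).symm
  have es : ∀ᵐ t ∂(volume.restrict (Icc 0 T)), ∀ᵐ x ∂mu01, sc t x = clip 1 (sc t x) := by
    refine Measure.ae_ae_of_ae_prod (p := fun p : ℝ × ℝ => sc p.1 p.2 = clip 1 (sc p.1 p.2)) ?_
    filter_upwards [hcb] with p h1
    exact (clip_eq h1.1 h1.2.1).symm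
  have ei : ∀ᵐ t ∂(volume.restrict (Icc 0 T)), ∀ᵐ x ∂mu01, ic t x = clip 1 (ic t x) := by
    refine Measure.ae_ae_of_ae_prod (p := fun p : ℝ × ℝ => ic p.1 p.2 = clip 1 (ic p.1 p.2)) ?_
    filter_upwards [hcb] with p h1
    exact (clip_eq h1.2.2.1 h1.2.2.2.1).symm
  have er : ∀ᵐ t ∂(volume.restrict (Icc 0 T)), ∀ᵐ x ∂mu01, rc t x = clip 1 (rc t x) := by
    refine Measure.ae_ae_of_ae_prod (p := fun p : ℝ × ℝ => rc p.1 p.2 = clip 1 (rc p.1 p.2)) ?_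
    filter_upwards [hcb] with p h1
    exact (clip_eq h1.2.2.2.2.1 h1.2.2.2.2.2.1).symm
  have hinit' : ∀ᵐ x ∂mu01, 0 ≤ s0 x ∧ s0 x ≤ 1 ∧ 0 ≤ i0 x ∧ i0 x ≤ 1 ∧ 0 ≤ r0 x ∧ r0 x ≤ 1 ∧
      s0 x + i0 x + r0 x = 1 := hinit
  have es0 : ∀ᵐ x ∂mu01, s0 x = clip 1 (s0 x) := by
    filter_upwards [hinit'] with x h1 using (clip_eq h1.1 h1.2.1).symm
  have ei0 : ∀ᵐ x ∂mu01, i0 x = clip 1 (i0 x) := by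
    filter_upwards [hinit'] with x h1 using (clip_eq h1.2.2.1 h1.2.2.2.1).symm
  have er0 : ∀ᵐ x ∂mu01, r0 x = clip 1 (r0 x) := by
    filter_upwards [hinit'] with x h1 using (clip_eq h1.2.2.2.2.1 h1.2.2.2.2.2.1).symm
  have c1 : ∀ a, 0 ≤ clip 1 a ∧ clip 1 a ≤ 1 := fun a => clip_mem zero_le_one a
  have hcont : ContSol T V (fun t x => clip C (β t x)) (fun t x => clip C (γ t x)) (fun x => clip 1 (s0 x))
      (fun x => clip 1 (r0 x)) (fun t x => clip 1 (sc t x)) (fun t x => clip 1 (ic t x)) (fun t x => clip 1 (rc t x)) := by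
    refine build_cont hcoef eW eβ eγ es ei er es0 er0 hc (mc 1 hc.1) (mc 1 hc.2.1) (mc 1 hc.2.2.1)
      (fun t x => c1 _) (fun t x => c1 _) (fun t x => c1 _) (mc0 1 hs0m) (mc0 1 hr0m) (fun x => c1 _) (fun x => c1 _) ?_
    filter_upwards [hcb] with p h1
    rw [clip_eq h1.1 h1.2.1, clip_eq h1.2.2.1 h1.2.2.2.1, clip_eq h1.2.2.2.2.1 h1.2.2.2.2.2.1]
    exact h1.2.2.2.2.2.2
  have hsum0 : ∀ᵐ x ∂mu01, clip 1 (s0 x) + clip 1 (i0 x) + clip 1 (r0 x) = 1 := by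
    filter_upwards [hinit'] with p h1
    rw [clip_eq h1.1 h1.2.1, clip_eq h1.2.2.1 h1.2.2.2.1, clip_eq h1.2.2.2.2.1 h1.2.2.2.2.2.1]
    exact h1.2.2.2.2.2.2
  have hdisc : ∀ n, Disc T n V (fun t x => clip C (β t x)) (fun t x => clip C (γ t x)) (fun x => clip 1 (s0 x))
      (fun x => clip 1 (r0 x)) (fun j t => s n j (clip T t)) (fun j t => i n j (clip T t)) (fun j t => r n j (clip T t)) :=
    fun n => build_disc hcoef eW eβ eγ es0 ei0 er0 (mc0 1 hs0m) (mc0 1 hi0m) (mc0 1 hr0m)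
      (fun x => c1 _) (fun x => c1 _) (fun x => c1 _) hsum0 (hsol n) (hinitn n)
  set K : ℝ := Real.exp (2 * T * ∫ t in Icc 0 T, 4 * C^2 * (w2f V t + 1)) with hK
  set B : ℕ → ℝ := fun n => (2 * (∫ x, E0f n (fun x => clip 1 (s0 x)) (fun x => clip 1 (r0 x)) x ^ 2 ∂mu01)
    + 2 * T * ∫ t in Icc 0 T, (4 * Dn V (fun t x => clip C (β t x)) n t + 4 * Gn (fun t x => clip C (γ t x)) n t)) * K with hB
  have limB : Tendsto B atTop (nhds 0) := by
    have := (((tendsto_E0 (mc0 1 hs0m) (mc0 1 hr0m) (fun x => c1 _) (fun x => c1 _)).const_mul 2).add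
      (hcoef.tendsto_d.const_mul (2 * T))).mul_const K
    simpa only [mul_zero, add_zero, zero_mul] using this
  have lim3 : Tendsto (fun n => 3 * Real.sqrt (B n)) atTop (nhds 0) := by
    have := ((Real.continuous_sqrt.tendsto 0).comp limB).const_mul 3
    simpa only [Real.sqrt_zero, mul_zero, Function.comp_def] using this
  have main := (eventually_gt_atTop (0:ℕ)).mono fun n hn =>
    essSup_bounds hT (f := fun t =>
        L2dist (sc t) (fun x => stepFn n (fun j => s n j t) x)
        + L2dist (ic t) (fun x => stepFn n (fun j => i n j t) x)
        + L2dist (rc t) (fun x => stepFn n (fun j => r n j t) x))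
      (fun t => add_nonneg (add_nonneg (Real.sqrt_nonneg _) (Real.sqrt_nonneg _)) (Real.sqrt_nonneg _))
      (final_bound hn hcont (hdisc n) es ei er (core hn hcoef hcont (hdisc n)))
  exact squeeze_zero' (main.mono fun n h => h.1) (main.mono fun n h => h.2) lim3


end
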